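/- arXiv:1509.06505 — 3 statements merged into one kernel-verified Lean document; each statement's English description precedes it below -/
import Mathlib

section
/- Let M be an n×n Haar-distributed random orthogonal matrix and let k_1 + ... + k_r = 2k. If X_n = n^k M_1^{k_1}···M_r^{k_r} where M_1,...,M_r are distinct fixed entries of M, and Y = Z_1^{k_1}···Z_r^{k_r} where Z_1,...,Z_r are i.i.d. standard normal random variables, then X_n converges to Y in L¹ (in particular E[X_n] → E[Y]) as n → ∞. -/
open MeasureTheory Matrix

/-- Matrices are measurable as functions to functions (pi measurable structure). -/
instance matrixMeasurableSpace (n : ℕ) : MeasurableSpace (Matrix (Fin n) (Fin n) ℝ) :=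
  inferInstanceAs (MeasurableSpace ((Fin n) → (Fin n) → ℝ))

/-- `μ` is the Haar probability measure on the orthogonal group `O(n)`, viewed as a
measure on `n × n` real matrices: it is a probability measure concentrated on
orthogonal matrices which is invariant under left and right translation by
orthogonal matrices. -/
structure IsHaarOrthogonal (n : ℕ) (μ : Measure (Matrix (Fin n) (Fin n) ℝ)) : Prop where
  isProb : IsProbabilityMeasure μ
  ae_orth : ∀ᵐ M ∂μ, M * Mᵀ = 1
  left_inv : ∀ V : Matrix (Fin n) (Fin n) ℝ, V * Vᵀ = 1 → μ.map (fun M => V * M) = μ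
  right_inv : ∀ V : Matrix (Fin n) (Fin n) ℝ, V * Vᵀ = 1 → μ.map (fun M => M * V) = μ

namespace HaarMoments

instance instBorelMat (n : ℕ) : BorelSpace (Matrix (Fin n) (Fin n) ℝ) :=
  inferInstanceAs (BorelSpace (Fin n → Fin n → ℝ))

instance instSecondCountableMat (n : ℕ) : SecondCountableTopology (Matrix (Fin n) (Fin n) ℝ) :=
  inferInstanceAs (SecondCountableTopology (Fin n → Fin n → ℝ))

/-- The cube of matrices with entries in `[-1,1]`. -/
def cube (n : ℕ) : Set (Matrix (Fin n) (Fin n) ℝ) :=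
  Set.pi Set.univ fun _ => Set.pi Set.univ fun _ => Set.Icc (-1) 1

lemma isCompact_cube (n : ℕ) : IsCompact (cube n) :=
  isCompact_univ_pi fun _ => isCompact_univ_pi fun _ => isCompact_Icc

lemma mem_cube_of_orth {n : ℕ} {M : Matrix (Fin n) (Fin n) ℝ} (h : M * Mᵀ = 1) :
    M ∈ cube n := by
  intro i _ j _
  have h1 : ∑ l, M i l * M i l = 1 := by
    have := congrFun (congrFun h i) i
    simpa [Matrix.mul_apply] using this
  have h2 : M i j * M i j ≤ ∑ l, M i l * M i l :=
    Finset.single_le_sum (f := fun l => M i l * M i l) (fun l _ => mul_self_nonneg _)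
      (Finset.mem_univ j)
  have h3 : |M i j| ≤ 1 := abs_le_one_iff_mul_self_le_one.2 (by linarith)
  exact abs_le.1 h3

section
variable {n : ℕ} {μ : Measure (Matrix (Fin n) (Fin n) ℝ)} {E : Type*}
  [NormedAddCommGroup E] [NormedSpace ℝ E]

lemma ae_cube (hμ : IsHaarOrthogonal n μ) : ∀ᵐ M ∂μ, M ∈ cube n :=
  hμ.ae_orth.mono fun _ h => mem_cube_of_orth h

lemma integrable_cont (hμ : IsHaarOrthogonal n μ) {f : Matrix (Fin n) (Fin n) ℝ → E}
    (hf : Continuous f) : Integrable f μ := by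
  have := hμ.isProb
  obtain ⟨C, hC⟩ := (isCompact_cube n).exists_bound_of_continuousOn hf.continuousOn
  exact Integrable.of_bound hf.aestronglyMeasurable C ((ae_cube hμ).mono fun M hM => hC M hM)

lemma hasDerivAt_int (hμ : IsHaarOrthogonal n μ)
    {G G' : ℝ → Matrix (Fin n) (Fin n) ℝ → E}
    (hG : ∀ θ, Continuous (G θ)) (hG' : Continuous (Function.uncurry G'))
    (hd : ∀ M θ, HasDerivAt (fun θ => G θ M) (G' θ M) θ) (θ₀ : ℝ) :
    HasDerivAt (fun θ => ∫ M, G θ M ∂μ) (∫ M, G' θ₀ M ∂μ) θ₀ := by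
  have := hμ.isProb
  obtain ⟨C, hC⟩ := ((isCompact_Icc (a := θ₀ - 1) (b := θ₀ + 1)).prod
    (isCompact_cube n)).exists_bound_of_continuousOn hG'.continuousOn
  have hs : Set.Icc (θ₀ - 1) (θ₀ + 1) ∈ nhds θ₀ := Icc_mem_nhds (by linarith) (by linarith)
  refine (hasDerivAt_integral_of_dominated_loc_of_deriv_le (bound := fun _ => C) hs
    (Filter.Eventually.of_forall fun θ => (hG θ).aestronglyMeasurable)
    (integrable_cont hμ (hG θ₀)) ?_ ?_ (integrable_const C) ?_).2
  · exact (hG'.comp (Continuous.prodMk_right θ₀)).aestronglyMeasurable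
  · filter_upwards [ae_cube hμ] with M hM θ hθ
    exact hC (θ, M) ⟨hθ, hM⟩
  · exact Filter.Eventually.of_forall fun M θ _ => hd M θ

/-- Rotation in the plane of the rows `a` and `b`. -/
noncomputable def rot (a b : Fin n) (θ : ℝ) : Matrix (Fin n) (Fin n) ℝ := fun i j =>
  (if i = j then 1 else 0)
    + (if i = a then (Real.cos θ - 1) * (if a = j then 1 else 0)
        + Real.sin θ * (if b = j then 1 else 0) else 0)
    + (if i = b then - Real.sin θ * (if a = j then 1 else 0)
        + (Real.cos θ - 1) * (if b = j then 1 else 0) else 0)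

lemma rot_mul (a b : Fin n) (θ : ℝ) (M : Matrix (Fin n) (Fin n) ℝ) (i j : Fin n) :
    (rot a b θ * M) i j = M i j
      + (if i = a then (Real.cos θ - 1) * M a j + Real.sin θ * M b j else 0)
      + (if i = b then - Real.sin θ * M a j + (Real.cos θ - 1) * M b j else 0) := by
  rw [Matrix.mul_apply]
  simp only [rot, add_mul, Finset.sum_add_distrib]
  congr 1
  · congr 1
    · simp
    · split_ifs
      · simp [add_mul, Finset.sum_add_distrib]
      · simp
  · split_ifs
    · simp [add_mul, Finset.sum_add_distrib]
    · simp

lemma rot_orth {a b : Fin n} (hab : a ≠ b) (θ : ℝ) : rot a b θ * (rot a b θ)ᵀ = 1 := by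
  ext i j
  have hcs := Real.sin_sq_add_cos_sq θ
  rw [rot_mul]
  simp only [Matrix.transpose_apply, rot, Matrix.one_apply]
  have hba := hab.symm
  by_cases h1 : i = a
  · subst h1
    by_cases h3 : j = i
    · subst h3; simp [hab, hba]; linear_combination hcs
    · by_cases h4 : j = b
      · subst h4; simp [hab, hba]; ring
      · have := Ne.symm h3; have := Ne.symm h4; simp [*]
  · by_cases h2 : i = b
    · subst h2
      by_cases h3 : j = a
      · subst h3; simp [hab, hba]; ring
      · by_cases h4 : j = i
        · subst h4; simp [hab, hba]; linear_combination hcs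
        · have := Ne.symm h3; have := Ne.symm h4; simp [*]
    · have h1' := Ne.symm h1
      have h2' := Ne.symm h2
      by_cases h5 : i = j
      · subst h5; simp [*]
      · by_cases h3 : j = a
        · subst h3; simp [*]
        · by_cases h4 : j = b
          · subst h4; simp [*]
          · have := Ne.symm h5; simp [*]

/-- The pairing of row `a` of `A` with row `b` of `M`. -/
def vv (A : Matrix (Fin n) (Fin n) ℝ) (a b : Fin n) (M : Matrix (Fin n) (Fin n) ℝ) : ℝ :=
  ∑ j, A a j * M b j

/-- The Frobenius pairing. -/
def TT (A M : Matrix (Fin n) (Fin n) ℝ) : ℝ := ∑ i, vv A i i M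

@[fun_prop]
lemma continuous_vv (A : Matrix (Fin n) (Fin n) ℝ) (a b : Fin n) : Continuous (vv A a b) := by
  unfold vv; fun_prop

@[fun_prop]
lemma continuous_TT (A : Matrix (Fin n) (Fin n) ℝ) : Continuous (TT A) := by
  unfold TT; fun_prop

lemma vv_rot (A : Matrix (Fin n) (Fin n) ℝ) {a b : Fin n} (hab : a ≠ b) (θ : ℝ)
    (M : Matrix (Fin n) (Fin n) ℝ) :
    vv A a b (rot a b θ * M) = - Real.sin θ * vv A a a M + Real.cos θ * vv A a b M := by
  unfold vv
  rw [Finset.mul_sum, Finset.mul_sum, ← Finset.sum_add_distrib]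
  refine Finset.sum_congr rfl fun j _ => ?_
  rw [rot_mul]
  simp [hab.symm]
  ring

lemma TT_rot (A : Matrix (Fin n) (Fin n) ℝ) {a b : Fin n} (hab : a ≠ b) (hb : ∀ j, A b j = 0)
    (θ : ℝ) (M : Matrix (Fin n) (Fin n) ℝ) :
    TT A (rot a b θ * M) =
      TT A M + (Real.cos θ - 1) * vv A a a M + Real.sin θ * vv A a b M := by
  have h : ∀ i, vv A i i (rot a b θ * M) = vv A i i M
      + if i = a then (Real.cos θ - 1) * vv A a a M + Real.sin θ * vv A a b M else 0 := by
    intro i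
    unfold vv
    by_cases hi : i = a
    · subst hi
      simp only [if_true, Finset.mul_sum, ← Finset.sum_add_distrib]
      refine Finset.sum_congr rfl fun j _ => ?_
      rw [rot_mul]
      simp [hab]
      ring
    · by_cases hi2 : i = b
      · subst hi2; simp [hb, hi]
      · simp [hi, hi2, rot_mul]
  unfold TT
  simp only [h, Finset.sum_add_distrib, Finset.sum_ite_eq', Finset.mem_univ, if_true]
  ring

lemma stein_row (hμ : IsHaarOrthogonal n μ) {g g' : ℝ → E} (hg : ∀ x, HasDerivAt g (g' x) x)
    (hg' : Continuous g') (A : Matrix (Fin n) (Fin n) ℝ) {a b : Fin n} (hab : a ≠ b)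
    (hb : ∀ j, A b j = 0) :
    ∫ M, vv A a a M • g (TT A M) ∂μ = ∫ M, (vv A a b M) ^ 2 • g' (TT A M) ∂μ := by
  have hgc : Continuous g := continuous_iff_continuousAt.2 fun x => (hg x).continuousAt
  set w : ℝ → Matrix (Fin n) (Fin n) ℝ → ℝ := fun θ M =>
    TT A M + (Real.cos θ - 1) * vv A a a M + Real.sin θ * vv A a b M with hw
  have key := hasDerivAt_int hμ
    (G := fun θ M => (- Real.sin θ * vv A a a M + Real.cos θ * vv A a b M) • g (w θ M))
    (G' := fun θ M => (- Real.sin θ * vv A a a M + Real.cos θ * vv A a b M) •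
        ((- Real.sin θ * vv A a a M + Real.cos θ * vv A a b M) • g' (w θ M))
      + (- Real.cos θ * vv A a a M + - Real.sin θ * vv A a b M) • g (w θ M))
    (by intro θ; simp only [hw]; fun_prop)
    (by simp only [hw, Function.uncurry_def]; fun_prop)
    (by
      intro M θ
      have h1 : HasDerivAt (fun θ => - Real.sin θ * vv A a a M + Real.cos θ * vv A a b M)
          (- Real.cos θ * vv A a a M + - Real.sin θ * vv A a b M) θ :=
        ((Real.hasDerivAt_sin θ).neg.mul_const _).add ((Real.hasDerivAt_cos θ).mul_const _)
      have h2 : HasDerivAt (fun θ => w θ M)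
          (- Real.sin θ * vv A a a M + Real.cos θ * vv A a b M) θ :=
        ((((Real.hasDerivAt_cos θ).sub_const 1).mul_const _).const_add _).add
          ((Real.hasDerivAt_sin θ).mul_const _)
      exact h1.smul ((hg _).scomp θ h2)) 0
  have hconst : ∀ θ, ∫ M, (- Real.sin θ * vv A a a M + Real.cos θ * vv A a b M) • g (w θ M) ∂μ
      = ∫ M, vv A a b M • g (TT A M) ∂μ := by
    intro θ
    have hc : Continuous fun M : Matrix (Fin n) (Fin n) ℝ => rot a b θ * M := by fun_prop
    conv_rhs => rw [← hμ.left_inv _ (rot_orth hab θ)]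
    rw [integral_map hc.aemeasurable (Continuous.aestronglyMeasurable (by fun_prop))]
    simp only [vv_rot A hab, TT_rot A hab hb, hw]
  simp only [hconst] at key
  have h0 := key.unique (hasDerivAt_const _ _)
  simp only [Real.sin_zero, Real.cos_zero, hw] at h0
  simp only [neg_zero, zero_mul, zero_add, one_mul, sub_self, add_zero, neg_mul, neg_smul] at h0
  rw [integral_add (integrable_cont hμ (by fun_prop)) (integrable_cont hμ (by fun_prop)),
    integral_neg] at h0
  rw [add_neg_eq_zero] at h0
  rw [← h0]
  simp only [smul_smul, sq]

lemma sum_vv_sq {M : Matrix (Fin n) (Fin n) ℝ} (h : M * Mᵀ = 1)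
    (A : Matrix (Fin n) (Fin n) ℝ) (a : Fin n) :
    ∑ b, (vv A a b M) ^ 2 = ∑ j, (A a j) ^ 2 := by
  have h' : Mᵀ * M = 1 := mul_eq_one_comm.1 h
  have h1 : ∀ b, vv A a b M = (M *ᵥ A a) b := by
    intro b; simp [vv, Matrix.mulVec, dotProduct, mul_comm]
  have h2 : (M *ᵥ A a) ⬝ᵥ (M *ᵥ A a) = A a ⬝ᵥ A a := by
    rw [Matrix.dotProduct_mulVec, ← Matrix.mulVec_transpose, Matrix.mulVec_mulVec, h',
      Matrix.one_mulVec]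
  simp only [h1, sq]
  exact h2

/-- The squared Frobenius norm. -/
def fro (A : Matrix (Fin n) (Fin n) ℝ) : ℝ := ∑ a, ∑ j, (A a j) ^ 2

/-- The quadratic error term. -/
def QQ (A : Matrix (Fin n) (Fin n) ℝ) (S : Finset (Fin n)) (M : Matrix (Fin n) (Fin n) ℝ) : ℝ :=
  ∑ b ∈ S, ∑ a, (vv A a b M) ^ 2

@[fun_prop]
lemma continuous_QQ (A : Matrix (Fin n) (Fin n) ℝ) (S : Finset (Fin n)) :
    Continuous (QQ A S) := by
  unfold QQ; fun_prop

lemma QQ_nonneg (A : Matrix (Fin n) (Fin n) ℝ) (S : Finset (Fin n))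
    (M : Matrix (Fin n) (Fin n) ℝ) : 0 ≤ QQ A S M :=
  Finset.sum_nonneg fun _ _ => Finset.sum_nonneg fun _ _ => sq_nonneg _

lemma stein (hμ : IsHaarOrthogonal n μ) {g g' : ℝ → E} (hg : ∀ x, HasDerivAt g (g' x) x)
    (hg' : Continuous g') (A : Matrix (Fin n) (Fin n) ℝ) (S : Finset (Fin n))
    (hS : ∀ b, b ∉ S → ∀ j, A b j = 0) :
    ((n : ℝ) - S.card) • ∫ M, TT A M • g (TT A M) ∂μ
      = ∫ M, (fro A - QQ A S M) • g' (TT A M) ∂μ := by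
  have hgc : Continuous g := continuous_iff_continuousAt.2 fun x => (hg x).continuousAt
  have h1 : ∀ b ∈ Sᶜ, ∫ M, TT A M • g (TT A M) ∂μ
      = ∫ M, (∑ a, (vv A a b M) ^ 2) • g' (TT A M) ∂μ := by
    intro b hb
    have hb' := hS b (Finset.mem_compl.1 hb)
    conv_lhs => enter [2, M]; rw [show TT A M • g (TT A M) = ∑ a, vv A a a M • g (TT A M) by
      rw [← Finset.sum_smul]; rfl]
    simp only [Finset.sum_smul]
    rw [integral_finsetSum _ (fun a _ => integrable_cont hμ (by fun_prop)),
      integral_finsetSum _ (fun a _ => integrable_cont hμ (by fun_prop))]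
    refine Finset.sum_congr rfl fun a _ => ?_
    by_cases hab : a = b
    · subst hab
      simp [vv, hb']
    · exact stein_row hμ hg hg' A hab hb'
  have h2 := Finset.sum_congr rfl h1
  rw [Finset.sum_const, Finset.card_compl, Fintype.card_fin,
    ← integral_finsetSum _ (fun a _ => integrable_cont hμ (by fun_prop))] at h2
  rw [← Nat.cast_smul_eq_nsmul ℝ, Nat.cast_sub (by simpa using Finset.card_le_univ S)] at h2
  rw [h2]
  refine integral_congr_ae (hμ.ae_orth.mono fun M hM => ?_)
  simp only [← Finset.sum_smul]
  congr 1
  have h3 : QQ A S M + ∑ b ∈ Sᶜ, ∑ a, (vv A a b M) ^ 2 = fro A := by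
    rw [QQ, Finset.sum_add_sum_compl, Finset.sum_comm]
    exact Finset.sum_congr rfl fun a _ => sum_vv_sq hM A a
  linarith

end
section
variable {n : ℕ} {μ : Measure (Matrix (Fin n) (Fin n) ℝ)}

lemma fro_nonneg (A : Matrix (Fin n) (Fin n) ℝ) : 0 ≤ fro A :=
  Finset.sum_nonneg fun _ _ => Finset.sum_nonneg fun _ _ => sq_nonneg _

lemma moment_step (hμ : IsHaarOrthogonal n μ) (A : Matrix (Fin n) (Fin n) ℝ)
    (S : Finset (Fin n)) (hS : ∀ b, b ∉ S → ∀ j, A b j = 0) (q : ℕ) :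
    ((n : ℝ) - S.card) * ∫ M, TT A M ^ (2 * (q + 1)) ∂μ
      ≤ (2 * q + 1) * fro A * ∫ M, TT A M ^ (2 * q) ∂μ := by
  have h := stein hμ (g := fun x : ℝ => x ^ (2 * q + 1))
    (g' := fun x : ℝ => ((2 * q + 1 : ℕ) : ℝ) * x ^ (2 * q))
    (fun x => by simpa using hasDerivAt_pow (2 * q + 1) x) (by fun_prop) A S hS
  simp only [smul_eq_mul] at h
  have e : ∀ M, TT A M ^ (2 * (q + 1)) = TT A M * TT A M ^ (2 * q + 1) := fun M => by ring
  simp only [e]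
  rw [h, ← integral_const_mul]
  refine integral_mono (integrable_cont hμ (by fun_prop)) (integrable_cont hμ (by fun_prop)) ?_
  intro M
  have h1 : 0 ≤ TT A M ^ (2 * q) := by rw [pow_mul]; positivity
  have h2 := QQ_nonneg A S M
  have h3 : 0 ≤ QQ A S M * ((2 * q + 1 : ℝ) * TT A M ^ (2 * q)) := by positivity
  push_cast
  linarith

lemma second_moment (hμ : IsHaarOrthogonal n μ) (A : Matrix (Fin n) (Fin n) ℝ) (a b : Fin n) :
    ((n : ℝ) - 1) * ∫ M, vv A a b M ^ 2 ∂μ ≤ ∑ j, (A a j) ^ 2 := by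
  have := hμ.isProb
  set A' : Matrix (Fin n) (Fin n) ℝ := fun i j => if i = b then A a j else 0 with hA'
  have hT : ∀ M, TT A' M = vv A a b M := by
    intro M
    unfold TT vv
    rw [Finset.sum_eq_single b]
    · simp [hA']
    · intro i _ hi; simp [hA', hi]
    · simp
  have hf : fro A' = ∑ j, (A a j) ^ 2 := by
    unfold fro
    rw [Finset.sum_eq_single b]
    · simp [hA']
    · intro i _ hi; simp [hA', hi]
    · simp
  have h := moment_step hμ A' {b} (by intro i hi j; simp at hi; simp [hA', hi]) 0
  simpa [hT, hf] using h

lemma integral_QQ (hμ : IsHaarOrthogonal n μ) (A : Matrix (Fin n) (Fin n) ℝ)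
    (S : Finset (Fin n)) :
    ((n : ℝ) - 1) * ∫ M, QQ A S M ∂μ ≤ S.card * fro A := by
  unfold QQ
  rw [integral_finsetSum _ (fun a _ => integrable_cont hμ (by fun_prop)), Finset.mul_sum,
    ← nsmul_eq_mul]
  refine Finset.sum_le_card_nsmul _ _ _ fun b _ => ?_
  rw [integral_finsetSum _ (fun a _ => integrable_cont hμ (by fun_prop)), Finset.mul_sum]
  exact Finset.sum_le_sum fun a _ => second_moment hμ A a b

lemma entry_moment (hμ : IsHaarOrthogonal n μ) (hn : 1 ≤ n) (i j : Fin n) (q : ℕ) :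
    ((n : ℝ) - 1) ^ q * ∫ M, (M i j) ^ (2 * q) ∂μ ≤ ∏ l ∈ Finset.range q, (2 * (l : ℝ) + 1) := by
  have := hμ.isProb
  have hn' : (1 : ℝ) ≤ n := by exact_mod_cast hn
  set A' : Matrix (Fin n) (Fin n) ℝ := fun a b => if a = i then (if b = j then 1 else 0) else 0
    with hA'
  have hT : ∀ M, TT A' M = M i j := by
    intro M
    unfold TT vv
    rw [Finset.sum_eq_single i]
    · simp [hA']
    · intro i _ hi; simp [hA', hi]
    · simp
  have hf : fro A' = 1 := by
    unfold fro
    rw [Finset.sum_eq_single i]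
    · simp [hA']
    · intro i _ hi; simp [hA', hi]
    · simp
  induction q with
  | zero => simp
  | succ q ih =>
    have h := moment_step hμ A' {i} (by intro a ha b; simp at ha; simp [hA', ha]) q
    simp only [hT, hf, Finset.card_singleton, Nat.cast_one, mul_one] at h
    rw [Finset.prod_range_succ, pow_succ]
    calc ((n : ℝ) - 1) ^ q * (n - 1) * ∫ M, (M i j) ^ (2 * (q + 1)) ∂μ
        = ((n : ℝ) - 1) ^ q * ((n - 1) * ∫ M, (M i j) ^ (2 * (q + 1)) ∂μ) := by ring
      _ ≤ ((n : ℝ) - 1) ^ q * ((2 * q + 1) * ∫ M, (M i j) ^ (2 * q) ∂μ) := by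
          gcongr
      _ = (((n : ℝ) - 1) ^ q * ∫ M, (M i j) ^ (2 * q) ∂μ) * (2 * q + 1) := by ring
      _ ≤ _ := by gcongr

open Complex in
lemma char_bound (hμ : IsHaarOrthogonal n μ) (hn : 2 ≤ n) (A : Matrix (Fin n) (Fin n) ℝ)
    (S : Finset (Fin n)) (hS : ∀ b, b ∉ S → ∀ j, A b j = 0) (hcard : S.card < n) :
    ‖(∫ M, cexp (((√(n : ℝ) * TT A M : ℝ) : ℂ) * I) ∂μ) - ((Real.exp (- (fro A / 2)) : ℝ) : ℂ)‖
      ≤ fro A * (S.card / ((n : ℝ) - S.card)) * (1 + n / ((n : ℝ) - 1)) := by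
  have := hμ.isProb
  set N : ℝ := (n : ℝ) with hN
  set m : ℝ := (S.card : ℝ) with hm
  set σ : ℝ := fro A with hσ
  have hσ0 : 0 ≤ σ := fro_nonneg A
  have hm0 : 0 ≤ m := Nat.cast_nonneg _
  have hN2 : (2 : ℝ) ≤ N := by simp only [hN]; exact_mod_cast hn
  have hNm : 0 < N - m := sub_pos.2 (by simp only [hN, hm]; exact_mod_cast hcard)
  have hN1 : 0 < N - 1 := by linarith
  have hsq : √N * √N = N := Real.mul_self_sqrt (by linarith)
  set e : ℝ → Matrix (Fin n) (Fin n) ℝ → ℂ := fun t M =>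
    cexp (((t * (√N * TT A M) : ℝ) : ℂ) * I) with he
  have hne : ∀ t M, ‖e t M‖ = 1 := fun t M => norm_exp_ofReal_mul_I _
  have hec : ∀ t, Continuous (e t) := fun t => by simp only [he]; fun_prop
  set φ : ℝ → ℂ := fun t => ∫ M, e t M ∂μ with hφ
  -- the derivative of the characteristic function
  have hd1 : ∀ t, HasDerivAt φ (∫ M, (((√N * TT A M : ℝ) : ℂ) * I) * e t M ∂μ) t := by
    intro t
    refine hasDerivAt_int hμ (G := e) (G' := fun t M => (((√N * TT A M : ℝ) : ℂ) * I) * e t M)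
      hec (by simp only [he, Function.uncurry_def]; fun_prop) ?_ t
    intro M t
    have h1 : HasDerivAt (fun t : ℝ => ((t * (√N * TT A M) : ℝ) : ℂ))
        ((√N * TT A M : ℝ) : ℂ) t := by
      have := ((hasDerivAt_id t).mul_const (√N * TT A M)).ofReal_comp
      simpa using this
    have h2 := (h1.mul_const I).cexp
    exact h2.congr_deriv (mul_comm _ _)
  -- Stein's identity
  have hst : ∀ t, ((N - m : ℝ) : ℂ) * ∫ M, (((√N * TT A M : ℝ) : ℂ) * I) * e t M ∂μ
      = - ((t * N : ℝ) : ℂ) * ∫ M, ((σ - QQ A S M : ℝ) : ℂ) * e t M ∂μ := by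
    intro t
    have h := stein hμ (g := fun x : ℝ => cexp (((t * (√N * x) : ℝ) : ℂ) * I))
      (g' := fun x : ℝ => (((t * √N : ℝ) : ℂ) * I) * cexp (((t * (√N * x) : ℝ) : ℂ) * I))
      (by
        intro x
        have h1 : HasDerivAt (fun x : ℝ => ((t * (√N * x) : ℝ) : ℂ)) ((t * √N : ℝ) : ℂ) x := by
          have := (((hasDerivAt_id x).const_mul (√N)).const_mul t).ofReal_comp
          simpa using this
        have h2 := (h1.mul_const I).cexp
        rw [mul_comm]
        exact h2) (by fun_prop) A S hS
    simp only [Complex.real_smul] at h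
    have e1 : ∀ M, (((√N * TT A M : ℝ) : ℂ) * I) * e t M
        = ((√N : ℂ) * I) * ((TT A M : ℂ) * e t M) := by
      intro M; push_cast; ring
    have e2 : ∀ M, ((fro A - QQ A S M : ℝ) : ℂ) * ((((t * √N : ℝ) : ℂ) * I) * e t M)
        = (((t * √N : ℝ) : ℂ) * I) * (((σ - QQ A S M : ℝ) : ℂ) * e t M) := by
      intro M; rw [hσ]; ring
    simp only [e1]
    change _ * ∫ M, _ * e t M ∂μ = ∫ M, _ * (_ * e t M) ∂μ at h
    simp only [e2] at h
    rw [integral_const_mul] at h ⊢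
    rw [mul_left_comm, h, ← mul_assoc]
    congr 1
    have hsq' : (√N : ℂ) * (√N : ℂ) = (N : ℂ) := by rw [← Complex.ofReal_mul, hsq]
    push_cast
    linear_combination (t : ℂ) * I ^ 2 * hsq' + (t : ℂ) * N * I_sq
  set δ : ℝ := σ * (m / (N - m)) * (1 + N / (N - 1)) with hδ
  have hδ0 : 0 ≤ δ := by positivity
  have hQ : ∫ M, QQ A S M ∂μ ≤ m * σ / (N - 1) := by
    rw [le_div_iff₀ hN1, mul_comm]
    exact integral_QQ hμ A S
  have hφ1 : ∀ t, ‖φ t‖ ≤ 1 := by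
    intro t
    refine (norm_integral_le_integral_norm _).trans ?_
    simp [hne]
  have hQe : ∀ t, ‖∫ M, (QQ A S M : ℂ) * e t M ∂μ‖ ≤ m * σ / (N - 1) := by
    intro t
    refine (norm_integral_le_integral_norm _).trans (le_trans (le_of_eq ?_) hQ)
    refine integral_congr_ae (Filter.Eventually.of_forall fun M => ?_)
    simp [hne, abs_of_nonneg (QQ_nonneg A S M)]
  have hbd : ∀ t, 0 ≤ t → t ≤ 1 →
      ‖((t * σ : ℝ) : ℂ) * φ t + ∫ M, (((√N * TT A M : ℝ) : ℂ) * I) * e t M ∂μ‖ ≤ δ := by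
    intro t ht0 ht1
    have h1 : ∫ M, ((σ - QQ A S M : ℝ) : ℂ) * e t M ∂μ
        = σ * φ t - ∫ M, (QQ A S M : ℂ) * e t M ∂μ := by
      have : ∀ M, ((σ - QQ A S M : ℝ) : ℂ) * e t M = σ * e t M - (QQ A S M : ℂ) * e t M := by
        intro M; push_cast; ring
      simp only [this]
      have hect := hec t
      rw [integral_sub (integrable_cont hμ (by fun_prop)) (integrable_cont hμ (by fun_prop)),
        integral_const_mul]
    have hc : ((N - m : ℝ) : ℂ) ≠ 0 := by exact_mod_cast hNm.ne'
    have h2 : ((t * σ : ℝ) : ℂ) * φ t + ∫ M, (((√N * TT A M : ℝ) : ℂ) * I) * e t M ∂μ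
        = ((- (t * σ * (m / (N - m))) : ℝ) : ℂ) * φ t
          + ((t * (N / (N - m)) : ℝ) : ℂ) * ∫ M, (QQ A S M : ℂ) * e t M ∂μ := by
      have h3 := hst t
      rw [h1] at h3
      apply mul_left_cancel₀ hc
      rw [mul_add, h3]
      have hc' : (N : ℂ) - m ≠ 0 := by exact_mod_cast hc
      push_cast
      field_simp
      ring
    rw [h2]
    refine (norm_add_le _ _).trans ?_
    rw [norm_mul, norm_mul, Complex.norm_real, Complex.norm_real, Real.norm_eq_abs, abs_neg,
      Real.norm_eq_abs, abs_of_nonneg (by positivity), abs_of_nonneg (by positivity)]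
    calc t * σ * (m / (N - m)) * ‖φ t‖ + t * (N / (N - m)) * ‖∫ M, (QQ A S M : ℂ) * e t M ∂μ‖
        ≤ 1 * σ * (m / (N - m)) * 1 + 1 * (N / (N - m)) * (m * σ / (N - 1)) := by
          gcongr
          · exact hφ1 t
          · exact hQe t
      _ = δ := by
          rw [hδ]; field_simp
  -- integrating factor
  set ψ : ℝ → ℂ := fun t => ((Real.exp (t ^ 2 * σ / 2) : ℝ) : ℂ) * φ t with hψ
  have hψd : ∀ t, HasDerivAt ψ (((Real.exp (t ^ 2 * σ / 2) : ℝ) : ℂ) *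
      (((t * σ : ℝ) : ℂ) * φ t + ∫ M, (((√N * TT A M : ℝ) : ℂ) * I) * e t M ∂μ)) t := by
    intro t
    have h1 : HasDerivAt (fun t : ℝ => Real.exp (t ^ 2 * σ / 2))
        (Real.exp (t ^ 2 * σ / 2) * (t * σ)) t := by
      have h := ((((hasDerivAt_pow 2 t).mul_const σ).div_const 2)).exp
      convert h using 1
      push_cast
      ring
    have h2 := h1.ofReal_comp.mul (hd1 t)
    refine h2.congr_deriv ?_
    push_cast
    ring
  have hmv : ‖ψ 1 - ψ 0‖ ≤ Real.exp (σ / 2) * δ * (1 - 0) := by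
    refine norm_image_sub_le_of_norm_deriv_le_segment' (a := 0) (b := 1) (f' := fun t =>
      (((Real.exp (t ^ 2 * σ / 2) : ℝ) : ℂ) *
      (((t * σ : ℝ) : ℂ) * φ t + ∫ M, (((√N * TT A M : ℝ) : ℂ) * I) * e t M ∂μ)))
      (fun t _ => (hψd t).hasDerivWithinAt) ?_ 1 (by norm_num)
    intro t ht
    rw [norm_mul, Complex.norm_real, Real.norm_eq_abs, Real.abs_exp]
    have : t ^ 2 * σ / 2 ≤ σ / 2 := by
      have : t ^ 2 ≤ 1 := pow_le_one₀ ht.1 ht.2.le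
      nlinarith
    gcongr
    exact hbd t ht.1 ht.2.le
  have hψ0 : ψ 0 = 1 := by simp [hψ, hφ, he]
  have hφ1' : φ 1 = ∫ M, cexp (((√N * TT A M : ℝ) : ℂ) * I) ∂μ := by simp [hφ, he]
  rw [← hφ1']
  have hfin : φ 1 - ((Real.exp (- (σ / 2)) : ℝ) : ℂ)
      = ((Real.exp (- (σ / 2)) : ℝ) : ℂ) * (ψ 1 - ψ 0) := by
    rw [hψ0, mul_sub, hψ]
    simp only
    rw [← mul_assoc, ← Complex.ofReal_mul, ← Real.exp_add]
    simp
  rw [hfin, norm_mul, Complex.norm_real, Real.norm_eq_abs, Real.abs_exp]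
  calc Real.exp (- (σ / 2)) * ‖ψ 1 - ψ 0‖
      ≤ Real.exp (- (σ / 2)) * (Real.exp (σ / 2) * δ * (1 - 0)) := by gcongr
    _ = (Real.exp (- (σ / 2)) * Real.exp (σ / 2)) * δ := by ring
    _ = δ := by rw [← Real.exp_add]; simp
end
lemma prod_sq_le {r K : ℕ} (k : Fin r → ℕ) (hK : ∑ s, k s = 2 * K) (w : Fin r → ℝ) :
    (∏ s, w s ^ k s) ^ 2 ≤ 1 + ∑ s, (w s) ^ (2 * (2 * K)) := by
  have hnn : ∀ s, 0 ≤ (w s) ^ (2 * (2 * K)) := fun s => by rw [pow_mul]; positivity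
  rcases isEmpty_or_nonempty (Fin r) with h | h
  · simp
  · obtain ⟨s₀, -, hs₀⟩ := Finset.exists_max_image Finset.univ (fun s => (w s) ^ 2)
      Finset.univ_nonempty
    calc (∏ s, w s ^ k s) ^ 2 = ∏ s, ((w s) ^ 2) ^ k s := by
          rw [← Finset.prod_pow]
          exact Finset.prod_congr rfl fun s _ => by rw [← pow_mul, ← pow_mul, mul_comm]
      _ ≤ ∏ s, ((w s₀) ^ 2) ^ k s :=
          Finset.prod_le_prod (fun s _ => by positivity) fun s hs =>
            pow_le_pow_left₀ (sq_nonneg _) (hs₀ s hs) _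
      _ = (w s₀) ^ (2 * (2 * K)) := by
          rw [Finset.prod_pow_eq_pow_sum, hK, ← pow_mul]
      _ ≤ ∑ s, (w s) ^ (2 * (2 * K)) :=
          Finset.single_le_sum (f := fun s => (w s) ^ (2 * (2 * K))) (fun s _ => hnn s)
            (Finset.mem_univ s₀)
      _ ≤ _ := by linarith

/-- Truncation at level `R`. -/
noncomputable def trunc (R : ℝ) : BoundedContinuousFunction ℝ ℝ :=
  BoundedContinuousFunction.ofNormedAddCommGroup (fun x => max (-R) (min R x)) (by fun_prop) |R|
    (by
      intro x
      rw [Real.norm_eq_abs, abs_le]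
      refine ⟨le_trans (neg_le_neg (le_abs_self R)) (le_max_left _ _), max_le (neg_le_abs R) ?_⟩
      exact (min_le_left _ _).trans (le_abs_self R))

lemma trunc_err {R : ℝ} (hR : 0 < R) (x : ℝ) : |x - trunc R x| ≤ x ^ 2 / R := by
  have e : trunc R x = max (-R) (min R x) := rfl
  rw [e, le_div_iff₀ hR]
  rcases le_total R x with h | h
  · rw [min_eq_left h, max_eq_right (by linarith), abs_of_nonneg (by linarith)]
    nlinarith [sq_nonneg (x - R)]
  · rw [min_eq_right h]
    rcases le_total (-R) x with h' | h'
    · rw [max_eq_right h']; simp; positivity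
    · rw [max_eq_left h', abs_of_nonpos (by linarith)]
      nlinarith [sq_nonneg (x + R)]

lemma integral_trunc_err {Ω : Type*} [MeasurableSpace Ω] {P : Measure Ω} [IsProbabilityMeasure P]
    {X : Ω → ℝ} (hX : MemLp X 2 P) {C : ℝ} (hC : ∫ ω, X ω ^ 2 ∂P ≤ C) {R : ℝ} (hR : 0 < R) :
    |∫ ω, X ω ∂P - ∫ ω, trunc R (X ω) ∂P| ≤ C / R := by
  have h1 : Integrable X P := hX.integrable (by norm_num)
  have h2 : Integrable (fun ω => trunc R (X ω)) P :=
    Integrable.of_bound ((trunc R).continuous.comp_aestronglyMeasurable h1.1) ‖trunc R‖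
      (Filter.Eventually.of_forall fun ω => (trunc R).norm_coe_le_norm _)
  rw [← integral_sub h1 h2]
  calc |∫ ω, (X ω - trunc R (X ω)) ∂P| ≤ ∫ ω, |X ω - trunc R (X ω)| ∂P :=
        abs_integral_le_integral_abs
    _ ≤ ∫ ω, X ω ^ 2 / R ∂P :=
        integral_mono (h1.sub h2).abs (hX.integrable_sq.div_const R) fun ω => trunc_err hR _
    _ = (∫ ω, X ω ^ 2 ∂P) / R := integral_div _ _
    _ ≤ C / R := by gcongr

lemma tendsto_of_weak {Ω : ℕ → Type*} [∀ n, MeasurableSpace (Ω n)] {P : ∀ n, Measure (Ω n)}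
    [∀ n, IsProbabilityMeasure (P n)] {Ω' : Type*} [MeasurableSpace Ω'] {Q : Measure Ω'}
    [IsProbabilityMeasure Q] {X : ∀ n, Ω n → ℝ} {Y : Ω' → ℝ}
    (hX : ∀ n, MemLp (X n) 2 (P n)) (hY : MemLp Y 2 Q) {C : ℝ}
    (hC : ∀ᶠ n in Filter.atTop, ∫ ω, X n ω ^ 2 ∂(P n) ≤ C)
    (hw : ∀ g : BoundedContinuousFunction ℝ ℝ, Filter.Tendsto (fun n => ∫ ω, g (X n ω) ∂(P n))
      Filter.atTop (nhds (∫ ω, g (Y ω) ∂Q))) :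
    Filter.Tendsto (fun n => ∫ ω, X n ω ∂(P n)) Filter.atTop (nhds (∫ ω, Y ω ∂Q)) := by
  rw [Metric.tendsto_nhds]
  intro ε hε
  set D : ℝ := max (max C (∫ ω, Y ω ^ 2 ∂Q)) 1 with hD
  have hD1 : 1 ≤ D := le_max_right _ _
  have hDC : C ≤ D := (le_max_left _ _).trans (le_max_left _ _)
  have hDY : ∫ ω, Y ω ^ 2 ∂Q ≤ D := (le_max_right _ _).trans (le_max_left _ _)
  set R : ℝ := 4 * D / ε with hR
  have hR0 : 0 < R := by positivity
  have hDR : D / R = ε / 4 := by rw [hR]; field_simp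
  have h3 := integral_trunc_err hY hDY hR0
  filter_upwards [hC, (Metric.tendsto_nhds.1 (hw (trunc R))) (ε / 4) (by positivity)] with n h1 h2
  have h4 := integral_trunc_err (hX n) (h1.trans hDC) hR0
  rw [Real.dist_eq] at h2 ⊢
  rw [hDR] at h3 h4
  rw [abs_lt] at h2 ⊢
  rw [abs_le] at h3 h4
  constructor <;> linarith [h3.1, h3.2, h4.1, h4.2, h2.1, h2.2]

open Complex in
lemma char_tendsto {r : ℕ} (p : Fin r → ℕ × ℕ) (hp : Function.Injective p)
    (μ : ∀ n : ℕ, Measure (Matrix (Fin (n + 1)) (Fin (n + 1)) ℝ))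
    (hμ : ∀ n, IsHaarOrthogonal (n + 1) (μ n)) (t : Fin r → ℝ) :
    Filter.Tendsto (fun n : ℕ => ∫ M, cexp (((∑ s, t s * (√((n + 1 : ℕ) : ℝ) *
        M ⟨(p s).1 % (n + 1), Nat.mod_lt _ n.succ_pos⟩
           ⟨(p s).2 % (n + 1), Nat.mod_lt _ n.succ_pos⟩) : ℝ) : ℂ) * I) ∂(μ n))
      Filter.atTop (nhds ((Real.exp (- ((∑ s, t s ^ 2) / 2)) : ℝ) : ℂ)) := by
  set σ : ℝ := ∑ s, t s ^ 2 with hσ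
  have hσ0 : 0 ≤ σ := Finset.sum_nonneg fun _ _ => sq_nonneg _
  set L : ℕ := ∑ s, ((p s).1 + (p s).2) with hL
  have hpL : ∀ s, (p s).1 + (p s).2 ≤ L := fun s =>
    Finset.single_le_sum (f := fun s => (p s).1 + (p s).2) (fun _ _ => Nat.zero_le _)
      (Finset.mem_univ s)
  rw [tendsto_iff_norm_sub_tendsto_zero]
  have hlim : Filter.Tendsto (fun n : ℕ => σ * (r / (((n + 1 : ℕ) : ℝ) - r)) * (1 + 2))
      Filter.atTop (nhds 0) := by
    have h1 : Filter.Tendsto (fun n : ℕ => ((n + 1 : ℕ) : ℝ) - r) Filter.atTop Filter.atTop :=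
      Filter.tendsto_atTop_add_const_right _ _
        (tendsto_natCast_atTop_atTop.comp (Filter.tendsto_add_atTop_nat 1))
    have h2 := (((h1.const_div_atTop (r : ℝ)).const_mul σ).mul_const (1 + 2))
    simpa using h2
  refine squeeze_zero' (Filter.Eventually.of_forall fun n => norm_nonneg _) ?_ hlim
  filter_upwards [Filter.eventually_ge_atTop (L + r + 1)] with n hn
  set row : Fin r → Fin (n + 1) := fun s => ⟨(p s).1 % (n + 1), Nat.mod_lt _ n.succ_pos⟩ with hrow
  set col : Fin r → Fin (n + 1) := fun s => ⟨(p s).2 % (n + 1), Nat.mod_lt _ n.succ_pos⟩ with hcol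
  have hinj : ∀ s s', row s = row s' → col s = col s' → s = s' := by
    intro s s' h1 h2
    have a1 := hpL s
    have a2 := hpL s'
    simp only [hrow, hcol, Fin.mk.injEq] at h1 h2
    rw [Nat.mod_eq_of_lt (by omega), Nat.mod_eq_of_lt (by omega)] at h1 h2
    exact hp (Prod.ext h1 h2)
  set A : Matrix (Fin (n + 1)) (Fin (n + 1)) ℝ := fun i j =>
    ∑ s, if i = row s then (if j = col s then t s else 0) else 0 with hA
  have hT : ∀ M, TT A M = ∑ s, t s * M (row s) (col s) := by
    intro M
    unfold TT vv
    simp only [hA, Finset.sum_mul]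
    rw [Finset.sum_congr rfl fun i _ => Finset.sum_comm, Finset.sum_comm]
    refine Finset.sum_congr rfl fun s _ => ?_
    rw [Finset.sum_eq_single (row s)]
    · simp
    · intro i _ hi; simp [hi]
    · simp
  have hf : fro A = σ := by
    have : fro A = TT A A := by simp only [fro, TT, vv, sq]
    rw [this, hT, hσ]
    refine Finset.sum_congr rfl fun s _ => ?_
    rw [sq]
    congr 1
    simp only [hA]
    rw [Finset.sum_eq_single s]
    · simp
    · intro s' _ hs'
      split_ifs with h1 h2
      · exact absurd (hinj s s' h1 h2).symm hs'
      · rfl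
      · rfl
    · simp
  set S : Finset (Fin (n + 1)) := Finset.univ.image row with hS
  have hSr : S.card ≤ r := by simpa using Finset.card_image_le (s := Finset.univ) (f := row)
  have hSr' : (S.card : ℝ) ≤ r := by exact_mod_cast hSr
  have hb := char_bound (hμ n) (by omega) A S (by
    intro b hb j
    simp only [hA]
    refine Finset.sum_eq_zero fun s _ => ?_
    rw [if_neg]
    rintro rfl
    exact hb (Finset.mem_image_of_mem _ (Finset.mem_univ s))) (by omega)
  rw [hf] at hb
  have hnr : (0 : ℝ) < ((n + 1 : ℕ) : ℝ) - r := by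
    rw [sub_pos]; exact_mod_cast (by omega : r < n + 1)
  have hn1 : (1 : ℝ) ≤ n := by exact_mod_cast (by omega : 1 ≤ n)
  have h2 : ((n + 1 : ℕ) : ℝ) / (((n + 1 : ℕ) : ℝ) - 1) ≤ 2 := by
    push_cast
    rw [div_le_iff₀ (by linarith)]
    linarith
  calc _ = ‖(∫ M, cexp (((√((n + 1 : ℕ) : ℝ) * TT A M : ℝ) : ℂ) * I) ∂(μ n))
        - ((Real.exp (- (σ / 2)) : ℝ) : ℂ)‖ := by
        simp only [hT, Finset.mul_sum, mul_left_comm (√((n + 1 : ℕ) : ℝ))]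
        rfl
    _ ≤ _ := hb
    _ ≤ _ := by
        have h0 : 0 ≤ 1 + ((n + 1 : ℕ) : ℝ) / (((n + 1 : ℕ) : ℝ) - 1) := by
          have : (0 : ℝ) ≤ ((n + 1 : ℕ) : ℝ) - 1 := by push_cast; linarith
          positivity
        gcongr

lemma weak_tendsto {r : ℕ} (p : Fin r → ℕ × ℕ) (hp : Function.Injective p)
    (μ : ∀ n : ℕ, Measure (Matrix (Fin (n + 1)) (Fin (n + 1)) ℝ))
    (hμ : ∀ n, IsHaarOrthogonal (n + 1) (μ n))
    (f : BoundedContinuousFunction (EuclideanSpace ℝ (Fin r)) ℝ) :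
    Filter.Tendsto (fun n : ℕ => ∫ M, f (WithLp.toLp 2 fun s => √((n + 1 : ℕ) : ℝ) *
        M ⟨(p s).1 % (n + 1), Nat.mod_lt _ n.succ_pos⟩
           ⟨(p s).2 % (n + 1), Nat.mod_lt _ n.succ_pos⟩) ∂(μ n))
      Filter.atTop (nhds (∫ z, f (WithLp.toLp 2 z)
        ∂(Measure.pi fun _ : Fin r => ProbabilityTheory.gaussianReal 0 1))) := by
  have hpr : ∀ n, IsProbabilityMeasure (μ n) := fun n => (hμ n).isProb
  set W : ∀ n : ℕ, Matrix (Fin (n + 1)) (Fin (n + 1)) ℝ → EuclideanSpace ℝ (Fin r) := fun n M =>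
    WithLp.toLp 2 fun s => √((n + 1 : ℕ) : ℝ) *
        M ⟨(p s).1 % (n + 1), Nat.mod_lt _ n.succ_pos⟩
           ⟨(p s).2 % (n + 1), Nat.mod_lt _ n.succ_pos⟩ with hW
  have hWc : ∀ n, Continuous (W n) := fun n => by simp only [hW]; fun_prop
  have hLc : Continuous fun z : Fin r → ℝ => (WithLp.toLp 2 z : EuclideanSpace ℝ (Fin r)) := by
    fun_prop
  set P : ℕ → ProbabilityMeasure (EuclideanSpace ℝ (Fin r)) := fun n =>
    ⟨(μ n).map (W n), Measure.isProbabilityMeasure_map (hWc n).aemeasurable⟩ with hP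
  set P₀ : ProbabilityMeasure (EuclideanSpace ℝ (Fin r)) :=
    ⟨(Measure.pi fun _ : Fin r => ProbabilityTheory.gaussianReal 0 1).map (WithLp.toLp 2),
      Measure.isProbabilityMeasure_map hLc.aemeasurable⟩ with hP₀
  have hconv : Filter.Tendsto P Filter.atTop (nhds P₀) := by
    refine ProbabilityMeasure.tendsto_iff_tendsto_charFun.2 fun t => ?_
    have h := char_tendsto p hp μ hμ (fun s => t s)
    convert h using 1
    · funext n
      simp only [hP, ProbabilityMeasure.coe_mk, charFun_apply]
      rw [integral_map (hWc n).aemeasurable (Continuous.aestronglyMeasurable (by fun_prop))]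
      simp [hW, PiLp.inner_apply]
    · congr 1
      simp only [hP₀, ProbabilityMeasure.coe_mk]
      rw [charFun_pi]
      simp only [ProbabilityTheory.charFun_gaussianReal]
      rw [← Complex.exp_sum]
      push_cast
      congr 1
      simp [Finset.sum_div]
  have h := (ProbabilityMeasure.tendsto_iff_forall_integral_tendsto.1 hconv) f
  simp only [hP, hP₀, ProbabilityMeasure.coe_mk] at h
  rw [integral_map hLc.aemeasurable f.continuous.aestronglyMeasurable] at h
  refine h.congr fun n => ?_
  rw [integral_map (hWc n).aemeasurable f.continuous.aestronglyMeasurable]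

lemma integrable_pow_gaussian (q : ℕ) :
    Integrable (fun x : ℝ => x ^ (2 * q)) (ProbabilityTheory.gaussianReal 0 1) := by
  have h := (ProbabilityTheory.memLp_id_gaussianReal' (μ := 0) (v := 1) ((2 * q : ℕ) : ENNReal)
    (ENNReal.natCast_ne_top _)).integrable_norm_pow'
  refine h.congr (Filter.Eventually.of_forall fun x => ?_)
  simp [pow_mul]

end HaarMoments

open ProbabilityTheory BoundedContinuousFunction

/-- `X_n = n^k M_1^{k_1}⋯M_r^{k_r}` (a monomial of total degree `2k` in
distinct fixed entries of a Haar orthogonal matrix of size `n+1`) converges in `L¹` to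
`Y = Z_1^{k_1}⋯Z_r^{k_r}` for i.i.d. standard normals `Z_i`: the laws converge weakly
together with first absolute moments, and in particular `E[X_n] → E[Y]`. -/
theorem stmt4 (r K : ℕ) (k : Fin r → ℕ) (hK : ∑ s, k s = 2 * K)
    (p : Fin r → ℕ × ℕ) (hp : Function.Injective p)
    (μ : ∀ n : ℕ, Measure (Matrix (Fin (n + 1)) (Fin (n + 1)) ℝ))
    (hμ : ∀ n, IsHaarOrthogonal (n + 1) (μ n)) :
    -- the (for large `n` well-defined) entries of `M` at the positions `p s`
    let X : ∀ n : ℕ, Matrix (Fin (n + 1)) (Fin (n + 1)) ℝ → ℝ := fun n M =>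
      (n + 1 : ℝ) ^ K * ∏ s : Fin r,
        (M ⟨(p s).1 % (n + 1), Nat.mod_lt _ n.succ_pos⟩
           ⟨(p s).2 % (n + 1), Nat.mod_lt _ n.succ_pos⟩) ^ (k s)
    let ν : Measure (Fin r → ℝ) := Measure.pi fun _ => gaussianReal 0 1
    let Y : (Fin r → ℝ) → ℝ := fun z => ∏ s : Fin r, (z s) ^ (k s)
    (∀ g : ℝ →ᵇ ℝ,
        Filter.Tendsto (fun n => ∫ M, g (X n M) ∂(μ n)) Filter.atTop
          (nhds (∫ z, g (Y z) ∂ν))) ∧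
      Filter.Tendsto (fun n => ∫ M, |X n M| ∂(μ n)) Filter.atTop
        (nhds (∫ z, |Y z| ∂ν)) ∧
      Filter.Tendsto (fun n => ∫ M, X n M ∂(μ n)) Filter.atTop
        (nhds (∫ z, Y z ∂ν)) := by
  intro X ν Y
  have hpr : ∀ n, IsProbabilityMeasure (μ n) := fun n => (hμ n).isProb
  have hXW : ∀ n M, X n M = ∏ s : Fin r, (√((n + 1 : ℕ) : ℝ) *
      (M ⟨(p s).1 % (n + 1), Nat.mod_lt _ n.succ_pos⟩
           ⟨(p s).2 % (n + 1), Nat.mod_lt _ n.succ_pos⟩)) ^ (k s) := by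
    intro n M
    simp only [X, mul_pow, Finset.prod_mul_distrib]
    rw [Finset.prod_pow_eq_pow_sum, hK, pow_mul, Real.sq_sqrt (Nat.cast_nonneg _)]
    push_cast
    rfl
  have hXc : ∀ n, Continuous (X n) := fun n => by simp only [X]; fun_prop
  have hYc : Continuous Y := by simp only [Y]; fun_prop
  -- weak convergence
  have hweak : ∀ g : ℝ →ᵇ ℝ,
      Filter.Tendsto (fun n => ∫ M, g (X n M) ∂(μ n)) Filter.atTop
        (nhds (∫ z, g (Y z) ∂ν)) := by
    intro g
    have h := HaarMoments.weak_tendsto p hp μ hμ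
      (g.compContinuous ⟨fun z : EuclideanSpace ℝ (Fin r) => Y (WithLp.ofLp z), by fun_prop⟩)
    refine h.congr fun n => ?_
    simp only [hXW]
    rfl
  -- second moments
  have hX2 : ∀ n, MemLp (X n) 2 (μ n) := fun n =>
    (memLp_two_iff_integrable_sq (hXc n).aestronglyMeasurable).2
      (HaarMoments.integrable_cont (hμ n) ((hXc n).pow 2))
  have hY2 : MemLp Y 2 ν := by
    refine (memLp_two_iff_integrable_sq hYc.aestronglyMeasurable).2 ?_
    have h := Integrable.fintype_prod (μ := fun _ : Fin r => gaussianReal 0 1)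
      (f := fun s (x : ℝ) => x ^ (2 * k s)) (fun s => HaarMoments.integrable_pow_gaussian (k s))
    refine h.congr (Filter.Eventually.of_forall fun z => ?_)
    simp only [Y, ← Finset.prod_pow]
    exact Finset.prod_congr rfl fun s _ => by rw [← pow_mul, mul_comm]
  set c : ℝ := ∏ l ∈ Finset.range (2 * K), (2 * (l : ℝ) + 1) with hc
  have hc0 : 0 ≤ c := Finset.prod_nonneg fun _ _ => by positivity
  have hC : ∀ᶠ n in Filter.atTop, ∫ M, X n M ^ 2 ∂(μ n) ≤ 1 + ∑ _s : Fin r, 2 ^ (2 * K) * c := by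
    filter_upwards [Filter.eventually_ge_atTop 1] with n hn
    have hn1 : (1 : ℝ) ≤ n := by exact_mod_cast hn
    have hi : ∀ s : Fin r, Integrable (fun M : Matrix (Fin (n + 1)) (Fin (n + 1)) ℝ =>
        (√((n + 1 : ℕ) : ℝ) * (M ⟨(p s).1 % (n + 1), Nat.mod_lt _ n.succ_pos⟩
           ⟨(p s).2 % (n + 1), Nat.mod_lt _ n.succ_pos⟩)) ^ (2 * (2 * K))) (μ n) := fun s =>
      HaarMoments.integrable_cont (hμ n) (by fun_prop)
    calc ∫ M, X n M ^ 2 ∂(μ n)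
        ≤ ∫ M, (1 + ∑ s : Fin r, (√((n + 1 : ℕ) : ℝ) *
          (M ⟨(p s).1 % (n + 1), Nat.mod_lt _ n.succ_pos⟩
           ⟨(p s).2 % (n + 1), Nat.mod_lt _ n.succ_pos⟩)) ^ (2 * (2 * K))) ∂(μ n) := by
          refine integral_mono (hX2 n).integrable_sq
            ((integrable_const 1).add (integrable_finsetSum _ fun s _ => hi s)) fun M => ?_
          simp only [hXW]
          exact HaarMoments.prod_sq_le k hK _
      _ = 1 + ∑ s : Fin r, ∫ M, (√((n + 1 : ℕ) : ℝ) *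
          (M ⟨(p s).1 % (n + 1), Nat.mod_lt _ n.succ_pos⟩
           ⟨(p s).2 % (n + 1), Nat.mod_lt _ n.succ_pos⟩)) ^ (2 * (2 * K)) ∂(μ n) := by
          rw [integral_add (integrable_const 1) (integrable_finsetSum _ fun s _ => hi s),
            integral_finsetSum _ fun s _ => hi s]
          simp
      _ ≤ _ := by
          gcongr with s _
          have h := HaarMoments.entry_moment (hμ n) (by omega)
            ⟨(p s).1 % (n + 1), Nat.mod_lt _ n.succ_pos⟩
            ⟨(p s).2 % (n + 1), Nat.mod_lt _ n.succ_pos⟩ (2 * K)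
          have e : (((n + 1 : ℕ) : ℝ) - 1) = n := by push_cast; ring
          rw [e] at h
          simp only [mul_pow]
          rw [integral_const_mul, pow_mul (√((n + 1 : ℕ) : ℝ)), Real.sq_sqrt (Nat.cast_nonneg _)]
          have hI : 0 ≤ ∫ M, (M ⟨(p s).1 % (n + 1), Nat.mod_lt _ n.succ_pos⟩
            ⟨(p s).2 % (n + 1), Nat.mod_lt _ n.succ_pos⟩) ^ (2 * (2 * K)) ∂(μ n) :=
            integral_nonneg fun M => by
              simp only [pow_mul _ 2]
              positivity
          have h2 : ((n + 1 : ℕ) : ℝ) ^ (2 * K) ≤ (2 * (n : ℝ)) ^ (2 * K) := by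
            gcongr
            push_cast
            linarith
          calc _ ≤ (2 * (n : ℝ)) ^ (2 * K) * _ := mul_le_mul_of_nonneg_right h2 hI
            _ = 2 ^ (2 * K) * ((n : ℝ) ^ (2 * K) * _) := by rw [mul_pow, mul_assoc]
            _ ≤ _ := mul_le_mul_of_nonneg_left h (by positivity)
  refine ⟨hweak, ?_, HaarMoments.tendsto_of_weak hX2 hY2 hC hweak⟩
  refine HaarMoments.tendsto_of_weak (X := fun n M => |X n M|) (Y := fun z => |Y z|)
    (fun n => (hX2 n).abs) hY2.abs
    (C := 1 + ∑ _s : Fin r, 2 ^ (2 * K) * c) (by simpa only [sq_abs] using hC) ?_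
  intro g
  exact hweak (g.compContinuous ⟨fun x : ℝ => |x|, continuous_abs⟩)
end

section
/- Let M be an n×n Haar-distributed random orthogonal matrix, C_n the permutation matrix of the n-cycle (1,2,...,n), and a, b fixed indices. Then √n · (M C_n Mᵀ)_{ab} = √n · Σ_{i=1}^n M_{a,i} M_{b,i+1} converges in distribution to a standard normal random variable as n → ∞. -/
open MeasureTheory Matrix

open ProbabilityTheory BoundedContinuousFunction

section aux

variable {n : ℕ}

/-- Conjugation-invariant random orthogonal matrix. -/
structure ConjInv (n : ℕ) (ν : Measure (Matrix (Fin n) (Fin n) ℝ)) : Prop where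
  isProb : IsProbabilityMeasure ν
  orth : ∀ᵐ X ∂ν, X * Xᵀ = 1
  inv : ∀ V : Matrix (Fin n) (Fin n) ℝ, V * Vᵀ = 1 → ν.map (fun X => V * X * Vᵀ) = ν

lemma meas_entry (i j : Fin n) : Measurable (fun X : Matrix (Fin n) (Fin n) ℝ => X i j) :=
  (measurable_pi_apply j).comp (measurable_pi_apply i)

lemma meas_of_entry {α : Type*} [MeasurableSpace α] {f : α → Matrix (Fin n) (Fin n) ℝ}
    (h : ∀ i j, Measurable fun x => f x i j) : Measurable f :=
  measurable_pi_iff.2 fun i => measurable_pi_iff.2 fun j => h i j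

lemma meas_conj (V : Matrix (Fin n) (Fin n) ℝ) : Measurable (fun X => V * X * Vᵀ) := by
  apply meas_of_entry
  intro i j
  simp only [Matrix.mul_apply]
  have := fun i j => meas_entry (n := n) i j
  fun_prop

lemma meas_mulself : Measurable (fun X : Matrix (Fin n) (Fin n) ℝ => X * X) := by
  apply meas_of_entry
  intro i j
  simp only [Matrix.mul_apply]
  have := fun i j => meas_entry (n := n) i j
  fun_prop

/-- plane rotation -/
noncomputable def rotM (p q : Fin n) (θ : ℝ) : Matrix (Fin n) (Fin n) ℝ := fun i k =>
  if i = p then (if k = p then Real.cos θ else 0) + (if k = q then Real.sin θ else 0)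
  else if i = q then (if k = p then - Real.sin θ else 0) + (if k = q then Real.cos θ else 0)
  else if k = i then 1 else 0

lemma mul_rotT (p q : Fin n) (θ : ℝ) (Y : Matrix (Fin n) (Fin n) ℝ) (i j : Fin n) :
    (Y * (rotM p q θ)ᵀ) i j =
      if j = p then Real.cos θ * Y i p + Real.sin θ * Y i q
      else if j = q then - Real.sin θ * Y i p + Real.cos θ * Y i q else Y i j := by
  simp only [Matrix.mul_apply, Matrix.transpose_apply, rotM]
  split_ifs <;> simp [mul_add, Finset.sum_add_distrib] <;> ring

lemma rot_mul (p q : Fin n) (θ : ℝ) (Y : Matrix (Fin n) (Fin n) ℝ) (i j : Fin n) :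
    ((rotM p q θ) * Y) i j =
      if i = p then Real.cos θ * Y p j + Real.sin θ * Y q j
      else if i = q then - Real.sin θ * Y p j + Real.cos θ * Y q j else Y i j := by
  have : ((rotM p q θ) * Y) i j = (Yᵀ * (rotM p q θ)ᵀ) j i := by
    rw [← Matrix.transpose_mul, Matrix.transpose_apply]
  rw [this, mul_rotT]
  simp [Matrix.transpose_apply]

lemma rot_orth (p q : Fin n) (hpq : p ≠ q) (θ : ℝ) : rotM p q θ * (rotM p q θ)ᵀ = 1 := by
  ext i j
  have h := Real.sin_sq_add_cos_sq θ
  rw [mul_rotT, Matrix.one_apply]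
  unfold rotM
  have hqp := hpq.symm
  by_cases hip : i = p
  · by_cases hjp : j = p
    · simp [hip, hjp, hpq, hqp]; nlinarith
    · by_cases hjq : j = q
      · simp [hip, hjq, hpq, hqp]; ring
      · simp [hip, hjp, hjq, Ne.symm hjp]
  · by_cases hiq : i = q
    · by_cases hjp : j = p
      · simp [hiq, hjp, hpq, hqp]; ring
      · by_cases hjq : j = q
        · simp [hiq, hjq, hpq, hqp]; nlinarith
        · simp [hiq, hjp, hjq, Ne.symm hjq]
    · by_cases hjp : j = p
      · simp [hip, hiq, hjp, Ne.symm hip, Ne.symm hiq]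
      · by_cases hjq : j = q
        · simp [hip, hiq, hjq, Ne.symm hip, Ne.symm hiq]
        · simp [hip, hiq, hjp, hjq, eq_comm]

lemma entry_le {X : Matrix (Fin n) (Fin n) ℝ} (h : X * Xᵀ = 1) (i j : Fin n) : |X i j| ≤ 1 := by
  have h1 := congrFun (congrFun h i) i
  simp only [Matrix.mul_apply, Matrix.transpose_apply, Matrix.one_apply_eq] at h1
  have h2 : X i j * X i j ≤ 1 := by
    rw [← h1]
    exact Finset.single_le_sum (f := fun j => X i j * X i j) (fun k _ => mul_self_nonneg _)
      (Finset.mem_univ j)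
  exact abs_le_one_iff_mul_self_le_one.2 h2

lemma core {ν : Measure (Matrix (Fin n) (Fin n) ℝ)} [IsProbabilityMeasure ν]
    (y x y' x' : ℝ → Matrix (Fin n) (Fin n) ℝ → ℝ)
    (my : ∀ θ, Measurable (y θ)) (mx : ∀ θ, Measurable (x θ))
    (my' : ∀ θ, Measurable (y' θ)) (mx' : ∀ θ, Measurable (x' θ))
    (hb : ∀ᵐ X ∂ν, ∀ θ, |y θ X| ≤ 4 ∧ |x θ X| ≤ 4 ∧ |y' θ X| ≤ 4 ∧ |x' θ X| ≤ 4)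
    (dy : ∀ X θ, HasDerivAt (fun θ => y θ X) (y' θ X) θ)
    (dx : ∀ X θ, HasDerivAt (fun θ => x θ X) (x' θ X) θ)
    (f f' : ℝ → ℂ) (hf : ∀ x, HasDerivAt f (f' x) x) (cf' : Continuous f')
    (hinv : ∀ θ, ∫ X, (y θ X : ℂ) * f (x θ X) ∂ν = ∫ X, (y 0 X : ℂ) * f (x 0 X) ∂ν) :
    ∫ X, ((y' 0 X : ℂ) * f (x 0 X) + (y 0 X : ℂ) * ((x' 0 X : ℂ) * f' (x 0 X))) ∂ν = 0 := by
  have cf : Continuous f := continuous_iff_continuousAt.2 fun x => (hf x).continuousAt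
  obtain ⟨K, hK⟩ := (isCompact_Icc (a := (-4 : ℝ)) (b := 4)).exists_bound_of_continuousOn
    cf.continuousOn
  obtain ⟨K', hK'⟩ := (isCompact_Icc (a := (-4 : ℝ)) (b := 4)).exists_bound_of_continuousOn
    cf'.continuousOn
  have hms : ∀ θ, Measurable (fun X => (y θ X : ℂ) * f (x θ X)) := fun θ =>
    (Complex.measurable_ofReal.comp (my θ)).mul (cf.measurable.comp (mx θ))
  have key := hasDerivAt_integral_of_dominated_loc_of_deriv_le (μ := ν) (𝕜 := ℝ) (x₀ := 0)
    (s := Set.univ) (F := fun θ X => (y θ X : ℂ) * f (x θ X))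
    (F' := fun θ X => ((y' θ X : ℂ) * f (x θ X) + (y θ X : ℂ) * ((x' θ X : ℂ) * f' (x θ X))))
    (bound := fun _ => 4 * K + 4 * (4 * K')) Filter.univ_mem
    (Filter.Eventually.of_forall fun θ => (hms θ).aestronglyMeasurable) ?_ ?_ ?_
    (integrable_const _) ?_
  · have h2 := key.2
    simp only [hinv] at h2
    exact h2.unique (hasDerivAt_const _ _)
  · refine Integrable.of_bound (hms 0).aestronglyMeasurable (4 * K) ?_
    filter_upwards [hb] with X hX
    obtain ⟨h1, h2, h3, h4⟩ := hX 0
    rw [norm_mul, Complex.norm_real]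
    exact mul_le_mul h1 (hK _ (abs_le.1 h2)) (norm_nonneg _) (by norm_num)
  · exact (((Complex.measurable_ofReal.comp (my' 0)).mul (cf.measurable.comp (mx 0))).add
      ((Complex.measurable_ofReal.comp (my 0)).mul ((Complex.measurable_ofReal.comp (mx' 0)).mul
        (cf'.measurable.comp (mx 0))))).aestronglyMeasurable
  · filter_upwards [hb] with X hX θ _
    obtain ⟨h1, h2, h3, h4⟩ := hX θ
    refine (norm_add_le _ _).trans (add_le_add ?_ ?_)
    · rw [norm_mul, Complex.norm_real]
      exact mul_le_mul h3 (hK _ (abs_le.1 h2)) (norm_nonneg _) (by norm_num)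
    · rw [norm_mul, Complex.norm_real, norm_mul, Complex.norm_real]
      exact mul_le_mul h1 (mul_le_mul h4 (hK' _ (abs_le.1 h2)) (norm_nonneg _) (by norm_num))
        (by positivity) (by norm_num)
  · refine Filter.Eventually.of_forall fun X θ _ => ?_
    have h1 := (dy X θ).ofReal_comp.mul ((hf (x θ X)).scomp θ (dx X θ))
    refine (h1.congr_deriv ?_)
    simp only [Function.comp, Complex.real_smul]

lemma conj_integral {ν : Measure (Matrix (Fin n) (Fin n) ℝ)} (h : ConjInv n ν)
    (V : Matrix (Fin n) (Fin n) ℝ) (hV : V * Vᵀ = 1) (G : Matrix (Fin n) (Fin n) ℝ → ℂ)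
    (hG : Measurable G) : ∫ X, G (V * X * Vᵀ) ∂ν = ∫ X, G X ∂ν := by
  conv_rhs => rw [← h.inv V hV]
  rw [integral_map (meas_conj V).aemeasurable hG.aestronglyMeasurable]

lemma tb {c s u v : ℝ} (hc : |c| ≤ 1) (hs : |s| ≤ 1) (hu : |u| ≤ 1) (hv : |v| ≤ 1) :
    |c * u + s * v| ≤ 4 := by
  have h1 : |c * u| ≤ 1 := by rw [abs_mul]; exact mul_le_one₀ hc (abs_nonneg _) hu
  have h2 : |s * v| ≤ 1 := by rw [abs_mul]; exact mul_le_one₀ hs (abs_nonneg _) hv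
  linarith [abs_add_le (c * u) (s * v)]

lemma offdiag1 {ν : Measure (Matrix (Fin n) (Fin n) ℝ)} (h : ConjInv n ν)
    (a b k : Fin n) (hab : a ≠ b) (hak : a ≠ k) (hbk : b ≠ k)
    (f f' : ℝ → ℂ) (hf : ∀ x, HasDerivAt f (f' x) x) (cf' : Continuous f') :
    ∫ X, (-(X a b : ℂ) * f (X a b) + (X a k : ℂ) * ((X a k : ℂ) * f' (X a b))) ∂ν = 0 := by
  have := h.isProb
  have cf : Continuous f := continuous_iff_continuousAt.2 fun x => (hf x).continuousAt
  have me := fun i j => meas_entry (n := n) i j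
  have key := core (ν := ν) (fun θ X => -Real.sin θ * X a b + Real.cos θ * X a k)
    (fun θ X => Real.cos θ * X a b + Real.sin θ * X a k)
    (fun θ X => -Real.cos θ * X a b + -Real.sin θ * X a k)
    (fun θ X => -Real.sin θ * X a b + Real.cos θ * X a k)
    (fun θ => by fun_prop) (fun θ => by fun_prop) (fun θ => by fun_prop) (fun θ => by fun_prop)
    ?_ ?_ ?_ f f' hf cf' ?_
  · simpa using key
  · filter_upwards [h.orth] with X hX θ
    have h1 := entry_le hX a b
    have h2 := entry_le hX a k
    have hs := Real.abs_sin_le_one θ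
    have hc := Real.abs_cos_le_one θ
    have hs' : |-Real.sin θ| ≤ 1 := by rwa [abs_neg]
    have hc' : |-Real.cos θ| ≤ 1 := by rwa [abs_neg]
    exact ⟨tb hs' hc h1 h2, tb hc hs h1 h2, tb hc' hs' h1 h2, tb hs' hc h1 h2⟩
  · intro X θ
    exact ((Real.hasDerivAt_sin θ).neg.mul_const _).add ((Real.hasDerivAt_cos θ).mul_const _)
  · intro X θ
    exact ((Real.hasDerivAt_cos θ).mul_const _).add ((Real.hasDerivAt_sin θ).mul_const _)
  · intro θ
    have h1 := conj_integral h (rotM b k θ) (rot_orth b k hbk θ)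
      (fun X => (X a k : ℂ) * f (X a b)) (((Complex.measurable_ofReal.comp (me a k)).mul
        (cf.measurable.comp (me a b))))
    simp only [mul_rotT, rot_mul, hab, hak, hbk.symm, if_true, if_false] at h1
    rw [h1]
    simp

lemma diag1 {ν : Measure (Matrix (Fin n) (Fin n) ℝ)} (h : ConjInv n ν)
    (a k : Fin n) (hak : a ≠ k)
    (f f' : ℝ → ℂ) (hf : ∀ x, HasDerivAt f (f' x) x) (cf' : Continuous f') :
    ∫ X, (((X k k - X a a : ℝ) : ℂ) * f (X a a) + (X a k : ℂ) *
      (((X a k + X k a : ℝ) : ℂ) * f' (X a a))) ∂ν = 0 := by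
  have := h.isProb
  have cf : Continuous f := continuous_iff_continuousAt.2 fun x => (hf x).continuousAt
  have me := fun i j => meas_entry (n := n) i j
  have key := core (ν := ν)
    (fun θ X => -Real.sin θ * (Real.cos θ * X a a + Real.sin θ * X k a) +
      Real.cos θ * (Real.cos θ * X a k + Real.sin θ * X k k))
    (fun θ X => Real.cos θ * (Real.cos θ * X a a + Real.sin θ * X k a) +
      Real.sin θ * (Real.cos θ * X a k + Real.sin θ * X k k))
    (fun θ X => Real.cos (2 * θ) * (X k k - X a a) - Real.sin (2 * θ) * (X a k + X k a))
    (fun θ X => Real.cos (2 * θ) * (X a k + X k a) + Real.sin (2 * θ) * (X k k - X a a))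
    (fun θ => by fun_prop) (fun θ => by fun_prop) (fun θ => by fun_prop) (fun θ => by fun_prop)
    ?_ ?_ ?_ f f' hf cf' ?_
  · simpa using key
  · filter_upwards [h.orth] with X hX θ
    have h1 := entry_le hX a a
    have h2 := entry_le hX a k
    have h3 := entry_le hX k a
    have h4 := entry_le hX k k
    have hs := Real.abs_sin_le_one θ
    have hc := Real.abs_cos_le_one θ
    have hs2 := Real.abs_sin_le_one (2 * θ)
    have hc2 := Real.abs_cos_le_one (2 * θ)
    have pr : ∀ c u B : ℝ, |c| ≤ 1 → |u| ≤ B → |c * u| ≤ B := fun c u B hc hu => by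
      rw [abs_mul]
      calc _ ≤ 1 * |u| := by gcongr
        _ ≤ B := by simpa using hu
    have sm : ∀ u v A B : ℝ, |u| ≤ A → |v| ≤ B → |u + v| ≤ A + B := fun u v A B hu hv =>
      (abs_add_le u v).trans (add_le_add hu hv)
    have sb : ∀ u v A B : ℝ, |u| ≤ A → |v| ≤ B → |u - v| ≤ A + B := fun u v A B hu hv =>
      (abs_sub u v).trans (add_le_add hu hv)
    have hs' : |-Real.sin θ| ≤ 1 := by rwa [abs_neg]
    have e1 := sm _ _ _ _ (pr _ _ _ hc h1) (pr _ _ _ hs h3)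
    have e2 := sm _ _ _ _ (pr _ _ _ hc h2) (pr _ _ _ hs h4)
    refine ⟨?_, ?_, ?_, ?_⟩
    · exact (sm _ _ _ _ (pr _ _ _ hs' e1) (pr _ _ _ hc e2)).trans (by norm_num)
    · exact (sm _ _ _ _ (pr _ _ _ hc e1) (pr _ _ _ hs e2)).trans (by norm_num)
    · exact (sb _ _ _ _ (pr _ _ _ hc2 (sb _ _ _ _ h4 h1)) (pr _ _ _ hs2 (sm _ _ _ _ h2 h3))).trans
        (by norm_num)
    · exact (sm _ _ _ _ (pr _ _ _ hc2 (sm _ _ _ _ h2 h3)) (pr _ _ _ hs2 (sb _ _ _ _ h4 h1))).trans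
        (by norm_num)
  · intro X θ
    have d1 := (Real.hasDerivAt_sin θ)
    have d2 := (Real.hasDerivAt_cos θ)
    refine HasDerivAt.congr_deriv ((d1.neg.mul ((d2.mul_const (X a a)).add (d1.mul_const (X k a)))).add
      (d2.mul ((d2.mul_const (X a k)).add (d1.mul_const (X k k))))) ?_
    rw [Real.cos_two_mul', Real.sin_two_mul]
    simp only [Pi.neg_apply, Pi.add_apply]
    ring
  · intro X θ
    have d1 := (Real.hasDerivAt_sin θ)
    have d2 := (Real.hasDerivAt_cos θ)
    refine HasDerivAt.congr_deriv ((d2.mul ((d2.mul_const (X a a)).add (d1.mul_const (X k a)))).add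
      (d1.mul ((d2.mul_const (X a k)).add (d1.mul_const (X k k))))) ?_
    rw [Real.cos_two_mul', Real.sin_two_mul]
    simp only [Pi.add_apply]
    ring
  · intro θ
    have h1 := conj_integral h (rotM a k θ) (rot_orth a k hak θ)
      (fun X => (X a k : ℂ) * f (X a a)) (((Complex.measurable_ofReal.comp (me a k)).mul
        (cf.measurable.comp (me a a))))
    simp only [mul_rotT, rot_mul, hak.symm, if_true, if_false] at h1
    rw [h1]
    simp

lemma int_ent {ν : Measure (Matrix (Fin n) (Fin n) ℝ)} (h : ConjInv n ν)
    (P : Matrix (Fin n) (Fin n) ℝ → ℝ) (mP : Measurable P) (B : ℝ) (hP : ∀ᵐ X ∂ν, |P X| ≤ B)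
    (a b : Fin n) (f : ℝ → ℂ) (cf : Continuous f) :
    Integrable (fun X => (P X : ℂ) * f (X a b)) ν := by
  have := h.isProb
  obtain ⟨K, hK⟩ := (isCompact_Icc (a := (-1 : ℝ)) (b := 1)).exists_bound_of_continuousOn
    cf.continuousOn
  refine Integrable.of_bound ((Complex.measurable_ofReal.comp mP).mul
    (cf.measurable.comp (meas_entry a b))).aestronglyMeasurable (B * K) ?_
  filter_upwards [hP, h.orth] with X h1 hX
  rw [norm_mul, Complex.norm_real]
  exact mul_le_mul h1 (hK _ (abs_le.1 (entry_le hX a b))) (norm_nonneg _)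
    ((abs_nonneg _).trans h1)

lemma abs_mul_le_one {u v : ℝ} (hu : |u| ≤ 1) (hv : |v| ≤ 1) : |u * v| ≤ 1 := by
  rw [abs_mul]; exact mul_le_one₀ hu (abs_nonneg _) hv

lemma row_sq {X : Matrix (Fin n) (Fin n) ℝ} (h : X * Xᵀ = 1) (a : Fin n) :
    ∑ k, X a k * X a k = 1 := by
  have h1 := congrFun (congrFun h a) a
  simpa only [Matrix.mul_apply, Matrix.transpose_apply, Matrix.one_apply_eq] using h1

lemma offdiag2 {ν : Measure (Matrix (Fin n) (Fin n) ℝ)} (h : ConjInv n ν)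
    (a b : Fin n) (hab : a ≠ b)
    (f f' : ℝ → ℂ) (hf : ∀ x, HasDerivAt f (f' x) x) (cf' : Continuous f') :
    ((n : ℂ) - 2) * ∫ X, (X a b : ℂ) * f (X a b) ∂ν =
      ∫ X, ((1 - X a a ^ 2 - X a b ^ 2 : ℝ) : ℂ) * f' (X a b) ∂ν := by
  have := h.isProb
  have cf : Continuous f := continuous_iff_continuousAt.2 fun x => (hf x).continuousAt
  have me := fun i j => meas_entry (n := n) i j
  have i1 : Integrable (fun X => (X a b : ℂ) * f (X a b)) ν :=
    int_ent h _ (me a b) 1 (h.orth.mono fun X hX => entry_le hX a b) a b f cf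
  have i2 : ∀ k, Integrable (fun X => ((X a k * X a k : ℝ) : ℂ) * f' (X a b)) ν := fun k =>
    int_ent h _ ((me a k).mul (me a k)) 1
      (h.orth.mono fun X hX => abs_mul_le_one (entry_le hX a k) (entry_le hX a k)) a b f' cf'
  have e1 : ∀ k, k ≠ a → k ≠ b → ∫ X, ((X a k * X a k : ℝ) : ℂ) * f' (X a b) ∂ν =
      ∫ X, (X a b : ℂ) * f (X a b) ∂ν := by
    intro k hka hkb
    have := offdiag1 h a b k hab hka.symm hkb.symm f f' hf cf'
    rw [← sub_eq_zero, ← integral_sub (i2 k) i1, ← this]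
    congr 1
    ext X
    push_cast
    ring
  have hb : b ∈ Finset.univ.erase a := by simp [hab.symm]
  have e2 : ∑ k ∈ (Finset.univ.erase a).erase b, ∫ X, ((X a k * X a k : ℝ) : ℂ) * f' (X a b) ∂ν =
      ((n : ℂ) - 2) * ∫ X, (X a b : ℂ) * f (X a b) ∂ν := by
    rw [Finset.sum_congr rfl (fun k hk => e1 k (by simp at hk; tauto) (by simp at hk; tauto)),
      Finset.sum_const, Finset.card_erase_of_mem hb, Finset.card_erase_of_mem (Finset.mem_univ _),
      nsmul_eq_mul, Finset.card_univ, Fintype.card_fin]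
    have : 2 ≤ n := by
      have := Finset.card_pos.2 ⟨b, hb⟩
      rw [Finset.card_erase_of_mem (Finset.mem_univ _), Finset.card_univ, Fintype.card_fin] at this
      omega
    rw [Nat.sub_sub, Nat.cast_sub this]
    norm_num
  rw [← e2, ← integral_finsetSum _ (fun k _ => i2 k)]
  apply integral_congr_ae
  filter_upwards [h.orth] with X hX
  rw [← Finset.sum_mul]
  congr 1
  rw [Finset.sum_erase_eq_sub hb, Finset.sum_erase_eq_sub (Finset.mem_univ _),
    ← Complex.ofReal_sum, row_sq hX a]
  push_cast
  ring

lemma diag2 {ν : Measure (Matrix (Fin n) (Fin n) ℝ)} (h : ConjInv n ν)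
    (htr : ∀ᵐ X ∂ν, X.trace = 0) (a : Fin n)
    (f f' : ℝ → ℂ) (hf : ∀ x, HasDerivAt f (f' x) x) (cf' : Continuous f') :
    (n : ℂ) * ∫ X, (X a a : ℂ) * f (X a a) ∂ν =
      ∫ X, ((1 - 2 * X a a ^ 2 + (X * X) a a : ℝ) : ℂ) * f' (X a a) ∂ν := by
  have := h.isProb
  have cf : Continuous f := continuous_iff_continuousAt.2 fun x => (hf x).continuousAt
  have me := fun i j => meas_entry (n := n) i j
  have i1 : ∀ k, Integrable (fun X => (X k k : ℂ) * f (X a a)) ν := fun k =>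
    int_ent h _ (me k k) 1 (h.orth.mono fun X hX => entry_le hX k k) a a f cf
  have i2 : ∀ k l, Integrable (fun X => ((X a k * X k l : ℝ) : ℂ) * f' (X a a)) ν := fun k l =>
    int_ent h _ ((me a k).mul (me k l)) 1
      (h.orth.mono fun X hX => abs_mul_le_one (entry_le hX a k) (entry_le hX k l)) a a f' cf'
  have i3 : ∀ k, Integrable (fun X => ((X a k * X a k : ℝ) : ℂ) * f' (X a a)) ν := fun k =>
    int_ent h _ ((me a k).mul (me a k)) 1
      (h.orth.mono fun X hX => abs_mul_le_one (entry_le hX a k) (entry_le hX a k)) a a f' cf'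
  have i4 : ∀ k, Integrable (fun X => ((X a k * X a k : ℝ) : ℂ) * f' (X a a) +
      ((X a k * X k a : ℝ) : ℂ) * f' (X a a)) ν := fun k => (i3 k).add (i2 k a)
  have i5 : ∀ k, Integrable (fun X => ((X a k * X a k : ℝ) : ℂ) * f' (X a a) +
      ((X a k * X k a : ℝ) : ℂ) * f' (X a a) + (X k k : ℂ) * f (X a a)) ν :=
    fun k => (i4 k).add (i1 k)
  have e1 : ∀ k, k ≠ a → ∫ X, (((X a k * X a k : ℝ) : ℂ) * f' (X a a) +
      ((X a k * X k a : ℝ) : ℂ) * f' (X a a) + (X k k : ℂ) * f (X a a)) ∂ν =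
      ∫ X, (X a a : ℂ) * f (X a a) ∂ν := by
    intro k hka
    have := diag1 h a k hka.symm f f' hf cf'
    rw [← sub_eq_zero, ← integral_sub (i5 k) (i1 a), ← this]
    congr 1
    ext X
    push_cast
    ring
  have e2 : ∑ k ∈ (Finset.univ.erase a), ∫ X, (((X a k * X a k : ℝ) : ℂ) * f' (X a a) +
      ((X a k * X k a : ℝ) : ℂ) * f' (X a a) + (X k k : ℂ) * f (X a a)) ∂ν =
      ((n : ℂ) - 1) * ∫ X, (X a a : ℂ) * f (X a a) ∂ν := by
    rw [Finset.sum_congr rfl (fun k hk => e1 k (by simpa using hk)),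
      Finset.sum_const, Finset.card_erase_of_mem (Finset.mem_univ _),
      nsmul_eq_mul, Finset.card_univ, Fintype.card_fin]
    have : 1 ≤ n := a.pos
    rw [Nat.cast_sub this]
    norm_num
  have e3 : (n : ℂ) * ∫ X, (X a a : ℂ) * f (X a a) ∂ν =
      ((n : ℂ) - 1) * ∫ X, (X a a : ℂ) * f (X a a) ∂ν + ∫ X, (X a a : ℂ) * f (X a a) ∂ν := by ring
  rw [e3, ← e2, ← integral_finsetSum _ (fun k _ => i5 k),
    ← integral_add (integrable_finsetSum _ (fun k _ => i5 k)) (i1 a)]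
  apply integral_congr_ae
  filter_upwards [h.orth, htr] with X hX hT
  have r1 := row_sq hX a
  have r2 : ∑ k, X a k * X k a = (X * X) a a := (Matrix.mul_apply).symm
  have r3 : ∑ k, X k k = 0 := hT
  rw [Finset.sum_erase_eq_sub (Finset.mem_univ _), Finset.sum_add_distrib, Finset.sum_add_distrib,
    ← Finset.sum_mul, ← Finset.sum_mul, ← Finset.sum_mul, ← Complex.ofReal_sum,
    ← Complex.ofReal_sum, ← Complex.ofReal_sum, r1, r2, r3]
  push_cast
  ring

lemma int_real {ν : Measure (Matrix (Fin n) (Fin n) ℝ)} (h : ConjInv n ν)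
    (P : Matrix (Fin n) (Fin n) ℝ → ℝ) (mP : Measurable P) (B : ℝ) (hP : ∀ᵐ X ∂ν, |P X| ≤ B) :
    Integrable P ν := by
  have := h.isProb
  exact Integrable.of_bound mP.aestronglyMeasurable B hP

lemma off_sq {ν : Measure (Matrix (Fin n) (Fin n) ℝ)} (h : ConjInv n ν)
    (a b : Fin n) (hab : a ≠ b) : ((n : ℝ) - 2) * ∫ X, X a b ^ 2 ∂ν ≤ 1 := by
  have := h.isProb
  have me := fun i j => meas_entry (n := n) i j
  have key := offdiag2 h a b hab (fun x => (x : ℂ)) (fun _ => 1)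
    (fun x => (hasDerivAt_id x).ofReal_comp) continuous_const
  have e1 : ∀ X : Matrix (Fin n) (Fin n) ℝ, (X a b : ℂ) * (X a b : ℂ) = ((X a b ^ 2 : ℝ) : ℂ) := by
    intro X; push_cast; ring
  simp only [e1, mul_one] at key
  have o1 := integral_complex_ofReal (μ := ν)
    (f := fun X : Matrix (Fin n) (Fin n) ℝ => X a b ^ 2)
  have o2 := integral_complex_ofReal (μ := ν)
    (f := fun X : Matrix (Fin n) (Fin n) ℝ => 1 - X a a ^ 2 - X a b ^ 2)
  rw [o1, o2] at key
  have key2 : ((n : ℝ) - 2) * ∫ X, X a b ^ 2 ∂ν = ∫ X, (1 - X a a ^ 2 - X a b ^ 2) ∂ν := by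
    exact_mod_cast key
  rw [key2]
  calc ∫ X, (1 - X a a ^ 2 - X a b ^ 2) ∂ν ≤ ∫ X, (1 : ℝ) ∂ν := by
        refine integral_mono_ae ?_ (integrable_const _) ?_
        · apply int_real h _ (by fun_prop) 3
          filter_upwards [h.orth] with X hX
          have h1 := sq_le_one_iff_abs_le_one _ |>.2 (entry_le hX a a)
          have h2 := sq_le_one_iff_abs_le_one _ |>.2 (entry_le hX a b)
          rw [abs_le]; constructor <;> nlinarith [sq_nonneg (X a a), sq_nonneg (X a b)]
        · exact Filter.Eventually.of_forall fun X => by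
            show 1 - X a a ^ 2 - X a b ^ 2 ≤ 1
            nlinarith [sq_nonneg (X a a), sq_nonneg (X a b)]
    _ = 1 := by simp

lemma orth_sq {X : Matrix (Fin n) (Fin n) ℝ} (h : X * Xᵀ = 1) : (X * X) * (X * X)ᵀ = 1 := by
  rw [Matrix.transpose_mul, Matrix.mul_assoc, ← Matrix.mul_assoc X Xᵀ, h, Matrix.one_mul, h]

lemma diag_sq {ν : Measure (Matrix (Fin n) (Fin n) ℝ)} (h : ConjInv n ν)
    (htr : ∀ᵐ X ∂ν, X.trace = 0) (a : Fin n) : (n : ℝ) * ∫ X, X a a ^ 2 ∂ν ≤ 2 := by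
  have := h.isProb
  have me := fun i j => meas_entry (n := n) i j
  have me2 : Measurable fun X : Matrix (Fin n) (Fin n) ℝ => (X * X) a a :=
    (me a a).comp meas_mulself
  have key := diag2 h htr a (fun x => (x : ℂ)) (fun _ => 1)
    (fun x => (hasDerivAt_id x).ofReal_comp) continuous_const
  have e1 : ∀ X : Matrix (Fin n) (Fin n) ℝ, (X a a : ℂ) * (X a a : ℂ) = ((X a a ^ 2 : ℝ) : ℂ) := by
    intro X; push_cast; ring
  simp only [e1, mul_one] at key
  have o1 := integral_complex_ofReal (μ := ν)
    (f := fun X : Matrix (Fin n) (Fin n) ℝ => X a a ^ 2)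
  have o2 := integral_complex_ofReal (μ := ν)
    (f := fun X : Matrix (Fin n) (Fin n) ℝ => 1 - 2 * X a a ^ 2 + (X * X) a a)
  rw [o1, o2] at key
  have key2 : (n : ℝ) * ∫ X, X a a ^ 2 ∂ν = ∫ X, (1 - 2 * X a a ^ 2 + (X * X) a a) ∂ν := by
    exact_mod_cast key
  rw [key2]
  calc ∫ X, (1 - 2 * X a a ^ 2 + (X * X) a a) ∂ν ≤ ∫ X, (2 : ℝ) ∂ν := by
        refine integral_mono_ae ?_ (integrable_const _) ?_
        · apply int_real h _ ((measurable_const.sub (((me a a).pow_const 2).const_mul 2)).add me2) 4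
          filter_upwards [h.orth] with X hX
          have h1 := sq_le_one_iff_abs_le_one _ |>.2 (entry_le hX a a)
          have h2 := abs_le.1 (entry_le (orth_sq hX) a a)
          show |1 - 2 * X a a ^ 2 + (X * X) a a| ≤ 4
          rw [abs_le]; constructor <;> nlinarith [sq_nonneg (X a a)]
        · filter_upwards [h.orth] with X hX
          have h2 := abs_le.1 (entry_le (orth_sq hX) a a)
          nlinarith [sq_nonneg (X a a)]
    _ = 2 := by simp

lemma conjInv_sq {ν : Measure (Matrix (Fin n) (Fin n) ℝ)} (h : ConjInv n ν) :
    ConjInv n (ν.map (fun X => X * X)) := by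
  have := h.isProb
  refine ⟨Measure.isProbabilityMeasure_map meas_mulself.aemeasurable, ?_, ?_⟩
  · refine (ae_map_iff meas_mulself.aemeasurable ?_).2 (h.orth.mono fun X hX => orth_sq hX)
    have : {X : Matrix (Fin n) (Fin n) ℝ | X * Xᵀ = 1} =
        ⋂ i, ⋂ j, {X : Matrix (Fin n) (Fin n) ℝ | (X * Xᵀ) i j = (1 : Matrix _ _ ℝ) i j} := by
      ext X; simp [← Matrix.ext_iff]
    rw [this]
    refine MeasurableSet.iInter fun i => MeasurableSet.iInter fun j => ?_
    refine measurableSet_eq_fun ?_ measurable_const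
    simp only [Matrix.mul_apply, Matrix.transpose_apply]
    have := fun i j => meas_entry (n := n) i j
    fun_prop
  · intro V hV
    conv_rhs => rw [← h.inv V hV]
    rw [Measure.map_map (meas_conj V) meas_mulself, Measure.map_map meas_mulself (meas_conj V)]
    congr 1
    ext1 X
    have hV' : Vᵀ * V = 1 := mul_eq_one_comm.1 hV
    simp only [Function.comp]
    calc V * (X * X) * Vᵀ = V * X * (1 * X) * Vᵀ := by simp [Matrix.mul_assoc]
      _ = _ := by rw [← hV']; simp only [Matrix.mul_assoc]

lemma ode {ν : Measure (Matrix (Fin n) (Fin n) ℝ)} (h : ConjInv n ν) (a b : Fin n)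
    (T : Matrix (Fin n) (Fin n) ℝ → ℝ) (mT : Measurable T) (B : ℝ) (hT : ∀ᵐ X ∂ν, |T X| ≤ B)
    (r δ : ℝ) (hδ : ∫ X, |T X - 1| ∂ν ≤ δ)
    (hst : ∀ t : ℝ, (r : ℂ) * ∫ X, (X a b : ℂ) * Complex.exp (t * (r * X a b) * Complex.I) ∂ν =
      t * Complex.I * ∫ X, (T X : ℂ) * Complex.exp (t * (r * X a b) * Complex.I) ∂ν) (t : ℝ) :
    ‖(∫ X, Complex.exp (t * (r * X a b) * Complex.I) ∂ν) - Complex.exp (-(t ^ 2 / 2 : ℝ))‖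
      ≤ t ^ 2 * δ := by
  have := h.isProb
  have me := fun i j => meas_entry (n := n) i j
  set φ : ℝ → ℂ := fun t => ∫ X, Complex.exp (t * (r * X a b) * Complex.I) ∂ν with hφ
  have mexp : ∀ t : ℝ, Measurable (fun X : Matrix (Fin n) (Fin n) ℝ =>
      Complex.exp (t * (r * X a b) * Complex.I)) := fun t => by
    have := me a b
    fun_prop
  have nexp : ∀ (t : ℝ) (X : Matrix (Fin n) (Fin n) ℝ),
      ‖Complex.exp (t * (r * X a b) * Complex.I)‖ = 1 := fun t X => by
    have := Complex.norm_exp_ofReal_mul_I (t * (r * X a b))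
    push_cast at this
    exact this
  have iexp : ∀ t : ℝ, Integrable (fun X : Matrix (Fin n) (Fin n) ℝ =>
      Complex.exp (t * (r * X a b) * Complex.I)) ν := fun t =>
    Integrable.of_bound (mexp t).aestronglyMeasurable 1
      (Filter.Eventually.of_forall fun X => (nexp t X).le)
  have iT : ∀ t : ℝ, Integrable (fun X : Matrix (Fin n) (Fin n) ℝ =>
      (T X : ℂ) * Complex.exp (t * (r * X a b) * Complex.I)) ν := fun t => by
    refine Integrable.of_bound ((Complex.measurable_ofReal.comp mT).mul
      (mexp t)).aestronglyMeasurable B (hT.mono fun X hX => ?_)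
    rw [norm_mul, nexp, mul_one, Complex.norm_real]
    exact hX
  have dφ : ∀ t : ℝ, HasDerivAt φ
      (∫ X, Complex.exp (t * (r * X a b) * Complex.I) * (r * X a b * Complex.I) ∂ν) t := by
    intro t
    refine (hasDerivAt_integral_of_dominated_loc_of_deriv_le (μ := ν) (𝕜 := ℝ) (x₀ := t)
      (s := Set.univ) (F := fun (t : ℝ) X => Complex.exp (t * (r * X a b) * Complex.I))
      (F' := fun (t : ℝ) X => Complex.exp (t * (r * X a b) * Complex.I) * (r * X a b * Complex.I))
      (bound := fun _ => |r|) Filter.univ_mem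
      (Filter.Eventually.of_forall fun θ => (mexp θ).aestronglyMeasurable) (iexp t) ?_ ?_
      (integrable_const _) ?_).2
    · refine ((mexp t).mul ?_).aestronglyMeasurable
      have := me a b
      fun_prop
    · filter_upwards [h.orth] with X hX s _
      rw [norm_mul, nexp, one_mul, norm_mul, norm_mul, Complex.norm_I, Complex.norm_real,
        Complex.norm_real, mul_one]
      exact mul_le_of_le_one_right (abs_nonneg _) (entry_le hX a b)
    · refine Filter.Eventually.of_forall fun X s _ => ?_
      have d0 : HasDerivAt (fun s : ℝ => (s : ℂ)) 1 s := (hasDerivAt_id s).ofReal_comp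
      have := ((d0.mul_const ((r : ℂ) * X a b)).mul_const Complex.I).cexp
      refine this.congr_deriv ?_
      ring
  have dφ2 : ∀ t : ℝ, HasDerivAt φ (-t * (φ t +
      ∫ X, ((T X - 1 : ℝ) : ℂ) * Complex.exp (t * (r * X a b) * Complex.I) ∂ν)) t := by
    intro t
    refine (dφ t).congr_deriv ?_
    have e1 : ∫ X, Complex.exp (t * (r * X a b) * Complex.I) * (r * X a b * Complex.I) ∂ν =
        Complex.I * ((r : ℂ) * ∫ X, (X a b : ℂ) * Complex.exp (t * (r * X a b) * Complex.I) ∂ν) := by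
      rw [← integral_const_mul, ← integral_const_mul]
      congr 1
      ext X
      ring
    have e2 : ∫ X, ((T X - 1 : ℝ) : ℂ) * Complex.exp (t * (r * X a b) * Complex.I) ∂ν =
        (∫ X, (T X : ℂ) * Complex.exp (t * (r * X a b) * Complex.I) ∂ν) - φ t := by
      rw [hφ, ← integral_sub (iT t) (iexp t)]
      congr 1
      ext X
      push_cast
      ring
    rw [e1, e2, hst]
    linear_combination (t : ℂ) * (∫ X, (T X : ℂ) * Complex.exp (t * (r * X a b) * Complex.I) ∂ν) *
      Complex.I_mul_I
  have rb : ∀ t : ℝ, ‖∫ X, ((T X - 1 : ℝ) : ℂ) * Complex.exp (t * (r * X a b) * Complex.I) ∂ν‖ ≤ δ := by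
    intro t
    refine (norm_integral_le_integral_norm _).trans (le_trans (le_of_eq ?_) hδ)
    congr 1
    ext X
    rw [norm_mul, nexp, mul_one, Complex.norm_real, Real.norm_eq_abs]
  have hδ0 : 0 ≤ δ := (norm_nonneg _).trans (rb 0)
  set R : ℝ → ℂ := fun t => ∫ X, ((T X - 1 : ℝ) : ℂ) * Complex.exp (t * (r * X a b) * Complex.I) ∂ν
  have dψ : ∀ s : ℝ, HasDerivAt (fun s : ℝ => φ s * Complex.exp ((s ^ 2 / 2 : ℝ)))
      (-s * R s * Complex.exp ((s ^ 2 / 2 : ℝ))) s := by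
    intro s
    have d0 : HasDerivAt (fun s : ℝ => s ^ 2 / 2) s s := by
      refine (((hasDerivAt_id s).pow 2).div_const 2).congr_deriv ?_
      simp
    have := (dφ2 s).mul d0.ofReal_comp.cexp
    refine this.congr_deriv ?_
    show -(s : ℂ) * (φ s + R s) * _ + _ = _
    ring
  have mv := (convex_Icc (-|t|) |t|).norm_image_sub_le_of_norm_hasDerivWithin_le
    (f := fun s : ℝ => φ s * Complex.exp ((s ^ 2 / 2 : ℝ)))
    (f' := fun s : ℝ => -s * R s * Complex.exp ((s ^ 2 / 2 : ℝ)))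
    (C := |t| * δ * Real.exp (t ^ 2 / 2)) (x := 0) (y := t)
    (fun s _ => (dψ s).hasDerivWithinAt) (fun s hs => by
      have hs' : |s| ≤ |t| := abs_le.2 hs
      rw [norm_mul, norm_mul, norm_neg, Complex.norm_real, Complex.norm_exp, Complex.ofReal_re,
        Real.norm_eq_abs]
      have : s ^ 2 ≤ t ^ 2 := sq_le_sq.2 hs'
      have := rb s
      gcongr) ⟨by simp, by simp⟩ (abs_le.1 le_rfl)
  have φ0 : φ 0 = 1 := by simp [hφ]
  have e3 : φ t - Complex.exp (-(t ^ 2 / 2 : ℝ)) =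
      (φ t * Complex.exp ((t ^ 2 / 2 : ℝ)) - φ 0 * Complex.exp (((0:ℝ) ^ 2 / 2 : ℝ))) *
        Complex.exp (-(t ^ 2 / 2 : ℝ)) := by
    rw [φ0, sub_mul, mul_assoc, ← Complex.exp_add]
    simp
  rw [e3, norm_mul]
  calc _ ≤ (|t| * δ * Real.exp (t ^ 2 / 2) * ‖t - 0‖) * ‖Complex.exp (-(t ^ 2 / 2 : ℝ))‖ := by
        gcongr
    _ = t ^ 2 * δ := by
        rw [← Complex.ofReal_neg, Complex.norm_exp, Complex.ofReal_re, sub_zero, Real.norm_eq_abs,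
          Real.exp_neg]
        field_simp
        rw [sq_abs]
        ring

lemma dexp (t r x : ℝ) : HasDerivAt (fun x : ℝ => Complex.exp (t * (r * x) * Complex.I))
    (Complex.exp (t * (r * x) * Complex.I) * (t * r * Complex.I)) x := by
  have d0 : HasDerivAt (fun s : ℝ => (s : ℂ)) 1 x := (hasDerivAt_id x).ofReal_comp
  refine (((d0.const_mul (r : ℂ)).const_mul (t : ℂ)).mul_const Complex.I).cexp.congr_deriv ?_
  ring

lemma bound_off {ν : Measure (Matrix (Fin n) (Fin n) ℝ)} (h : ConjInv n ν)
    (htr : ∀ᵐ X ∂ν, X.trace = 0) (hn : 3 ≤ n) (a b : Fin n) (hab : a ≠ b) (t : ℝ) :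
    ‖(∫ X, Complex.exp (t * ((Real.sqrt n : ℝ) * X a b) * Complex.I) ∂ν) -
      Complex.exp (-(t ^ 2 / 2 : ℝ))‖ ≤ t ^ 2 * (11 / ((n : ℝ) - 2)) := by
  have := h.isProb
  have me := fun i j => meas_entry (n := n) i j
  have hn' : (3 : ℝ) ≤ n := by exact_mod_cast hn
  have hpos : (0 : ℝ) < (n : ℝ) - 2 := by linarith
  have c3 : (n : ℝ) / (n - 2) ≤ 3 := by rw [div_le_iff₀ hpos]; linarith
  have c0 : 0 ≤ (n : ℝ) / (n - 2) := by positivity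
  have hr : (Real.sqrt n : ℝ) * Real.sqrt n = n := Real.mul_self_sqrt (by positivity)
  have hrC : ((Real.sqrt n : ℝ) : ℂ) * (Real.sqrt n : ℝ) = n := by exact_mod_cast hr
  have hnC : (n : ℂ) - 2 ≠ 0 := by
    have : (((n : ℝ) - 2 : ℝ) : ℂ) ≠ 0 := Complex.ofReal_ne_zero.2 hpos.ne'
    simpa using this
  have bd : ∀ᵐ X ∂ν, X a a ^ 2 ≤ 1 ∧ X a b ^ 2 ≤ 1 := by
    filter_upwards [h.orth] with X hX
    exact ⟨sq_le_one_iff_abs_le_one _ |>.2 (entry_le hX a a),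
      sq_le_one_iff_abs_le_one _ |>.2 (entry_le hX a b)⟩
  have isq : ∀ i j, Integrable (fun X : Matrix (Fin n) (Fin n) ℝ => X i j ^ 2) ν := fun i j =>
    int_real h _ ((me i j).pow_const 2) 1 (h.orth.mono fun X hX => by
      rw [abs_of_nonneg (sq_nonneg _)]
      exact sq_le_one_iff_abs_le_one _ |>.2 (entry_le hX i j))
  have mT : Measurable (fun X : Matrix (Fin n) (Fin n) ℝ =>
      (n : ℝ) / (n - 2) * (1 - X a a ^ 2 - X a b ^ 2)) := by fun_prop
  have bT : ∀ᵐ X ∂ν, |(n : ℝ) / (n - 2) * (1 - X a a ^ 2 - X a b ^ 2)| ≤ 9 := by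
    filter_upwards [bd] with X ⟨h1, h2⟩
    rw [abs_mul, abs_of_nonneg c0]
    have : |1 - X a a ^ 2 - X a b ^ 2| ≤ 3 := by
      rw [abs_le]; constructor <;> nlinarith [sq_nonneg (X a a), sq_nonneg (X a b)]
    nlinarith [abs_nonneg (1 - X a a ^ 2 - X a b ^ 2)]
  refine ode h a b (fun X => (n : ℝ) / (n - 2) * (1 - X a a ^ 2 - X a b ^ 2)) mT 9 bT _ _ ?_ ?_ t
  · have e1 : ∫ X, |(n : ℝ) / (n - 2) * (1 - X a a ^ 2 - X a b ^ 2) - 1| ∂ν ≤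
        ∫ X, (2 / ((n : ℝ) - 2) + (3 * X a a ^ 2 + 3 * X a b ^ 2)) ∂ν := by
      refine integral_mono_ae ?_ ((integrable_const _).add (((isq a a).const_mul 3).add
        ((isq a b).const_mul 3))) ?_
      · exact ((int_real h _ mT 9 bT).sub (integrable_const _)).abs
      · filter_upwards with X
        have e : (n : ℝ) / (n - 2) * (1 - X a a ^ 2 - X a b ^ 2) - 1 =
            2 / ((n : ℝ) - 2) - (n : ℝ) / (n - 2) * (X a a ^ 2 + X a b ^ 2) := by
          field_simp
          ring
        have p : 0 ≤ 2 / ((n : ℝ) - 2) := by positivity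
        have q : 0 ≤ X a a ^ 2 + X a b ^ 2 := by positivity
        show |(n : ℝ) / (n - 2) * (1 - X a a ^ 2 - X a b ^ 2) - 1| ≤
          2 / ((n : ℝ) - 2) + (3 * X a a ^ 2 + 3 * X a b ^ 2)
        rw [e, abs_le]
        constructor <;> nlinarith [mul_nonneg c0 q, mul_le_mul_of_nonneg_right c3 q]
    refine e1.trans ?_
    have iR : Integrable (fun X : Matrix (Fin n) (Fin n) ℝ => 3 * X a a ^ 2 + 3 * X a b ^ 2) ν :=
      ((isq a a).const_mul 3).add ((isq a b).const_mul 3)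
    rw [integral_add (integrable_const _) iR,
      integral_add ((isq a a).const_mul 3) ((isq a b).const_mul 3), integral_const_mul,
      integral_const_mul, integral_const]
    have k1 := off_sq h a b hab
    have k2 := diag_sq h htr a
    have p1 : 0 ≤ ∫ X, X a a ^ 2 ∂ν := integral_nonneg fun X => sq_nonneg _
    rw [probReal_univ, one_smul, le_div_iff₀ hpos]
    have : (2 / ((n : ℝ) - 2)) * ((n : ℝ) - 2) = 2 := by field_simp
    nlinarith
  · intro t
    have key := offdiag2 h a b hab _ _ (dexp t (Real.sqrt n)) (by fun_prop)
    have e2 : ∫ X, ((1 - X a a ^ 2 - X a b ^ 2 : ℝ) : ℂ) *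
        (Complex.exp (t * ((Real.sqrt n : ℝ) * X a b) * Complex.I) *
          (t * (Real.sqrt n : ℝ) * Complex.I)) ∂ν = (t * (Real.sqrt n : ℝ) * Complex.I) *
        ∫ X, ((1 - X a a ^ 2 - X a b ^ 2 : ℝ) : ℂ) *
        Complex.exp (t * ((Real.sqrt n : ℝ) * X a b) * Complex.I) ∂ν := by
      rw [← integral_const_mul]
      congr 1
      ext X
      ring
    have e3 : ∫ X, (((n : ℝ) / (n - 2) * (1 - X a a ^ 2 - X a b ^ 2) : ℝ) : ℂ) *
        Complex.exp (t * ((Real.sqrt n : ℝ) * X a b) * Complex.I) ∂ν = ((n : ℂ) / (n - 2)) *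
        ∫ X, ((1 - X a a ^ 2 - X a b ^ 2 : ℝ) : ℂ) *
        Complex.exp (t * ((Real.sqrt n : ℝ) * X a b) * Complex.I) ∂ν := by
      rw [← integral_const_mul]
      congr 1
      ext X
      push_cast
      ring
    rw [e2] at key
    rw [e3]
    generalize ∫ X, ((1 - X a a ^ 2 - X a b ^ 2 : ℝ) : ℂ) *
        Complex.exp (t * ((Real.sqrt n : ℝ) * X a b) * Complex.I) ∂ν = J at key ⊢
    generalize ∫ X, (X a b : ℂ) *
        Complex.exp (t * ((Real.sqrt n : ℝ) * X a b) * Complex.I) ∂ν = K at key ⊢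
    apply mul_left_cancel₀ hnC
    have e4 : ((n : ℂ) - 2) * (t * Complex.I * ((n : ℂ) / (n - 2) * J)) =
        t * Complex.I * n * J := by field_simp
    rw [e4]
    linear_combination ((Real.sqrt n : ℝ) : ℂ) * key + t * Complex.I * J * hrC

lemma bound_diag {ν : Measure (Matrix (Fin n) (Fin n) ℝ)} (h : ConjInv n ν)
    (htr : ∀ᵐ X ∂ν, X.trace = 0) (htr2 : ∀ᵐ X ∂ν, (X * X).trace = 0) (hn : 3 ≤ n) (a : Fin n)
    (t : ℝ) :
    ‖(∫ X, Complex.exp (t * ((Real.sqrt n : ℝ) * X a a) * Complex.I) ∂ν) -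
      Complex.exp (-(t ^ 2 / 2 : ℝ))‖ ≤ t ^ 2 * (4 / n + 2 / Real.sqrt n) := by
  have := h.isProb
  have me := fun i j => meas_entry (n := n) i j
  have me2 : Measurable fun X : Matrix (Fin n) (Fin n) ℝ => (X * X) a a :=
    (me a a).comp meas_mulself
  have hn' : (3 : ℝ) ≤ n := by exact_mod_cast hn
  have hpos : (0 : ℝ) < (n : ℝ) := by linarith
  have rpos : 0 < Real.sqrt n := Real.sqrt_pos.2 hpos
  have hr : (Real.sqrt n : ℝ) * Real.sqrt n = n := Real.mul_self_sqrt (by positivity)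
  have hrC : ((Real.sqrt n : ℝ) : ℂ) * (Real.sqrt n : ℝ) = n := by exact_mod_cast hr
  have hrC0 : ((Real.sqrt n : ℝ) : ℂ) ≠ 0 := Complex.ofReal_ne_zero.2 rpos.ne'
  have htr' : ∀ᵐ X ∂(ν.map (fun X => X * X)), X.trace = 0 := by
    refine (ae_map_iff meas_mulself.aemeasurable ?_).2 htr2
    refine measurableSet_eq_fun ?_ measurable_const
    exact Finset.measurable_sum _ (fun i _ => me i i)
  have sq2 : (n : ℝ) * ∫ X, (X * X) a a ^ 2 ∂ν ≤ 2 := by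
    have k := diag_sq (conjInv_sq h) htr' a
    rwa [integral_map meas_mulself.aemeasurable
      ((me a a).pow_const 2).aestronglyMeasurable] at k
  have sq1 := diag_sq h htr a
  have bd : ∀ᵐ X ∂ν, X a a ^ 2 ≤ 1 ∧ |(X * X) a a| ≤ 1 := by
    filter_upwards [h.orth] with X hX
    exact ⟨sq_le_one_iff_abs_le_one _ |>.2 (entry_le hX a a), entry_le (orth_sq hX) a a⟩
  have isq : Integrable (fun X : Matrix (Fin n) (Fin n) ℝ => X a a ^ 2) ν :=
    int_real h _ ((me a a).pow_const 2) 1 (bd.mono fun X hX => by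
      rw [abs_of_nonneg (sq_nonneg _)]
      exact hX.1)
  have isq2 : Integrable (fun X : Matrix (Fin n) (Fin n) ℝ => (X * X) a a ^ 2) ν :=
    int_real h _ (me2.pow_const 2) 1 (bd.mono fun X hX => by
      rw [abs_of_nonneg (sq_nonneg _)]
      exact sq_le_one_iff_abs_le_one _ |>.2 hX.2)
  have mT : Measurable (fun X : Matrix (Fin n) (Fin n) ℝ => 1 - 2 * X a a ^ 2 + (X * X) a a) :=
    ((measurable_const.sub (((me a a).pow_const 2).const_mul 2)).add me2)
  have bT : ∀ᵐ X ∂ν, |1 - 2 * X a a ^ 2 + (X * X) a a| ≤ 4 := by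
    filter_upwards [bd] with X ⟨h1, h2⟩
    have h3 := abs_le.1 h2
    rw [abs_le]; constructor <;> nlinarith [sq_nonneg (X a a)]
  refine ode h a a (fun X => 1 - 2 * X a a ^ 2 + (X * X) a a) mT 4 bT _ _ ?_ ?_ t
  · have iR : Integrable (fun X : Matrix (Fin n) (Fin n) ℝ => 2 * X a a ^ 2 +
        Real.sqrt n / 2 * (X * X) a a ^ 2) ν := (isq.const_mul 2).add (isq2.const_mul _)
    have e1 : ∫ X, |1 - 2 * X a a ^ 2 + (X * X) a a - 1| ∂ν ≤
        ∫ X, (1 / (2 * Real.sqrt n) + (2 * X a a ^ 2 + Real.sqrt n / 2 * (X * X) a a ^ 2)) ∂ν := by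
      refine integral_mono_ae ?_ ((integrable_const _).add iR) ?_
      · exact ((int_real h _ mT 4 bT).sub (integrable_const _)).abs
      · filter_upwards with X
        show |1 - 2 * X a a ^ 2 + (X * X) a a - 1| ≤
          1 / (2 * Real.sqrt n) + (2 * X a a ^ 2 + Real.sqrt n / 2 * (X * X) a a ^ 2)
        generalize (X * X) a a = Y
        have e0 : 1 / (2 * Real.sqrt n) + Real.sqrt n / 2 * Y ^ 2 - |Y| =
            (Real.sqrt n * |Y| - 1) ^ 2 / (2 * Real.sqrt n) := by
          rw [← sq_abs Y]
          field_simp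
          ring
        have e0' : 0 ≤ (Real.sqrt n * |Y| - 1) ^ 2 / (2 * Real.sqrt n) := by positivity
        have q := sq_nonneg (X a a)
        have y1 := neg_abs_le Y
        have y2 := le_abs_self Y
        rw [abs_le]
        constructor <;> linarith
    refine e1.trans ?_
    rw [integral_add (integrable_const _) iR,
      integral_add (isq.const_mul 2) (isq2.const_mul _), integral_const_mul,
      integral_const_mul, integral_const]
    rw [probReal_univ, one_smul]
    have k1 : ∫ X, X a a ^ 2 ∂ν ≤ 2 / n := by rw [le_div_iff₀ hpos]; linarith
    have k2 : ∫ X, (X * X) a a ^ 2 ∂ν ≤ 2 / n := by rw [le_div_iff₀ hpos]; linarith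
    have k3 : Real.sqrt n / 2 * ∫ X, (X * X) a a ^ 2 ∂ν ≤ Real.sqrt n / 2 * (2 / n) := by gcongr
    have k4 : Real.sqrt n / 2 * (2 / n) = 1 / Real.sqrt n := by
      rw [div_mul_div_comm, div_eq_div_iff (by positivity) rpos.ne']
      linear_combination 2 * hr
    have k5 : 1 / (2 * Real.sqrt n) + 1 / Real.sqrt n ≤ 2 / Real.sqrt n := by
      rw [← sub_nonneg]
      have : 2 / Real.sqrt n - (1 / (2 * Real.sqrt n) + 1 / Real.sqrt n) = 1 / (2 * Real.sqrt n) := by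
        field_simp; norm_num
      rw [this]; positivity
    have k6 : (4 : ℝ) / n = 2 * (2 / n) := by ring
    linarith
  · intro t
    have key := diag2 h htr a _ _ (dexp t (Real.sqrt n)) (by fun_prop)
    have e2 : ∫ X, ((1 - 2 * X a a ^ 2 + (X * X) a a : ℝ) : ℂ) *
        (Complex.exp (t * ((Real.sqrt n : ℝ) * X a a) * Complex.I) *
          (t * (Real.sqrt n : ℝ) * Complex.I)) ∂ν = (t * (Real.sqrt n : ℝ) * Complex.I) *
        ∫ X, ((1 - 2 * X a a ^ 2 + (X * X) a a : ℝ) : ℂ) *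
        Complex.exp (t * ((Real.sqrt n : ℝ) * X a a) * Complex.I) ∂ν := by
      rw [← integral_const_mul]
      congr 1
      ext X
      ring
    rw [e2] at key
    generalize ∫ X, ((1 - 2 * X a a ^ 2 + (X * X) a a : ℝ) : ℂ) *
        Complex.exp (t * ((Real.sqrt n : ℝ) * X a a) * Complex.I) ∂ν = J at key ⊢
    generalize ∫ X, (X a a : ℂ) *
        Complex.exp (t * ((Real.sqrt n : ℝ) * X a a) * Complex.I) ∂ν = K at key ⊢
    apply mul_left_cancel₀ hrC0
    linear_combination key + K * hrC

/-- the cyclic permutation matrix -/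
def cyc (n : ℕ) : Matrix (Fin (n + 1)) (Fin (n + 1)) ℝ := fun i j => if j = i + 1 then 1 else 0

lemma cyc_mul {n : ℕ} (Y : Matrix (Fin (n + 1)) (Fin (n + 1)) ℝ) (i j : Fin (n + 1)) :
    (cyc n * Y) i j = Y (i + 1) j := by
  simp [Matrix.mul_apply, cyc]

lemma cyc_orth (n : ℕ) : cyc n * (cyc n)ᵀ = 1 := by
  ext i j
  rw [cyc_mul, Matrix.transpose_apply, Matrix.one_apply]
  simp [cyc]

lemma cyc_trace {n : ℕ} (hn : 2 ≤ n) : (cyc n).trace = 0 := by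
  refine Finset.sum_eq_zero fun i _ => ?_
  rw [Matrix.diag_apply, cyc, if_neg]
  intro h
  have h1 : (1 : Fin (n + 1)) = 0 := by simpa using h
  have := congrArg Fin.val h1
  rw [Fin.val_one', Nat.mod_eq_of_lt (by omega)] at this
  simp at this

lemma cyc_trace2 {n : ℕ} (hn : 2 ≤ n) : (cyc n * cyc n).trace = 0 := by
  refine Finset.sum_eq_zero fun i _ => ?_
  rw [Matrix.diag_apply, cyc_mul, cyc, if_neg]
  intro h
  have h1 : (1 : Fin (n + 1)) + 1 = 0 := by rw [add_assoc] at h; simpa using h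
  have := congrArg Fin.val h1
  rw [Fin.val_add, Fin.val_one', Nat.mod_eq_of_lt (a := 1) (by omega),
    Nat.mod_eq_of_lt (by omega)] at this
  simp at this

lemma cyc_entry {n : ℕ} (M : Matrix (Fin (n + 1)) (Fin (n + 1)) ℝ) (a b : Fin (n + 1)) :
    (M * cyc n * Mᵀ) a b = ∑ i, M a i * M b (i + 1) := by
  rw [Matrix.mul_assoc, Matrix.mul_apply]
  simp only [cyc_mul, Matrix.transpose_apply]

lemma meas_X (n : ℕ) : Measurable (fun M => M * cyc n * Mᵀ) := by
  apply meas_of_entry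
  intro i j
  simp only [cyc_entry]
  have := fun i j => meas_entry (n := n + 1) i j
  fun_prop

lemma measSet_orth : MeasurableSet {X : Matrix (Fin n) (Fin n) ℝ | X * Xᵀ = 1} := by
  have : {X : Matrix (Fin n) (Fin n) ℝ | X * Xᵀ = 1} =
      ⋂ i, ⋂ j, {X : Matrix (Fin n) (Fin n) ℝ | (X * Xᵀ) i j = (1 : Matrix _ _ ℝ) i j} := by
    ext X; simp [← Matrix.ext_iff]
  rw [this]
  refine MeasurableSet.iInter fun i => MeasurableSet.iInter fun j => ?_
  refine measurableSet_eq_fun ?_ measurable_const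
  simp only [Matrix.mul_apply, Matrix.transpose_apply]
  have := fun i j => meas_entry (n := n) i j
  fun_prop

lemma haar_conj {n : ℕ} {μ : Measure (Matrix (Fin (n + 1)) (Fin (n + 1)) ℝ)}
    (h : IsHaarOrthogonal (n + 1) μ) :
    ConjInv (n + 1) (μ.map (fun M => M * cyc n * Mᵀ)) := by
  have := h.isProb
  refine ⟨Measure.isProbabilityMeasure_map (meas_X n).aemeasurable, ?_, ?_⟩
  · refine (ae_map_iff (meas_X n).aemeasurable measSet_orth).2 ?_
    filter_upwards [h.ae_orth] with M hM
    have hM' : Mᵀ * M = 1 := mul_eq_one_comm.1 hM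
    calc M * cyc n * Mᵀ * (M * cyc n * Mᵀ)ᵀ = M * cyc n * (Mᵀ * M) * ((cyc n)ᵀ * Mᵀ) := by
          simp only [Matrix.transpose_mul, Matrix.transpose_transpose, Matrix.mul_assoc]
      _ = M * (cyc n * (cyc n)ᵀ) * Mᵀ := by rw [hM', Matrix.mul_one]; simp only [Matrix.mul_assoc]
      _ = 1 := by rw [cyc_orth, Matrix.mul_one, hM]
  · intro V hV
    have mV : Measurable (fun M : Matrix (Fin (n + 1)) (Fin (n + 1)) ℝ => V * M) := by
      apply meas_of_entry
      intro i j
      simp only [Matrix.mul_apply]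
      have := fun i j => meas_entry (n := n + 1) i j
      fun_prop
    conv_rhs => rw [← h.left_inv V hV]
    rw [Measure.map_map (meas_conj V) (meas_X n), Measure.map_map (meas_X n) mV]
    congr 1
    ext1 M
    simp only [Function.comp, Matrix.transpose_mul, Matrix.mul_assoc]

lemma haar_trace {n : ℕ} {μ : Measure (Matrix (Fin (n + 1)) (Fin (n + 1)) ℝ)}
    (h : IsHaarOrthogonal (n + 1) μ) (hn : 2 ≤ n) :
    (∀ᵐ X ∂(μ.map (fun M => M * cyc n * Mᵀ)), X.trace = 0) ∧
    (∀ᵐ X ∂(μ.map (fun M => M * cyc n * Mᵀ)), (X * X).trace = 0) := by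
  have me := fun i j => meas_entry (n := n + 1) i j
  have mt : Measurable (fun X : Matrix (Fin (n + 1)) (Fin (n + 1)) ℝ => X.trace) :=
    Finset.measurable_sum _ (fun i _ => me i i)
  constructor
  · refine (ae_map_iff (meas_X n).aemeasurable (measurableSet_eq_fun mt measurable_const)).2 ?_
    filter_upwards [h.ae_orth] with M hM
    have hM' : Mᵀ * M = 1 := mul_eq_one_comm.1 hM
    rw [Matrix.trace_mul_comm, ← Matrix.mul_assoc, hM', Matrix.one_mul, cyc_trace hn]
  · refine (ae_map_iff (meas_X n).aemeasurable
      (measurableSet_eq_fun (mt.comp meas_mulself) measurable_const)).2 ?_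
    filter_upwards [h.ae_orth] with M hM
    have hM' : Mᵀ * M = 1 := mul_eq_one_comm.1 hM
    have : M * cyc n * Mᵀ * (M * cyc n * Mᵀ) = M * (cyc n * cyc n) * Mᵀ := by
      calc _ = M * cyc n * (Mᵀ * M) * (cyc n * Mᵀ) := by simp only [Matrix.mul_assoc]
        _ = _ := by rw [hM', Matrix.mul_one]; simp only [Matrix.mul_assoc]
    show (M * cyc n * Mᵀ * (M * cyc n * Mᵀ)).trace = 0
    rw [this, Matrix.trace_mul_comm, ← Matrix.mul_assoc, hM', Matrix.one_mul, cyc_trace2 hn]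

lemma meas_W {n : ℕ} (a b : Fin (n + 1)) :
    Measurable (fun M : Matrix (Fin (n + 1)) (Fin (n + 1)) ℝ =>
      Real.sqrt (n + 1) * ∑ i : Fin (n + 1), M a i * M b (i + 1)) := by
  have := fun i j => meas_entry (n := n + 1) i j
  fun_prop

lemma charFun_W {n : ℕ} {μ : Measure (Matrix (Fin (n + 1)) (Fin (n + 1)) ℝ)}
    (a b : Fin (n + 1)) (t : ℝ) :
    charFun (μ.map (fun M => Real.sqrt (n + 1) * ∑ i : Fin (n + 1), M a i * M b (i + 1))) t =
      ∫ X, Complex.exp (t * ((Real.sqrt ((n + 1 : ℕ) : ℝ) : ℝ) * X a b) * Complex.I)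
        ∂(μ.map (fun M => M * cyc n * Mᵀ)) := by
  have me := meas_entry (n := n + 1) a b
  have m1 : Measurable (fun x : ℝ => Complex.exp (t * x * Complex.I)) := by fun_prop
  have m2 : Measurable (fun X : Matrix (Fin (n + 1)) (Fin (n + 1)) ℝ =>
      Complex.exp (t * ((Real.sqrt ((n + 1 : ℕ) : ℝ) : ℝ) * X a b) * Complex.I)) := by fun_prop
  rw [charFun_apply_real, integral_map (meas_W a b).aemeasurable m1.aestronglyMeasurable,
    integral_map (meas_X n).aemeasurable m2.aestronglyMeasurable]
  congr 1
  ext M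
  rw [cyc_entry, Complex.ofReal_mul, Nat.cast_succ]

lemma tendsto_char (μ : ∀ n : ℕ, Measure (Matrix (Fin (n + 1)) (Fin (n + 1)) ℝ))
    (hμ : ∀ n, IsHaarOrthogonal (n + 1) (μ n)) (a b : ∀ n : ℕ, Fin (n + 1)) (t : ℝ) :
    Filter.Tendsto (fun n => charFun ((μ n).map (fun M =>
      Real.sqrt (n + 1) * ∑ i : Fin (n + 1), M (a n) i * M (b n) (i + 1))) t) Filter.atTop
      (nhds (Complex.exp (-(t ^ 2 / 2 : ℝ)))) := by
  rw [tendsto_iff_norm_sub_tendsto_zero]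
  have hlim : Filter.Tendsto (fun n : ℕ => t ^ 2 * (11 / (((n + 1 : ℕ) : ℝ) - 2)) +
      t ^ 2 * (4 / ((n + 1 : ℕ) : ℝ) + 2 / Real.sqrt ((n + 1 : ℕ) : ℝ))) Filter.atTop
      (nhds 0) := by
    have c : Filter.Tendsto (fun n : ℕ => ((n + 1 : ℕ) : ℝ)) Filter.atTop Filter.atTop :=
      tendsto_natCast_atTop_atTop.comp (Filter.tendsto_add_atTop_nat 1)
    have c1 : Filter.Tendsto (fun n : ℕ => 11 / (((n + 1 : ℕ) : ℝ) - 2)) Filter.atTop (nhds 0) :=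
      Filter.Tendsto.const_div_atTop (Filter.tendsto_atTop_add_const_right _ _ c) _
    have c2 : Filter.Tendsto (fun n : ℕ => 4 / ((n + 1 : ℕ) : ℝ)) Filter.atTop (nhds 0) :=
      c.const_div_atTop _
    have c3 : Filter.Tendsto (fun n : ℕ => 2 / Real.sqrt ((n + 1 : ℕ) : ℝ)) Filter.atTop
        (nhds 0) := (Real.tendsto_sqrt_atTop.comp c).const_div_atTop _
    simpa using (c1.const_mul (t ^ 2)).add ((c2.add c3).const_mul (t ^ 2))
  refine squeeze_zero' (Filter.Eventually.of_forall fun n => norm_nonneg _) ?_ hlim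
  filter_upwards [Filter.eventually_ge_atTop 2] with n hn
  have h1 := haar_conj (hμ n)
  obtain ⟨h2, h3⟩ := haar_trace (hμ n) hn
  have hN : (2 : ℝ) ≤ n := by exact_mod_cast hn
  have p1 : 0 ≤ t ^ 2 * (11 / (((n + 1 : ℕ) : ℝ) - 2)) := by
    have : 0 ≤ (((n + 1 : ℕ) : ℝ) - 2) := by push_cast; linarith
    positivity
  have p2 : 0 ≤ t ^ 2 * (4 / ((n + 1 : ℕ) : ℝ) + 2 / Real.sqrt ((n + 1 : ℕ) : ℝ)) := by
    positivity
  rw [charFun_W (a n) (b n) t]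
  by_cases hab : a n = b n
  · rw [← hab]
    have := bound_diag h1 h2 h3 (by omega) (a n) t
    linarith
  · have := bound_off h1 h2 (by omega) (a n) (b n) hab t
    linarith

lemma levy {Ω : ℕ → Type} [∀ n, MeasurableSpace (Ω n)] (μ : ∀ n, Measure (Ω n))
    (hp : ∀ n, IsProbabilityMeasure (μ n)) (W : ∀ n, Ω n → ℝ) (mW : ∀ n, Measurable (W n))
    (h : ∀ t : ℝ, Filter.Tendsto (fun n => charFun ((μ n).map (W n)) t) Filter.atTop
      (nhds (Complex.exp (-(t ^ 2 / 2 : ℝ))))) (g : ℝ →ᵇ ℝ) :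
    Filter.Tendsto (fun n => ∫ M, g (W n M) ∂(μ n)) Filter.atTop
      (nhds (∫ x, g x ∂gaussianReal 0 1)) := by
  let ρ : ℕ → ProbabilityMeasure ℝ := fun n => ⟨(μ n).map (W n),
    Measure.isProbabilityMeasure_map (mW n).aemeasurable⟩
  let γ : ProbabilityMeasure ℝ := ⟨gaussianReal 0 1, inferInstance⟩
  have hconv : Filter.Tendsto ρ Filter.atTop (nhds γ) := by
    apply ProbabilityMeasure.tendsto_of_tendsto_charFun
    intro t
    have hγ : charFun (γ : Measure ℝ) t = Complex.exp (-(t ^ 2 / 2 : ℝ)) := by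
      show charFun (gaussianReal 0 1) t = _
      rw [charFun_gaussianReal]
      congr 1
      push_cast
      simp
    rw [hγ]
    exact h t
  have := ProbabilityMeasure.tendsto_iff_forall_integral_tendsto.1 hconv g
  refine Filter.Tendsto.congr (fun n => ?_) this
  exact integral_map (mW n).aemeasurable g.continuous.measurable.aestronglyMeasurable

end aux

/-- `√n (M C_n Mᵀ)_{ab} = √n ∑_i M_{a,i} M_{b,i+1}` (columns mod `n`,
`C_n` the `n`-cycle) converges in distribution to a standard normal. -/
theorem stmt7 (μ : ∀ n : ℕ, Measure (Matrix (Fin (n + 1)) (Fin (n + 1)) ℝ))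
    (hμ : ∀ n, IsHaarOrthogonal (n + 1) (μ n)) (a b : ∀ n : ℕ, Fin (n + 1)) :
    ∀ g : ℝ →ᵇ ℝ,
      Filter.Tendsto
        (fun n => ∫ M,
          g (Real.sqrt (n + 1) * ∑ i : Fin (n + 1), M (a n) i * M (b n) (i + 1)) ∂(μ n))
        Filter.atTop (nhds (∫ x, g x ∂gaussianReal 0 1)) := by
  exact levy μ (fun n => (hμ n).isProb) _ (fun n => meas_W (a n) (b n)) (tendsto_char μ hμ a b)
end

section
/- Let M be an n×n Haar-distributed random orthogonal matrix, a, b fixed indices, and Z a standard normal random variable. For each n, let Q_n range over permutation matrices whose corresponding permutation has at most 2·log n cycles. Then for every real x, the maximum over such Q_n of |P(√n (M Q_n Mᵀ)_{ab} ≤ x) − P(Z ≤ x)| tends to 0 as n → ∞. -/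
open MeasureTheory Matrix

/-- The number of cycles of a permutation, counting fixed points as cycles. -/
def cycleCount {n : ℕ} (σ : Equiv.Perm (Fin n)) : ℕ :=
  σ.cycleType.card + (Finset.univ.filter fun x => σ x = x).card

open ProbabilityTheory


section helpers

open Filter Topology

lemma gauss_int_pow (k : ℕ) : Integrable (fun g : ℝ => g ^ k) (gaussianReal 0 1) := by
  have h := (memLp_id_gaussianReal' (μ := 0) (v := 1) (k : ENNReal) (by simp)).integrable_norm_pow' 
  refine (integrable_norm_iff (by fun_prop)).1 ?_
  simpa using h

lemma gauss_sq : ∫ g, g ^ 2 ∂(gaussianReal 0 1) = 1 := by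
  have h := variance_fun_id_gaussianReal (μ := 0) (v := 1)
  rw [variance_eq_integral measurable_id'.aemeasurable] at h
  simpa using h

lemma gauss_four : ∫ g, g ^ 4 ∂(gaussianReal 0 1) = 3 := by
  have h1 : ∫ g, g ^ 4 ∂(gaussianReal 0 1) =
      iteratedDeriv 4 (mgf (fun x ↦ x) (gaussianReal 0 1)) 0 := by
    rw [iteratedDeriv_mgf_zero] <;> simp
  have key : ∀ (p q : ℝ → ℝ), (∀ t, HasDerivAt p (q t) t) →
      deriv (fun t => p t * Real.exp (t ^ 2 / 2)) =
        fun t => (q t + t * p t) * Real.exp (t ^ 2 / 2) := by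
    intro p q hp
    ext t
    have he : HasDerivAt (fun t : ℝ => Real.exp (t ^ 2 / 2)) (Real.exp (t ^ 2 / 2) * t) t := by
      have := ((hasDerivAt_pow 2 t).div_const 2).exp
      convert! this using 1
      simp
    rw [((hp t).fun_mul he).deriv]
    ring
  rw [h1, mgf_fun_id_gaussianReal]
  have h0 : (fun t : ℝ => Real.exp (0 * t + ((1 : NNReal) : ℝ) * t ^ 2 / 2)) =
      fun t => (fun _ => (1 : ℝ)) t * Real.exp (t ^ 2 / 2) := by
    ext t; simp
  rw [h0]
  simp only [iteratedDeriv_succ, iteratedDeriv_zero]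
  rw [key (fun _ => 1) (fun _ => 0) (fun t => hasDerivAt_const t 1)]
  have e1 : (fun t : ℝ => (0 + t * 1) * Real.exp (t ^ 2 / 2)) =
      fun t => (fun t => t) t * Real.exp (t ^ 2 / 2) := by ext t; simp
  rw [e1, key (fun t => t) (fun _ => 1) (fun t => hasDerivAt_id t)]
  rw [key (fun t => 1 + t * t) (fun t => 2 * t) (fun t => by
    have := ((hasDerivAt_id t).mul (hasDerivAt_id t)).const_add 1
    convert! this using 1
    simp; ring)]
  rw [key (fun t => 2 * t + t * (1 + t * t)) (fun t => 3 + 3 * t ^ 2) (fun t => by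
    have := ((hasDerivAt_id t).const_mul 3).add (hasDerivAt_pow 3 t)
    convert! this using 1
    · ext s; simp; ring
    · simp)]
  simp

/-- normalized centered square -/
noncomputable def ysq (g : ℝ) : ℝ := (g ^ 2 - 1) / Real.sqrt 2

lemma ysq_meas : Measurable ysq := by unfold ysq; fun_prop

lemma ysq_mean : ∫ g, ysq g ∂(gaussianReal 0 1) = 0 := by
  unfold ysq
  rw [integral_div, integral_sub (gauss_int_pow 2) (integrable_const _), gauss_sq]
  simp

lemma ysq_sq_eq : (fun g => ysq g ^ 2) = fun g => (g ^ 4 - 2 * g ^ 2 + 1) / 2 := by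
  ext g
  unfold ysq
  rw [div_pow, Real.sq_sqrt (by norm_num)]
  ring

lemma ysq_sq : ∫ g, ysq g ^ 2 ∂(gaussianReal 0 1) = 1 := by
  rw [ysq_sq_eq, integral_div, integral_add (f := fun g => g ^ 4 - 2 * g ^ 2)
    ((gauss_int_pow 4).sub ((gauss_int_pow 2).const_mul 2))
    (integrable_const _), integral_sub (gauss_int_pow 4) ((gauss_int_pow 2).const_mul 2),
    integral_const_mul, gauss_sq, gauss_four]
  simp; norm_num

lemma ysq_memLp : MemLp ysq 2 (gaussianReal 0 1) := by
  refine (memLp_two_iff_integrable_sq ysq_meas.aestronglyMeasurable).2 (.of_integral_ne_zero ?_)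
  rw [ysq_sq]; simp

noncomputable def phi (t : ℝ) : ℂ := charFun ((gaussianReal 0 1).map ysq) t

lemma phi_taylor : (fun t : ℝ ↦ phi t - Complex.exp (-((t : ℂ) ^ 2 / 2))) =o[𝓝 0] fun t ↦ t ^ 2 := by
  have h := taylor_charFun_two (P := gaussianReal 0 1) ysq_meas.aemeasurable ysq_mean
    (by simpa using ysq_sq)
  have hu : Tendsto (fun t : ℝ => -((t : ℂ) ^ 2 / 2)) (𝓝 0) (𝓝 0) := by
    have : Continuous (fun t : ℝ => -((t : ℂ) ^ 2 / 2)) := by fun_prop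
    simpa using this.tendsto 0
  have hd : HasDerivAt Complex.exp 1 0 := by simpa using Complex.hasDerivAt_exp 0
  have h2 := (hasDerivAt_iff_isLittleO.1 hd).comp_tendsto hu
  have h3 : (fun t : ℝ => Complex.exp (-((t : ℂ) ^ 2 / 2)) - (1 - (t : ℂ) ^ 2 / 2)) =o[𝓝 0]
      fun t ↦ t ^ 2 := by
    refine (h2.congr_left (fun t => ?_)).trans_isBigO ?_
    · simp; ring
    · refine Asymptotics.IsBigO.of_bound 1 (Eventually.of_forall fun t => ?_)
      simp
      nlinarith [sq_nonneg t]
  exact (h.sub h3).congr_left fun t => by simp [phi]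

lemma norm_prod_sub_prod_le' {ι : Type*} (s : Finset ι) (a b : ι → ℂ) (ha : ∀ i, ‖a i‖ ≤ 1)
    (hb : ∀ i, ‖b i‖ ≤ 1) : ‖∏ i ∈ s, a i - ∏ i ∈ s, b i‖ ≤ ∑ i ∈ s, ‖a i - b i‖ := by
  classical
  induction s using Finset.induction_on with
  | empty => simp
  | insert i s hi ih =>
    rw [Finset.prod_insert hi, Finset.prod_insert hi, Finset.sum_insert hi]
    have e : a i * ∏ j ∈ s, a j - b i * ∏ j ∈ s, b j =
        (a i - b i) * ∏ j ∈ s, a j + b i * (∏ j ∈ s, a j - ∏ j ∈ s, b j) := by ring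
    rw [e]
    refine (norm_add_le _ _).trans (add_le_add ?_ ?_)
    · rw [norm_mul, norm_prod]
      exact mul_le_of_le_one_right (norm_nonneg _)
        (Finset.prod_le_one (fun _ _ => norm_nonneg _) (fun j _ => ha j))
    · rw [norm_mul]
      exact (mul_le_of_le_one_left (norm_nonneg _) (hb i)).trans ih

lemma charFun_lin {N : ℕ} (c : Fin N → ℝ) (d t : ℝ) :
    charFun ((Measure.pi fun _ : Fin N => gaussianReal 0 1).map
      (fun g => ∑ i, c i * ysq (g i) + d)) t =
      (∏ i, phi (t * c i)) * Complex.exp (t * d * Complex.I) := by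
  have hm : Measurable (fun g : Fin N → ℝ => ∑ i, c i * ysq (g i) + d) := by
    unfold ysq; fun_prop
  have hp : ∀ s, phi s = ∫ g, Complex.exp (s * ysq g * Complex.I) ∂(gaussianReal 0 1) := by
    intro s
    rw [phi, charFun_apply_real, integral_map ysq_meas.aemeasurable (by fun_prop)]
  rw [charFun_apply_real, integral_map hm.aemeasurable (by fun_prop)]
  simp_rw [hp]
  rw [← integral_fintype_prod_eq_prod (𝕜 := ℂ)
    (f := fun i g => Complex.exp (((t * c i : ℝ) : ℂ) * ysq g * Complex.I)), ← integral_mul_const]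
  congr 1
  ext g
  rw [← Complex.exp_sum, ← Complex.exp_add]
  congr 1
  push_cast
  rw [mul_add, Finset.mul_sum, add_mul, Finset.sum_mul]
  congr 1
  refine Finset.sum_congr rfl fun i _ => by ring

lemma clt_char (N : ℕ → ℕ) (c : ∀ k, Fin (N k) → ℝ) (d η : ℕ → ℝ)
    (hc : Tendsto (fun k => ∑ i, c k i ^ 2) atTop (𝓝 1)) (hη : Tendsto η atTop (𝓝 0))
    (hcη : ∀ k i, |c k i| ≤ η k) (hd : Tendsto d atTop (𝓝 0)) (t : ℝ) :
    Tendsto (fun k => charFun ((Measure.pi fun _ : Fin (N k) => gaussianReal 0 1).map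
      (fun g => ∑ i, c k i * ysq (g i) + d k)) t) atTop (𝓝 (charFun (gaussianReal 0 1) t)) := by
  simp_rw [charFun_lin]
  have hE : Tendsto (fun k => Complex.exp (t * d k * Complex.I)) atTop (𝓝 1) := by
    have : Continuous (fun s : ℝ => Complex.exp (t * s * Complex.I)) := by fun_prop
    simpa [Function.comp_def] using (this.tendsto 0).comp hd
  have hB : Tendsto (fun k => ∏ i, Complex.exp (-(((t * c k i : ℝ) : ℂ) ^ 2 / 2))) atTop
      (𝓝 (charFun (gaussianReal 0 1) t)) := by
    have : Continuous (fun s : ℝ => Complex.exp (-(t ^ 2 * s / 2))) := by fun_prop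
    have h := (this.tendsto 1).comp hc
    rw [charFun_gaussianReal]
    convert! h using 2
    · rename_i k
      rw [← Complex.exp_sum]
      simp only [Function.comp]
      congr 1
      push_cast
      rw [Finset.sum_neg_distrib, Finset.mul_sum, Finset.sum_div]
      congr 1
      refine Finset.sum_congr rfl fun i _ => by ring
    · simp
  have hA : Tendsto (fun k => ∏ i, phi (t * c k i) -
      ∏ i, Complex.exp (-(((t * c k i : ℝ) : ℂ) ^ 2 / 2))) atTop (𝓝 0) := by
    rw [tendsto_zero_iff_norm_tendsto_zero]
    rw [Metric.tendsto_nhds]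
    intro ε hε
    have hδ : 0 < ε / (2 * (t ^ 2 + 1)) := by positivity
    have h1 := phi_taylor.def hδ
    have htη : Tendsto (fun k => |t| * η k) atTop (𝓝 0) := by
      simpa using hη.const_mul |t|
    obtain ⟨r, hr, hball⟩ := Metric.eventually_nhds_iff.1 h1
    have h2 : ∀ᶠ k in atTop, |t| * η k < r := htη.eventually (gt_mem_nhds hr)
    have h3 : ∀ᶠ k in atTop, ∑ i, c k i ^ 2 < 2 := hc.eventually (gt_mem_nhds (by norm_num))
    filter_upwards [h2, h3] with k hk2 hk3
    simp only [dist_zero_right, norm_norm]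
    refine (norm_prod_sub_prod_le' _ _ _ (fun i => ?_) (fun i => ?_)).trans_lt ?_
    · have : IsProbabilityMeasure ((gaussianReal 0 1).map ysq) :=
        Measure.isProbabilityMeasure_map ysq_meas.aemeasurable
      exact norm_charFun_le_one _
    · rw [Complex.norm_exp]
      have : (-(((t * c k i : ℝ) : ℂ) ^ 2 / 2)).re = - ((t * c k i) ^ 2 / 2) := by
        norm_cast
      rw [this]
      exact Real.exp_le_one_iff.2 (by have := sq_nonneg (t * c k i); linarith)
    · have hs : ∀ i, ‖phi (t * c k i) - Complex.exp (-(((t * c k i : ℝ) : ℂ) ^ 2 / 2))‖ ≤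
          ε / (2 * (t ^ 2 + 1)) * (t ^ 2 * c k i ^ 2) := by
        intro i
        have hd : dist (t * c k i) 0 < r := by
          rw [dist_zero_right, Real.norm_eq_abs, abs_mul]
          exact (mul_le_mul_of_nonneg_left (hcη k i) (abs_nonneg t)).trans_lt hk2
        have := hball hd
        rwa [Real.norm_eq_abs, abs_of_nonneg (sq_nonneg _), mul_pow] at this
      refine (Finset.sum_le_sum fun i _ => hs i).trans_lt ?_
      rw [← Finset.mul_sum, ← Finset.mul_sum, div_mul_eq_mul_div, div_lt_iff₀ (by positivity)]
      have : t ^ 2 * ∑ i, c k i ^ 2 ≤ t ^ 2 * 2 :=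
        mul_le_mul_of_nonneg_left hk3.le (sq_nonneg t)
      nlinarith
  have := ((hA.add hB).mul hE)
  simpa using this

lemma levy_cdf (ν : ℕ → Measure ℝ) (hν : ∀ k, IsProbabilityMeasure (ν k))
    (h : ∀ t, Tendsto (fun k => charFun (ν k) t) atTop (𝓝 (charFun (gaussianReal 0 1) t)))
    (x : ℝ) : Tendsto (fun k => (ν k (Set.Iic x)).toReal) atTop
      (𝓝 ((gaussianReal 0 1) (Set.Iic x)).toReal) := by
  let ν' : ℕ → ProbabilityMeasure ℝ := fun k => ⟨ν k, hν k⟩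
  let ν₀ : ProbabilityMeasure ℝ := ⟨gaussianReal 0 1, inferInstance⟩
  have hlim : Tendsto ν' atTop (𝓝 ν₀) :=
    ProbabilityMeasure.tendsto_of_tendsto_charFun h
  have hfr : (ν₀ : Measure ℝ) (frontier (Set.Iic x)) = 0 := by
    rw [frontier_Iic]
    change gaussianReal 0 1 {x} = 0
    have := nullSingletonClass_gaussianReal (μ := 0) (v := 1) (by simp)
    simp
  have h := ProbabilityMeasure.tendsto_measure_of_null_frontier_of_tendsto' hlim hfr
  exact (ENNReal.tendsto_toReal (measure_ne_top _ _)).comp h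

lemma clt_seq (N : ℕ → ℕ) (c : ∀ k, Fin (N k) → ℝ) (d η : ℕ → ℝ)
    (hc : Tendsto (fun k => ∑ i, c k i ^ 2) atTop (𝓝 1)) (hη : Tendsto η atTop (𝓝 0))
    (hcη : ∀ k i, |c k i| ≤ η k) (hd : Tendsto d atTop (𝓝 0)) (x : ℝ) :
    Tendsto (fun k => ((Measure.pi fun _ : Fin (N k) => gaussianReal 0 1)
      {g | ∑ i, c k i * ysq (g i) + d k ≤ x}).toReal) atTop
      (𝓝 ((gaussianReal 0 1) (Set.Iic x)).toReal) := by
  have hm : ∀ k, Measurable (fun g : Fin (N k) → ℝ => ∑ i, c k i * ysq (g i) + d k) := by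
    intro k; unfold ysq; fun_prop
  have hset : ∀ k, ((Measure.pi fun _ : Fin (N k) => gaussianReal 0 1)
      {g | ∑ i, c k i * ysq (g i) + d k ≤ x}) =
      ((Measure.pi fun _ : Fin (N k) => gaussianReal 0 1).map
      (fun g => ∑ i, c k i * ysq (g i) + d k)) (Set.Iic x) := by
    intro k
    rw [Measure.map_apply (hm k) measurableSet_Iic, Set.preimage]
    simp only [Set.mem_Iic]
  simp_rw [hset]
  refine levy_cdf _ ?_ ?_ x
  · intro k
    exact Measure.isProbabilityMeasure_map (hm k).aemeasurable
  · intro t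
    exact clt_char N c d η hc hη hcη hd t

lemma permMatrix_conj {n : ℕ} (σ : Equiv.Perm (Fin n)) (M : Matrix (Fin n) (Fin n) ℝ)
    (a b : Fin n) : (M * σ.permMatrix ℝ * Mᵀ) a b = ∑ i, M a i * M b (σ i) := by
  rw [Matrix.mul_assoc, Matrix.mul_apply]
  refine Finset.sum_congr rfl fun i _ => ?_
  congr 1
  rw [Matrix.mul_apply]
  simp [Equiv.Perm.permMatrix, PEquiv.toMatrix_apply]

lemma trace_permMatrix' {n : ℕ} (σ : Equiv.Perm (Fin n)) :
    (σ.permMatrix ℝ).trace = ((Finset.univ.filter fun x => σ x = x).card : ℝ) := by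
  rw [Matrix.trace, Finset.card_filter]
  push_cast
  refine Finset.sum_congr rfl fun i _ => ?_
  simp [Equiv.Perm.permMatrix, PEquiv.toMatrix_apply]

lemma fix_sq_card {n : ℕ} (σ : Equiv.Perm (Fin n)) :
    (Finset.univ.filter fun x => (σ * σ) x = x).card ≤ 2 * cycleCount σ := by
  classical
  unfold cycleCount
  have h1 : (Finset.univ.filter fun x => (σ * σ) x = x) ⊆
      (Finset.univ.filter fun x => σ x = x) ∪
      (Finset.univ.filter fun x => (σ * σ) x = x ∧ σ x ≠ x) := by
    intro x hx
    simp only [Finset.mem_union, Finset.mem_filter, Finset.mem_univ, true_and] at hx ⊢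
    tauto
  have h2 : (Finset.univ.filter fun x => (σ * σ) x = x ∧ σ x ≠ x).card ≤
      2 * σ.cycleFactorsFinset.card := by
    refine Finset.card_le_mul_card_image_of_maps_to (f := σ.cycleOf) ?_ 2 ?_
    · intro x hx
      simp only [Finset.mem_filter, Finset.mem_univ, true_and] at hx
      rw [Equiv.Perm.cycleOf_mem_cycleFactorsFinset_iff, Equiv.Perm.mem_support]
      exact hx.2
    · intro c _
      rcases Finset.eq_empty_or_nonempty (Finset.filter (fun x => σ.cycleOf x = c)
        (Finset.univ.filter fun x => (σ * σ) x = x ∧ σ x ≠ x)) with h | ⟨x, hx⟩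
      · rw [h]; simp
      · refine le_trans (Finset.card_le_card (t := {x, σ x}) ?_) Finset.card_le_two
        intro y hy
        simp only [Finset.mem_filter, Finset.mem_univ, true_and] at hx hy
        have hsame : σ.SameCycle x y := by
          by_contra hns
          have h1 := Equiv.Perm.cycleOf_apply_of_not_sameCycle hns
          rw [hx.2, ← hy.2, Equiv.Perm.cycleOf_apply_self] at h1
          exact hy.1.2 h1
        obtain ⟨i, hi⟩ := hsame
        simp only [Finset.mem_insert, Finset.mem_singleton]
        have hev : ∀ k : ℤ, (σ ^ (k + k)) x = x := by
          intro k
          have : σ ^ (k + k) = (σ * σ) ^ k := by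
            rw [_root_.zpow_add, (Commute.refl σ).mul_zpow]
          rw [this]
          exact Equiv.Perm.zpow_apply_eq_self_of_apply_eq_self hx.1.1 k
        rcases Int.even_or_odd' i with ⟨k, hk | hk⟩
        · left; rw [← hi, hk, two_mul, hev]
        · right
          rw [← hi, hk, add_comm, _root_.zpow_add, two_mul, Equiv.Perm.mul_apply, hev, zpow_one]
  have h3 : σ.cycleType.card = σ.cycleFactorsFinset.card := by
    simp [Equiv.Perm.cycleType]
  have h4 := (Finset.card_le_card h1).trans (Finset.card_union_le _ _)
  omega

lemma spectral_perm {n : ℕ} (σ : Equiv.Perm (Fin n)) :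
    ∃ (V : Matrix (Fin n) (Fin n) ℝ) (l : Fin n → ℝ), V * Vᵀ = 1 ∧
      (∀ (M : Matrix (Fin n) (Fin n) ℝ) a,
        (M * σ.permMatrix ℝ * Mᵀ) a a = ∑ i, l i * ((M * V) a i) ^ 2) ∧
      (∀ i, |l i| ≤ 1) ∧
      ∑ i, l i = ((Finset.univ.filter fun x => σ x = x).card : ℝ) ∧
      ∑ i, l i ^ 2 = ((n : ℝ) + ((Finset.univ.filter fun x => (σ * σ) x = x).card : ℝ)) / 2 := by
  classical
  set Q := σ.permMatrix ℝ with hQ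
  set S : Matrix (Fin n) (Fin n) ℝ := (1 / 2 : ℝ) • (Q + Qᵀ) with hS
  have hherm : S.IsHermitian := by
    rw [Matrix.IsHermitian, Matrix.conjTranspose_eq_transpose_of_trivial, hS]
    simp [add_comm]
  have hsp := hherm.spectral_theorem
  rw [Unitary.conjStarAlgAut_apply] at hsp
  set V : Matrix (Fin n) (Fin n) ℝ := (hherm.eigenvectorUnitary).1 with hV
  set l := hherm.eigenvalues with hl
  have hstar : star V = Vᵀ := by
    rw [Matrix.star_eq_conjTranspose, Matrix.conjTranspose_eq_transpose_of_trivial]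
  have hVV : V * Vᵀ = 1 := by
    rw [← hstar]; exact Unitary.coe_mul_star_self _
  have hVV' : Vᵀ * V = 1 := by
    rw [← hstar]; exact Unitary.coe_star_mul_self _
  have hS2 : S = V * Matrix.diagonal l * Vᵀ := by
    rw [← hstar]
    exact hsp
  have hmain : ∀ (M : Matrix (Fin n) (Fin n) ℝ) a,
        (M * Q * Mᵀ) a a = ∑ i, l i * ((M * V) a i) ^ 2 := by
    intro M a
    have e1 : (M * S * Mᵀ) a a = (M * Q * Mᵀ) a a := by
      have : (M * Qᵀ * Mᵀ) a a = (M * Q * Mᵀ) a a := by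
        have : (M * Qᵀ * Mᵀ) = (M * Q * Mᵀ)ᵀ := by
          simp [Matrix.transpose_mul, Matrix.mul_assoc]
        rw [this]; rfl
      rw [hS]
      simp only [Matrix.mul_smul, Matrix.smul_mul, Matrix.mul_add, Matrix.add_mul,
        Matrix.smul_apply, Matrix.add_apply, this, smul_eq_mul]
      ring
    rw [← e1, hS2]
    have e2 : M * (V * Matrix.diagonal l * Vᵀ) * Mᵀ =
        (M * V) * Matrix.diagonal l * (M * V)ᵀ := by
      simp [Matrix.transpose_mul, Matrix.mul_assoc]
    rw [e2, Matrix.mul_apply]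
    refine Finset.sum_congr rfl fun i _ => ?_
    rw [Matrix.mul_diagonal, Matrix.transpose_apply]
    ring
  have hl1 : ∀ i, (Vᵀ * Q * V) i i = l i := by
    intro i
    have := hmain Vᵀ i
    rw [hVV', Matrix.transpose_transpose] at this
    rw [this]
    simp [Matrix.one_apply]
  refine ⟨V, l, hVV, hmain, ?_, ?_, ?_⟩
  · intro i
    have h := hl1 i
    have h2 := permMatrix_conj σ Vᵀ i i
    rw [Matrix.transpose_transpose, ← hQ, h] at h2
    have h3 : ∑ j, V j i ^ 2 = 1 := by
      have := congrFun (congrFun hVV' i) i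
      rw [Matrix.mul_apply, Matrix.one_apply_eq] at this
      rw [← this]
      refine Finset.sum_congr rfl fun j _ => ?_
      rw [Matrix.transpose_apply]; ring
    have h4 : ∑ j, V (σ j) i ^ 2 = 1 := by
      rw [← h3]; exact Equiv.sum_comp σ (fun j => V j i ^ 2)
    rw [abs_le]
    have h5 : 0 ≤ ∑ j, (V j i + V (σ j) i) ^ 2 := Finset.sum_nonneg fun _ _ => sq_nonneg _
    have h6 : 0 ≤ ∑ j, (V j i - V (σ j) i) ^ 2 := Finset.sum_nonneg fun _ _ => sq_nonneg _
    have h7 : ∑ j, (V j i + V (σ j) i) ^ 2 = 2 + 2 * l i := by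
      simp only [add_sq, Finset.sum_add_distrib, h3, h4, h2, Matrix.transpose_apply, Finset.mul_sum,
        mul_assoc]
      ring
    have h8 : ∑ j, (V j i - V (σ j) i) ^ 2 = 2 - 2 * l i := by
      simp only [sub_sq, Finset.sum_add_distrib, Finset.sum_sub_distrib, h3, h4, h2,
        Matrix.transpose_apply, Finset.mul_sum, mul_assoc]
      ring
    constructor <;> linarith
  · rw [← trace_permMatrix', ← hQ]
    have : (Vᵀ * Q * V).trace = ∑ i, l i := by
      rw [Matrix.trace]; exact Finset.sum_congr rfl fun i _ => hl1 i
    rw [← this, Matrix.trace_mul_comm, ← Matrix.mul_assoc, hVV, Matrix.one_mul]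
  · have e1 : (S * S).trace = ∑ i, l i ^ 2 := by
      have : S * S = V * (Matrix.diagonal l * Matrix.diagonal l) * Vᵀ := by
        rw [hS2]
        calc V * diagonal l * Vᵀ * (V * diagonal l * Vᵀ)
            = V * diagonal l * (Vᵀ * V) * diagonal l * Vᵀ := by simp only [Matrix.mul_assoc]
          _ = _ := by rw [hVV']; simp only [Matrix.mul_assoc, Matrix.one_mul]
      rw [this, Matrix.trace_mul_comm, ← Matrix.mul_assoc, hVV', Matrix.one_mul,
        Matrix.diagonal_mul_diagonal, Matrix.trace_diagonal]
      exact Finset.sum_congr rfl fun i _ => by ring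
    have hQQ : Q * Qᵀ = 1 := by
      rw [hQ, Matrix.transpose_permMatrix, ← Matrix.permMatrix_mul]; simp
    have hQQ' : Qᵀ * Q = 1 := by
      rw [hQ, Matrix.transpose_permMatrix, ← Matrix.permMatrix_mul]; simp
    have hQ2 : (Q * Q).trace = ((Finset.univ.filter fun x => (σ * σ) x = x).card : ℝ) := by
      rw [← trace_permMatrix', Matrix.permMatrix_mul]
    have hQ3 : (Qᵀ * Qᵀ).trace = (Q * Q).trace := by
      rw [← Matrix.transpose_mul, Matrix.trace_transpose]
    rw [← e1, ← hQ2, hS]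
    simp only [Matrix.mul_smul, Matrix.smul_mul, Matrix.mul_add, Matrix.add_mul,
      Matrix.trace_smul, Matrix.trace_add, hQQ, hQQ', hQ3, Matrix.trace_one, smul_eq_mul,
      Fintype.card_fin]
    ring

/-- Householder reflection. -/
lemma householder {n : ℕ} (p q : Fin n → ℝ) (hp : p ⬝ᵥ p = 1) (hq : q ⬝ᵥ q = 1) :
    ∃ V : Matrix (Fin n) (Fin n) ℝ, V * Vᵀ = 1 ∧ V *ᵥ p = q ∧ Vᵀ = V ∧
      ∀ r : Fin n → ℝ, r ⬝ᵥ p = r ⬝ᵥ q → V *ᵥ r = r := by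
  by_cases hpq : p = q
  · exact ⟨1, by simp, by simp [hpq], by simp, by simp⟩
  set z := p - q with hz
  have hz0 : z ⬝ᵥ z ≠ 0 := by
    intro h
    exact hpq (sub_eq_zero.1 (dotProduct_self_eq_zero.1 h))
  have hzz : z ⬝ᵥ z = 2 - 2 * (p ⬝ᵥ q) := by
    rw [hz]
    simp only [sub_dotProduct, dotProduct_sub, hp, hq, dotProduct_comm q p]
    ring
  have hzp : z ⬝ᵥ p = (z ⬝ᵥ z) / 2 := by
    rw [hzz, hz, sub_dotProduct, hp, dotProduct_comm q p]; ring
  set V : Matrix (Fin n) (Fin n) ℝ := 1 - (2 / (z ⬝ᵥ z)) • Matrix.vecMulVec z z with hV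
  have hVt : Vᵀ = V := by
    rw [hV]
    simp [Matrix.transpose_sub, Matrix.transpose_smul, Matrix.transpose_vecMulVec]
  have hVr : ∀ r, V *ᵥ r = r - (2 / (z ⬝ᵥ z) * (z ⬝ᵥ r)) • z := by
    intro r
    rw [hV, Matrix.sub_mulVec, Matrix.one_mulVec, Matrix.smul_mulVec, Matrix.vecMulVec_mulVec]
    ext i
    simp; ring
  refine ⟨V, ?_, ?_, hVt, ?_⟩
  · rw [hVt]
    apply Matrix.ext_of_mulVec_single
    intro i
    rw [← Matrix.mulVec_mulVec, hVr, hVr]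
    simp only [dotProduct_sub, dotProduct_smul, smul_eq_mul, Matrix.one_mulVec]
    ext j
    simp only [Pi.sub_apply, Pi.smul_apply, smul_eq_mul]
    field_simp
    ring
  · rw [hVr, hzp]
    have : 2 / (z ⬝ᵥ z) * (z ⬝ᵥ z / 2) = 1 := by field_simp
    rw [this, hz]; simp
  · intro r hr
    rw [hVr]
    have : z ⬝ᵥ r = 0 := by
      rw [hz, sub_dotProduct, dotProduct_comm p, dotProduct_comm q, hr, sub_self]
    rw [this]; simp

/-- standard Gaussian vector -/
noncomputable abbrev gam (n : ℕ) : Measure (Fin n → ℝ) :=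
  Measure.pi fun _ : Fin n => gaussianReal 0 1

lemma gam_rot {n : ℕ} (M : Matrix (Fin n) (Fin n) ℝ) (hM : M * Mᵀ = 1) :
    (gam n).map (fun g => g ᵥ* M) = gam n := by
  have hv : Orthonormal ℝ ((Set.univ : Set (Fin n)).domRestrict
      (fun i => WithLp.toLp 2 (M i) : Fin n → EuclideanSpace ℝ (Fin n))) := by
    rw [orthonormal_iff_ite]
    rintro ⟨i, _⟩ ⟨j, _⟩
    have h := congrFun (congrFun hM i) j
    rw [Matrix.mul_apply, Matrix.one_apply] at h
    simp only [Set.domRestrict_apply, PiLp.inner_apply, Subtype.mk.injEq]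
    rw [← h]
    refine Finset.sum_congr rfl fun k _ => ?_
    simp [mul_comm]
  obtain ⟨b, hb⟩ := hv.exists_orthonormalBasis_extension_of_card_eq (by simp)
  have h1 := stdGaussian_eq_map_pi_orthonormalBasis b
  have hfun : (fun x : Fin n → ℝ => ∑ i, x i • b i) =
      (WithLp.toLp 2) ∘ (fun g : Fin n → ℝ => g ᵥ* M) := by
    ext x j
    simp [hb, Matrix.vecMul, dotProduct]
  have hmeas : Measurable (fun g : Fin n → ℝ => g ᵥ* M) := by
    refine measurable_pi_iff.2 fun j => ?_
    simp only [Matrix.vecMul, dotProduct]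
    fun_prop
  rw [hfun, ← map_pi_eq_stdGaussian, ← Measure.map_map (by fun_prop) hmeas] at h1
  have h2 := congrArg (fun ν => Measure.map (WithLp.ofLp) ν) h1
  simp only at h2
  rw [Measure.map_map (by fun_prop) (by fun_prop), Measure.map_map (by fun_prop) (by fun_prop)] at h2
  have hid : (WithLp.ofLp ∘ WithLp.toLp 2 : (Fin n → ℝ) → (Fin n → ℝ)) = id := rfl
  rw [hid, Measure.map_id, Measure.map_id] at h2
  exact h2.symm

lemma single_dot_self {n : ℕ} (a : Fin n) :
    (Pi.single a 1 : Fin n → ℝ) ⬝ᵥ Pi.single a 1 = 1 := by simp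

lemma gam_lin {n : ℕ} (a : Fin n) (y : Fin n → ℝ) (hy : y ⬝ᵥ y = 1) :
    (gam n).map (fun h => h ⬝ᵥ y) = gaussianReal 0 1 := by
  obtain ⟨V, hV, hVp, hVt, -⟩ := householder (Pi.single a 1) y (single_dot_self a) hy
  have hmeas : Measurable (fun g : Fin n → ℝ => g ᵥ* V) := by
    refine measurable_pi_iff.2 fun j => ?_
    simp only [Matrix.vecMul, dotProduct]
    fun_prop
  have hfun : (fun h : Fin n → ℝ => h ⬝ᵥ y) = (Function.eval a) ∘ (fun g => g ᵥ* V) := by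
    ext h
    simp only [Function.comp, Function.eval]
    rw [← hVp, Matrix.dotProduct_mulVec]
    simp
  rw [hfun, ← Measure.map_map (measurable_pi_apply a) hmeas, gam_rot V hV]
  exact (measurePreserving_eval (fun _ : Fin n => gaussianReal 0 1) a).map_eq

lemma gam_ae_ne {n : ℕ} (b : Fin n) : ∀ᵐ h ∂(gam n), h b ≠ 0 := by
  have h1 : gaussianReal 0 1 {(0 : ℝ)} = 0 := by
    have := nullSingletonClass_gaussianReal (μ := 0) (v := 1) (by simp)
    simp
  have h2 : ∀ᵐ s ∂(gaussianReal 0 1), s ≠ (0 : ℝ) := by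
    rw [ae_iff]; simpa using h1
  exact (measurePreserving_eval (fun _ : Fin n => gaussianReal 0 1) b).quasiMeasurePreserving.ae h2

lemma mat_meas_entry {n : ℕ} (i j : Fin n) :
    Measurable (fun M : Matrix (Fin n) (Fin n) ℝ => M i j) :=
  (measurable_pi_apply j).comp (measurable_pi_apply i)

lemma mat_meas_left {n : ℕ} (V : Matrix (Fin n) (Fin n) ℝ) :
    Measurable (fun M : Matrix (Fin n) (Fin n) ℝ => V * M) := by
  refine measurable_pi_iff.2 fun i => measurable_pi_iff.2 fun j => ?_
  simp only [Matrix.mul_apply]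
  exact Finset.measurable_sum _ fun k _ => (mat_meas_entry k j).const_mul _

lemma mat_meas_right {n : ℕ} (V : Matrix (Fin n) (Fin n) ℝ) :
    Measurable (fun M : Matrix (Fin n) (Fin n) ℝ => M * V) := by
  refine measurable_pi_iff.2 fun i => measurable_pi_iff.2 fun j => ?_
  simp only [Matrix.mul_apply]
  exact Finset.measurable_sum _ fun k _ => (mat_meas_entry i k).mul_const _

lemma mat_meas_conj {n : ℕ} (σ : Equiv.Perm (Fin n)) (a b : Fin n) :
    Measurable (fun M : Matrix (Fin n) (Fin n) ℝ => (M * σ.permMatrix ℝ * Mᵀ) a b) := by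
  simp only [permMatrix_conj]
  exact Finset.measurable_sum _ fun k _ => (mat_meas_entry _ _).mul (mat_meas_entry _ _)

lemma row_law {n : ℕ} (μ : Measure (Matrix (Fin n) (Fin n) ℝ)) (hμ : IsHaarOrthogonal n μ)
    (a : Fin n) (C : Set (Fin n → ℝ)) (hC : MeasurableSet C)
    (hcone : ∀ (r : ℝ) w, 0 < r → w ∈ C → r • w ∈ C) :
    μ {M | M a ∈ C} = gam n C := by
  have := hμ.isProb
  have hmj : Measurable (fun p : Matrix (Fin n) (Fin n) ℝ × (Fin n → ℝ) => p.2 ᵥ* p.1) := by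
    refine measurable_pi_iff.2 fun j => ?_
    simp only [Matrix.vecMul, dotProduct]
    refine Finset.measurable_sum _ fun k _ => ?_
    exact ((measurable_pi_apply k).comp measurable_snd).mul
      ((mat_meas_entry k j).comp measurable_fst)
  set E : Set (Matrix (Fin n) (Fin n) ℝ × (Fin n → ℝ)) := {p | p.2 ᵥ* p.1 ∈ C} with hE
  have hEm : MeasurableSet E := hmj hC
  have h1 : (μ.prod (gam n)) E = gam n C := by
    rw [Measure.prod_apply hEm]
    have : ∀ᵐ M ∂μ, gam n (Prod.mk M ⁻¹' E) = gam n C := by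
      filter_upwards [hμ.ae_orth] with M hM
      conv_rhs => rw [← gam_rot M hM]
      rw [Measure.map_apply _ hC]
      · rfl
      · refine measurable_pi_iff.2 fun j => ?_
        simp only [Matrix.vecMul, dotProduct]
        fun_prop
    rw [lintegral_congr_ae this]
    simp
  have h2 : (μ.prod (gam n)) E = μ {M | M a ∈ C} := by
    rw [Measure.prod_apply_symm hEm]
    have : ∀ᵐ g ∂(gam n), μ ((fun M => (M, g)) ⁻¹' E) = μ {M | M a ∈ C} := by
      filter_upwards [gam_ae_ne a] with g hg
      have hgg : 0 < g ⬝ᵥ g := by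
        refine lt_of_le_of_ne (Finset.sum_nonneg fun i _ => mul_self_nonneg _) ?_
        intro h0
        exact hg (congrFun (dotProduct_self_eq_zero.1 h0.symm) a)
      set r := Real.sqrt (g ⬝ᵥ g) with hr
      have hr0 : 0 < r := Real.sqrt_pos.2 hgg
      have hrr : r * r = g ⬝ᵥ g := Real.mul_self_sqrt hgg.le
      obtain ⟨V, hV, hVp, hVt, -⟩ := householder (Pi.single a 1) (r⁻¹ • g) (single_dot_self a)
        (by
          rw [smul_dotProduct, dotProduct_smul, ← hrr, smul_eq_mul, smul_eq_mul]
          field_simp)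
      have hrow : ∀ M : Matrix (Fin n) (Fin n) ℝ, (V * M) a = r⁻¹ • (g ᵥ* M) := by
        intro M
        rw [← Matrix.smul_vecMul, ← hVp]
        ext j
        rw [Matrix.mul_apply, Matrix.vecMul, dotProduct]
        refine Finset.sum_congr rfl fun k _ => ?_
        congr 1
        rw [Matrix.mulVec_single_one]
        conv_lhs => rw [← hVt]
        rfl
      have hm : MeasurableSet {M : Matrix (Fin n) (Fin n) ℝ | M a ∈ C} :=
        (measurable_pi_apply a) hC
      conv_rhs => rw [← hμ.left_inv V hV]
      rw [Measure.map_apply (mat_meas_left V) hm]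
      congr 1
      ext M
      simp only [hE, Set.mem_preimage, Set.mem_ofPred_eq, hrow]
      constructor
      · exact hcone _ _ (inv_pos.2 hr0)
      · intro h
        have := hcone r _ hr0 h
        rwa [smul_smul, mul_inv_cancel₀ hr0.ne', one_smul] at this
    rw [lintegral_congr_ae this]
    simp
  rw [← h1, h2]

lemma diag_law {n : ℕ} (μ : Measure (Matrix (Fin n) (Fin n) ℝ)) (hμ : IsHaarOrthogonal n μ)
    (σ : Equiv.Perm (Fin n)) (a : Fin n) (s x : ℝ) (V : Matrix (Fin n) (Fin n) ℝ) (l : Fin n → ℝ)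
    (hV : V * Vᵀ = 1) (hl : ∀ (M : Matrix (Fin n) (Fin n) ℝ) a,
        (M * σ.permMatrix ℝ * Mᵀ) a a = ∑ i, l i * ((M * V) a i) ^ 2) :
    μ {M | s * ((M * σ.permMatrix ℝ * Mᵀ) a a) ≤ x} =
      gam n {g | s * ∑ i, l i * g i ^ 2 ≤ x * ∑ i, g i ^ 2} := by
  have hCm : MeasurableSet {g : Fin n → ℝ | s * ∑ i, l i * g i ^ 2 ≤ x * ∑ i, g i ^ 2} := by
    refine measurableSet_le ?_ ?_ <;> fun_prop
  rw [← row_law μ hμ a _ hCm]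
  · have hm : MeasurableSet {M : Matrix (Fin n) (Fin n) ℝ | M a ∈
        {g : Fin n → ℝ | s * ∑ i, l i * g i ^ 2 ≤ x * ∑ i, g i ^ 2}} :=
      (measurable_pi_apply a) hCm
    conv_rhs => rw [← hμ.right_inv V hV]
    rw [Measure.map_apply (mat_meas_right V) hm]
    refine measure_congr ?_
    filter_upwards [hμ.ae_orth] with M hM
    have h1 : ∑ i, ((M * V) a i) ^ 2 = 1 := by
      have : (M * V) * (M * V)ᵀ = 1 := by
        rw [Matrix.transpose_mul, Matrix.mul_assoc, ← Matrix.mul_assoc V, hV, Matrix.one_mul, hM]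
      have := congrFun (congrFun this a) a
      rw [Matrix.mul_apply, Matrix.one_apply_eq] at this
      rw [← this]
      refine Finset.sum_congr rfl fun j _ => ?_
      rw [Matrix.transpose_apply]; ring
    apply propext
    change s * ((M * σ.permMatrix ℝ * Mᵀ) a a) ≤ x ↔
      s * ∑ i, l i * ((M * V) a i) ^ 2 ≤ x * ∑ i, ((M * V) a i) ^ 2
    rw [h1, hl, mul_one]
  · intro r w hr hw
    simp only [Set.mem_ofPred_eq, Pi.smul_apply, smul_eq_mul, mul_pow] at hw ⊢
    have e1 : s * ∑ i, l i * (r ^ 2 * w i ^ 2) = r ^ 2 * (s * ∑ i, l i * w i ^ 2) := by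
      simp only [Finset.mul_sum]
      exact Finset.sum_congr rfl fun i _ => by ring
    have e2 : x * ∑ i, (r ^ 2 * w i ^ 2) = r ^ 2 * (x * ∑ i, w i ^ 2) := by
      simp only [Finset.mul_sum]
      exact Finset.sum_congr rfl fun i _ => by ring
    rw [e1, e2]
    exact mul_le_mul_of_nonneg_left hw (sq_nonneg r)

lemma cone_equiv {n : ℕ} (l g : Fin n → ℝ) (x u m : ℝ) (hu : 0 < u) (hn : (n : ℝ) = m)
    (hm : m * u ^ 2 = 1) :
    (Real.sqrt m * ∑ i, l i * g i ^ 2 ≤ x * ∑ i, g i ^ 2) ↔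
      ∑ i, (Real.sqrt 2 * (l i * u - x * u ^ 2)) * ysq (g i) + u * ∑ i, l i ≤ x := by
  have hs : Real.sqrt m = u⁻¹ := by
    have : m = (u⁻¹) ^ 2 := by field_simp; linarith
    rw [this, Real.sqrt_sq (inv_pos.2 hu).le]
  have h2 : Real.sqrt 2 ≠ 0 := by positivity
  have e : ∑ i, (Real.sqrt 2 * (l i * u - x * u ^ 2)) * ysq (g i) =
      u * ∑ i, l i * g i ^ 2 - x * u ^ 2 * ∑ i, g i ^ 2 - u * ∑ i, l i + x := by
    have h1 : ∀ i, (Real.sqrt 2 * (l i * u - x * u ^ 2)) * ysq (g i) =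
        u * (l i * g i ^ 2) - x * u ^ 2 * g i ^ 2 - u * l i + x * u ^ 2 := by
      intro i; unfold ysq; field_simp; ring
    simp only [h1, Finset.sum_add_distrib, Finset.sum_sub_distrib, ← Finset.mul_sum,
      Finset.sum_const, Finset.card_univ, Fintype.card_fin, nsmul_eq_mul, hn]
    linear_combination x * hm
  rw [e, hs]
  set A := ∑ i, l i * g i ^ 2
  set B := ∑ i, g i ^ 2
  have hk : u⁻¹ * A ≤ x * B ↔ u ^ 2 * (u⁻¹ * A) ≤ u ^ 2 * (x * B) :=
    (mul_le_mul_iff_right₀ (by positivity)).symm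
  have e3 : u ^ 2 * (u⁻¹ * A) = u * A := by field_simp
  rw [hk, e3]
  constructor <;> intro h <;> linarith

lemma diag_unif (μ : ∀ n : ℕ, Measure (Matrix (Fin (n + 1)) (Fin (n + 1)) ℝ))
    (hμ : ∀ n, IsHaarOrthogonal (n + 1) (μ n)) (x : ℝ) :
    ∀ ε > (0 : ℝ), ∃ N : ℕ, ∀ n ≥ N, ∀ σ : Equiv.Perm (Fin (n + 1)), ∀ a : Fin (n + 1),
      (cycleCount σ : ℝ) ≤ 2 * Real.log (n + 1) →
      |((μ n) {M | Real.sqrt (n + 1) * ((M * σ.permMatrix ℝ * Mᵀ) a a) ≤ x}).toReal -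
        ((gaussianReal 0 1) (Set.Iic x)).toReal| < ε := by
  intro ε hε
  by_contra hcon
  push Not at hcon
  choose n hn σ a hσ hbad using hcon
  choose V l hV hl hl1 hl2 hl3 using fun k => spectral_perm (σ k)
  set u : ℕ → ℝ := fun k => (Real.sqrt ((n k : ℝ) + 1))⁻¹ with hu
  have hn1 : ∀ k, 0 < (n k : ℝ) + 1 := fun k => by positivity
  have hu0 : ∀ k, 0 < u k := fun k => inv_pos.2 (Real.sqrt_pos.2 (hn1 k))
  have hmu : ∀ k, ((n k : ℝ) + 1) * u k ^ 2 = 1 := fun k => by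
    rw [hu]
    simp only [inv_pow]
    rw [Real.sq_sqrt (hn1 k).le, mul_inv_cancel₀ (hn1 k).ne']
  have hmt : Tendsto (fun k => (n k : ℝ) + 1) atTop atTop := by
    refine tendsto_atTop_add_const_right _ _ ?_
    refine tendsto_natCast_atTop_atTop.comp ?_
    exact tendsto_atTop_mono hn tendsto_id
  have hut : Tendsto u atTop (𝓝 0) :=
    tendsto_inv_atTop_zero.comp (Real.tendsto_sqrt_atTop.comp hmt)
  have hlog : Tendsto (fun k => Real.log ((n k : ℝ) + 1) * u k) atTop (𝓝 0) := by
    have h := (isLittleO_log_rpow_atTop (r := 1 / 2) (by norm_num)).tendsto_div_nhds_zero.comp hmt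
    refine h.congr fun k => ?_
    simp only [Function.comp, hu]
    rw [← Real.sqrt_eq_rpow, div_eq_mul_inv]
  set F : ℕ → ℝ := fun k => ((Finset.univ.filter fun y => σ k y = y).card : ℝ) with hF
  set G : ℕ → ℝ := fun k => ((Finset.univ.filter fun y => (σ k * σ k) y = y).card : ℝ) with hG
  have hFle : ∀ k, F k ≤ 2 * Real.log (n k + 1) := fun k => by
    refine le_trans ?_ (hσ k)
    simp only [hF, cycleCount]
    push_cast
    have : (0 : ℝ) ≤ ((σ k).cycleType.card : ℝ) := by positivity
    linarith
  have hGle : ∀ k, G k ≤ 4 * Real.log (n k + 1) := fun k => by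
    have h1 : G k ≤ 2 * (cycleCount (σ k) : ℝ) := by
      simp only [hG]; exact_mod_cast fix_sq_card (σ k)
    have := hσ k
    linarith
  have hFt : Tendsto (fun k => u k * F k) atTop (𝓝 0) := by
    have h2 : Tendsto (fun k => 2 * (Real.log ((n k : ℝ) + 1) * u k)) atTop (𝓝 0) := by
      simpa using hlog.const_mul 2
    refine squeeze_zero (fun k => ?_) (fun k => ?_) h2
    · exact mul_nonneg (hu0 k).le (by simp [hF])
    · nlinarith [hFle k, hu0 k]
  have hGt : Tendsto (fun k => u k * G k) atTop (𝓝 0) := by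
    have h2 : Tendsto (fun k => 4 * (Real.log ((n k : ℝ) + 1) * u k)) atTop (𝓝 0) := by
      simpa using hlog.const_mul 4
    refine squeeze_zero (fun k => ?_) (fun k => ?_) h2
    · exact mul_nonneg (hu0 k).le (by simp [hG])
    · nlinarith [hGle k, hu0 k]
  have hclt := clt_seq (fun k => n k + 1)
    (fun k i => Real.sqrt 2 * (l k i * u k - x * u k ^ 2)) (fun k => u k * ∑ i, l k i)
    (fun k => Real.sqrt 2 * (u k + |x| * u k ^ 2)) ?_ ?_ ?_ ?_ x
  · have hev := (Metric.tendsto_nhds.1 hclt ε hε).exists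
    obtain ⟨k, hk⟩ := hev
    rw [Real.dist_eq] at hk
    refine absurd hk (not_lt.2 ?_)
    refine (hbad k).trans (le_of_eq ?_)
    congr 3
    rw [diag_law (μ (n k)) (hμ (n k)) (σ k) (a k) _ x (V k) (l k) (hV k) (hl k)]
    congr 1
    ext g
    exact cone_equiv (l k) g x (u k) _ (hu0 k) (by push_cast; rfl) (hmu k)
  · have e : ∀ k, ∑ i, (Real.sqrt 2 * (l k i * u k - x * u k ^ 2)) ^ 2 =
        1 + u k * G k * u k - 4 * x * (u k * F k) * u k ^ 2 + 2 * x ^ 2 * u k ^ 2 := by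
      intro k
      have h1 : ∀ i, (Real.sqrt 2 * (l k i * u k - x * u k ^ 2)) ^ 2 =
          2 * u k ^ 2 * l k i ^ 2 - 4 * x * u k ^ 3 * l k i + 2 * x ^ 2 * u k ^ 4 := by
        intro i
        rw [mul_pow, Real.sq_sqrt (by norm_num)]
        ring
      simp only [h1, Finset.sum_add_distrib, Finset.sum_sub_distrib, ← Finset.mul_sum,
        Finset.sum_const, Finset.card_univ, Fintype.card_fin, nsmul_eq_mul, hl2, hl3]
      change 2 * u k ^ 2 * (((((n k + 1 : ℕ)) : ℝ) + G k) / 2) - 4 * x * u k ^ 3 * F k +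
        2 * x ^ 2 * (((n k + 1 : ℕ) : ℝ) * u k ^ 4) = _
      push_cast
      linear_combination (1 + 2 * x ^ 2 * u k ^ 2) * hmu k
    simp_rw [e]
    have := (((hGt.mul hut).const_add 1).sub ((hFt.const_mul (4 * x)).mul (hut.pow 2))).add
      ((hut.pow 2).const_mul (2 * x ^ 2))
    simpa using this
  · have := ((hut.add ((hut.pow 2).const_mul |x|)).const_mul (Real.sqrt 2))
    simpa using this
  · intro k i
    rw [abs_mul, abs_of_nonneg (Real.sqrt_nonneg 2)]
    refine mul_le_mul_of_nonneg_left ?_ (Real.sqrt_nonneg 2)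
    refine (abs_sub _ _).trans ?_
    rw [abs_mul, abs_mul, abs_of_pos (hu0 k), abs_of_nonneg (sq_nonneg (u k))]
    have := mul_le_mul_of_nonneg_right (hl1 k i) (hu0 k).le
    linarith
  · simp_rw [hl2]
    exact hFt

lemma slutsky {Ω : Type*} [MeasurableSpace Ω] (P : Measure Ω) [IsProbabilityMeasure P]
    (X : Ω → ℝ) (hXm : Measurable X) (hX : P.map X = gaussianReal 0 1) (E A : Set Ω) (x δ : ℝ)
    (h1 : ∀ ω, ω ∉ A → X ω ≤ x - δ → ω ∈ E) (h2 : ∀ ω, ω ∉ A → ω ∈ E → X ω ≤ x + δ) :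
    |P.real E - (gaussianReal 0 1).real (Set.Iic x)| ≤
      (gaussianReal 0 1).real (Set.Icc (x - δ) (x + δ)) + P.real A := by
  have hI : ∀ t, P.real (X ⁻¹' Set.Iic t) = (gaussianReal 0 1).real (Set.Iic t) := by
    intro t
    rw [← hX, map_measureReal_apply hXm measurableSet_Iic]
  have a1 : P.real E ≤ P.real (X ⁻¹' Set.Iic (x + δ)) + P.real A := by
    refine (measureReal_mono ?_).trans (measureReal_union_le _ _)
    intro ω hω
    by_cases hA : ω ∈ A
    · exact Or.inr hA
    · exact Or.inl (h2 ω hA hω)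
  have a2 : P.real (X ⁻¹' Set.Iic (x - δ)) ≤ P.real E + P.real A := by
    refine (measureReal_mono ?_).trans (measureReal_union_le _ _)
    intro ω hω
    by_cases hA : ω ∈ A
    · exact Or.inr hA
    · exact Or.inl (h1 ω hA hω)
  have a3 : (gaussianReal 0 1).real (Set.Iic x) ≤ (gaussianReal 0 1).real (Set.Iic (x - δ)) +
      (gaussianReal 0 1).real (Set.Icc (x - δ) (x + δ)) := by
    by_cases hδ : 0 ≤ δ
    · refine (measureReal_mono ?_).trans (measureReal_union_le _ _)
      intro t ht
      simp only [Set.mem_Iic, Set.mem_union, Set.mem_Icc] at *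
      rcases le_total t (x - δ) with h | h
      · exact Or.inl h
      · exact Or.inr ⟨h, by linarith⟩
    · have : (gaussianReal 0 1).real (Set.Iic x) ≤ (gaussianReal 0 1).real (Set.Iic (x - δ)) :=
        measureReal_mono (Set.Iic_subset_Iic.2 (by linarith))
      linarith [measureReal_nonneg (μ := gaussianReal 0 1) (s := Set.Icc (x - δ) (x + δ))]
  have a4 : (gaussianReal 0 1).real (Set.Iic (x + δ)) ≤ (gaussianReal 0 1).real (Set.Iic x) +
      (gaussianReal 0 1).real (Set.Icc (x - δ) (x + δ)) := by
    by_cases hδ : 0 ≤ δ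
    · refine (measureReal_mono ?_).trans (measureReal_union_le _ _)
      intro t ht
      simp only [Set.mem_Iic, Set.mem_union, Set.mem_Icc] at *
      rcases le_total t x with h | h
      · exact Or.inl h
      · exact Or.inr ⟨by linarith, ht⟩
    · have : (gaussianReal 0 1).real (Set.Iic (x + δ)) ≤ (gaussianReal 0 1).real (Set.Iic x) :=
        measureReal_mono (Set.Iic_subset_Iic.2 (by linarith))
      linarith [measureReal_nonneg (μ := gaussianReal 0 1) (s := Set.Icc (x - δ) (x + δ))]
  rw [hI] at a1 a2
  rw [abs_le]
  constructor <;> linarith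

lemma tail_abs {Ω : Type*} [MeasurableSpace Ω] (P : Measure Ω) [IsProbabilityMeasure P]
    (f : Ω → ℝ) (hf : Measurable f) (L : ℝ) :
    P.real {ω | L < |f ω|} ≤ P.real {ω | f ω ≤ -L} + (1 - P.real {ω | f ω ≤ L}) := by
  have hm : MeasurableSet {ω | f ω ≤ L} := measurableSet_le hf measurable_const
  rw [← probReal_compl_eq_one_sub hm]
  refine (measureReal_mono ?_).trans (measureReal_union_le _ _)
  intro ω hω
  rcases lt_abs.1 (show L < |f ω| from hω) with h | h
  · exact Or.inr (not_le.2 h)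
  · exact Or.inl (show f ω ≤ -L by linarith)

lemma gauss_tails (ε : ℝ) (hε : 0 < ε) : ∃ K : ℝ, 0 < K ∧
    (gaussianReal 0 1).real (Set.Iic (-K)) < ε ∧ 1 - (gaussianReal 0 1).real (Set.Iic K) < ε := by
  have t1 : Tendsto (fun t => (gaussianReal 0 1).real (Set.Iic t)) atTop (𝓝 1) := by
    have := tendsto_cdf_atTop (gaussianReal 0 1)
    refine this.congr fun t => ?_
    rw [cdf_eq_real]
  have t2 : Tendsto (fun t => (gaussianReal 0 1).real (Set.Iic t)) atBot (𝓝 0) := by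
    have := tendsto_cdf_atBot (gaussianReal 0 1)
    refine this.congr fun t => ?_
    rw [cdf_eq_real]
  have e1 := t1.eventually (lt_mem_nhds (show 1 - ε < 1 by linarith))
  have e2 := (t2.comp tendsto_neg_atTop_atBot).eventually (gt_mem_nhds hε)
  obtain ⟨K, h1, h2, h3⟩ := (e1.and (e2.and (eventually_gt_atTop 0))).exists
  exact ⟨K, h3, h2, by linarith⟩

lemma gauss_window (x ε : ℝ) (hε : 0 < ε) : ∃ δ : ℝ, 0 < δ ∧
    (gaussianReal 0 1).real (Set.Icc (x - δ) (x + δ)) < ε := by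
  have := nullSingletonClass_gaussianReal (μ := 0) (v := 1) (by simp)
  have h := tendsto_measure_Icc (gaussianReal 0 1) x
  have h2 : Tendsto (fun δ => (gaussianReal 0 1).real (Set.Icc (x - δ) (x + δ))) (𝓝 0) (𝓝 0) := by
    have := (ENNReal.tendsto_toReal ENNReal.zero_ne_top).comp h
    simpa [Measure.real, Function.comp_def] using this
  have e2 := (h2.mono_left (nhdsWithin_le_nhds (s := Set.Ioi 0))).eventually (gt_mem_nhds hε)
  obtain ⟨δ, h1, h3⟩ := (e2.and self_mem_nhdsWithin).exists
  exact ⟨δ, h3, h1⟩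

lemma chi_conc {n : ℕ} (c : ℝ) (hc : 0 < c) (hn : 0 < n) :
    (gam n).real {h | c * n ≤ |∑ k, ysq (h k)|} ≤ 1 / (c ^ 2 * n) := by
  have hn' : (0 : ℝ) < n := by exact_mod_cast hn
  have hL : ∀ k : Fin n, MemLp (fun h : Fin n → ℝ => ysq (h k)) 2 (gam n) := fun k =>
    ysq_memLp.comp_measurePreserving (measurePreserving_eval (fun _ : Fin n => gaussianReal 0 1) k)
  have hS : MemLp (fun h : Fin n → ℝ => ∑ k, ysq (h k)) 2 (gam n) := by
    exact memLp_finsetSum _ fun k _ => hL k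
  have hmean : ∫ h, ∑ k, ysq (h k) ∂(gam n) = 0 := by
    rw [integral_finsetSum _ fun k _ => (hL k).integrable (by norm_num)]
    refine Finset.sum_eq_zero fun k _ => ?_
    have := integral_comp_eval (μ := fun _ : Fin n => gaussianReal 0 1) (i := k) (f := ysq)
      ysq_meas.aestronglyMeasurable
    rw [this, ysq_mean]
  have hvar : variance (fun h : Fin n → ℝ => ∑ k, ysq (h k)) (gam n) = n := by
    have := variance_sum_pi (μ := fun _ : Fin n => gaussianReal 0 1) (X := fun _ => ysq)
      (fun _ => ysq_memLp)
    have e : (fun h : Fin n → ℝ => ∑ k, ysq (h k)) = ∑ k, fun h : Fin n → ℝ => ysq (h k) := by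
      ext h; simp
    rw [e, this]
    have hv : variance ysq (gaussianReal 0 1) = 1 := by
      rw [variance_of_integral_eq_zero ysq_meas.aemeasurable ysq_mean]
      exact ysq_sq
    simp [hv]
  have := meas_ge_le_variance_div_sq hS (c := c * n) (by positivity)
  rw [hvar, hmean] at this
  simp only [sub_zero] at this
  have h2 := ENNReal.toReal_mono ENNReal.ofReal_ne_top this
  rw [ENNReal.toReal_ofReal (by positivity)] at h2
  refine h2.trans (le_of_eq ?_)
  field_simp

/-- zero out a coordinate -/
def hp {n : ℕ} (a : Fin n) (h : Fin n → ℝ) : Fin n → ℝ := fun k => if k = a then 0 else h k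

lemma hp_meas {n : ℕ} (a k : Fin n) : Measurable (fun h : Fin n → ℝ => hp a h k) := by
  unfold hp
  split_ifs
  · exact measurable_const
  · exact measurable_pi_apply k

lemma conj_meas2 {n : ℕ} (σ : Equiv.Perm (Fin n)) (a k : Fin n) :
    Measurable (fun p : Matrix (Fin n) (Fin n) ℝ × (Fin n → ℝ) =>
      (p.1 * σ.permMatrix ℝ * p.1ᵀ) a k) :=
  (mat_meas_conj σ a k).comp measurable_fst

lemma off_law {n : ℕ} (μ : Measure (Matrix (Fin n) (Fin n) ℝ)) (hμ : IsHaarOrthogonal n μ)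
    (σ : Equiv.Perm (Fin n)) (a b : Fin n) (hab : a ≠ b) (s x : ℝ) :
    μ {M | s * ((M * σ.permMatrix ℝ * Mᵀ) a b) ≤ x} =
      (μ.prod (gam n)) {p | s * ∑ k, (p.1 * σ.permMatrix ℝ * p.1ᵀ) a k * hp a p.2 k ≤
        x * Real.sqrt (∑ k, hp a p.2 k ^ 2)} := by
  have := hμ.isProb
  set E : Set (Matrix (Fin n) (Fin n) ℝ × (Fin n → ℝ)) :=
    {p | s * ∑ k, (p.1 * σ.permMatrix ℝ * p.1ᵀ) a k * hp a p.2 k ≤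
        x * Real.sqrt (∑ k, hp a p.2 k ^ 2)} with hE
  have hEm : MeasurableSet E := by
    refine measurableSet_le ?_ ?_
    · refine Measurable.const_mul (Finset.measurable_sum _ fun k _ => ?_) _
      exact (conj_meas2 σ a k).mul ((hp_meas a k).comp measurable_snd)
    · refine Measurable.const_mul (Measurable.sqrt (Finset.measurable_sum _ fun k _ => ?_)) _
      exact ((hp_meas a k).comp measurable_snd).pow_const 2
  rw [Measure.prod_apply_symm hEm]
  have : ∀ᵐ h ∂(gam n), μ ((fun M => (M, h)) ⁻¹' E) =
      μ {M | s * ((M * σ.permMatrix ℝ * Mᵀ) a b) ≤ x} := by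
    filter_upwards [gam_ae_ne b] with h hb
    set g := hp a h with hg
    have hgb : g b ≠ 0 := by simp [hg, hp, hab.symm, hb]
    have hga : g a = 0 := by simp [hg, hp]
    have hgg : 0 < g ⬝ᵥ g := by
      refine lt_of_le_of_ne (Finset.sum_nonneg fun i _ => mul_self_nonneg _) ?_
      intro h0
      exact hgb (congrFun (dotProduct_self_eq_zero.1 h0.symm) b)
    set r := Real.sqrt (g ⬝ᵥ g) with hr
    have hr0 : 0 < r := Real.sqrt_pos.2 hgg
    have hrr : r * r = g ⬝ᵥ g := Real.mul_self_sqrt hgg.le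
    have hr' : Real.sqrt (∑ k, g k ^ 2) = r := by
      rw [hr]; congr 1
      exact Finset.sum_congr rfl fun k _ => by ring
    obtain ⟨V, hV, hVp, hVt, hVf⟩ := householder (Pi.single b 1) (r⁻¹ • g) (single_dot_self b)
      (by
        rw [smul_dotProduct, dotProduct_smul, ← hrr, smul_eq_mul, smul_eq_mul]
        field_simp)
    have hVa : V *ᵥ Pi.single a 1 = Pi.single a 1 := by
      apply hVf
      simp [hga, hab]
    have hconj : ∀ M : Matrix (Fin n) (Fin n) ℝ,
        ((V * M) * σ.permMatrix ℝ * (V * M)ᵀ) a b =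
          r⁻¹ * ∑ k, (M * σ.permMatrix ℝ * Mᵀ) a k * g k := by
      intro M
      have e : (V * M) * σ.permMatrix ℝ * (V * M)ᵀ = V * (M * σ.permMatrix ℝ * Mᵀ) * V := by
        rw [Matrix.transpose_mul, hVt]
        simp only [Matrix.mul_assoc]
      rw [e]
      set W := M * σ.permMatrix ℝ * Mᵀ
      have ca : ∀ k, V a k = (Pi.single a 1 : Fin n → ℝ) k := by
        intro k
        rw [← hVa, Matrix.mulVec_single_one]
        conv_lhs => rw [← hVt]
        rfl
      have cb : ∀ k, V k b = r⁻¹ * g k := by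
        intro k
        have := congrFun hVp k
        rw [Matrix.mulVec_single_one] at this
        exact this
      have hrow : ∀ k, (V * W) a k = W a k := by
        intro k
        rw [Matrix.mul_apply]
        simp [ca, Pi.single_apply]
      rw [Matrix.mul_apply, Finset.mul_sum]
      refine Finset.sum_congr rfl fun k _ => ?_
      rw [hrow, cb]; ring
    have hm : MeasurableSet {M : Matrix (Fin n) (Fin n) ℝ |
        s * ((M * σ.permMatrix ℝ * Mᵀ) a b) ≤ x} :=
      measurableSet_le ((mat_meas_conj σ a b).const_mul s) measurable_const
    conv_rhs => rw [← hμ.left_inv V hV]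
    rw [Measure.map_apply (mat_meas_left V) hm]
    refine congrArg μ (Set.ext fun M => ?_)
    simp only [hE, Set.mem_preimage, Set.mem_ofPred_eq, hconj]
    rw [← hg, hr']
    set T := ∑ k, (M * σ.permMatrix ℝ * Mᵀ) a k * g k
    have : s * (r⁻¹ * T) = s * T / r := by field_simp
    rw [this, div_le_iff₀ hr0]
  rw [lintegral_congr_ae this]
  simp

lemma conj_row_unit {n : ℕ} (M : Matrix (Fin n) (Fin n) ℝ) (hM : M * Mᵀ = 1)
    (σ : Equiv.Perm (Fin n)) (a : Fin n) :
    (fun k => (M * σ.permMatrix ℝ * Mᵀ) a k) ⬝ᵥ (fun k => (M * σ.permMatrix ℝ * Mᵀ) a k) = 1 := by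
  have hM' : Mᵀ * M = 1 := mul_eq_one_comm.1 hM
  have hQ : σ.permMatrix ℝ * (σ.permMatrix ℝ)ᵀ = 1 := by
    rw [Matrix.transpose_permMatrix, ← Matrix.permMatrix_mul]
    simp
  have h : (M * σ.permMatrix ℝ * Mᵀ) * (M * σ.permMatrix ℝ * Mᵀ)ᵀ = 1 := by
    rw [Matrix.transpose_mul, Matrix.transpose_mul, Matrix.transpose_transpose]
    calc M * σ.permMatrix ℝ * Mᵀ * (M * ((σ.permMatrix ℝ)ᵀ * Mᵀ))
        = M * (σ.permMatrix ℝ * (Mᵀ * M) * (σ.permMatrix ℝ)ᵀ) * Mᵀ := by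
          simp only [Matrix.mul_assoc]
      _ = 1 := by rw [hM', Matrix.mul_one, hQ, Matrix.mul_one, hM]
  have := congrFun (congrFun h a) a
  rw [Matrix.mul_apply, Matrix.one_apply_eq] at this
  exact this

lemma lin_meas {n : ℕ} (σ : Equiv.Perm (Fin n)) (a : Fin n) :
    Measurable (fun p : Matrix (Fin n) (Fin n) ℝ × (Fin n → ℝ) =>
      p.2 ⬝ᵥ (fun k => (p.1 * σ.permMatrix ℝ * p.1ᵀ) a k)) := by
  simp only [dotProduct]
  refine Finset.measurable_sum _ fun k _ => ?_
  exact ((measurable_pi_apply k).comp measurable_snd).mul (conj_meas2 σ a k)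

lemma lin_law {n : ℕ} (μ : Measure (Matrix (Fin n) (Fin n) ℝ)) (hμ : IsHaarOrthogonal n μ)
    (σ : Equiv.Perm (Fin n)) (a : Fin n) :
    (μ.prod (gam n)).map (fun p => p.2 ⬝ᵥ (fun k => (p.1 * σ.permMatrix ℝ * p.1ᵀ) a k)) =
      gaussianReal 0 1 := by
  have := hμ.isProb
  ext S hS
  rw [Measure.map_apply (lin_meas σ a) hS, Measure.prod_apply ((lin_meas σ a) hS)]
  have : ∀ᵐ M ∂μ, gam n (Prod.mk M ⁻¹' ((fun p : Matrix (Fin n) (Fin n) ℝ × (Fin n → ℝ) =>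
      p.2 ⬝ᵥ (fun k => (p.1 * σ.permMatrix ℝ * p.1ᵀ) a k)) ⁻¹' S)) = gaussianReal 0 1 S := by
    filter_upwards [hμ.ae_orth] with M hM
    have hy := conj_row_unit M hM σ a
    rw [← gam_lin a _ hy, Measure.map_apply _ hS]
    · rfl
    · simp only [dotProduct]
      fun_prop
  rw [lintegral_congr_ae this]
  simp

lemma off_core {m X x S ya ha c K η δ T : ℝ} (hm : 0 < m) (hS : S = m + Real.sqrt 2 * T - ha ^ 2)
    (hS0 : 0 ≤ S) (hT : |T| ≤ c * m) (hha : |ha| ≤ K) (hya : |ya| ≤ η) (hc : 0 ≤ c)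
    (hδ : |x| * (2 * c + K ^ 2 / m) + η * K ≤ δ) :
    (X ≤ x - δ → Real.sqrt m * (X - ya * ha) ≤ x * Real.sqrt S) ∧
    (Real.sqrt m * (X - ya * ha) ≤ x * Real.sqrt S → X ≤ x + δ) := by
  have hsm : 0 < Real.sqrt m := Real.sqrt_pos.2 hm
  set R := Real.sqrt S / Real.sqrt m with hR
  have hR0 : 0 ≤ R := by positivity
  have hRS : R ^ 2 = S / m := by
    rw [hR, div_pow, Real.sq_sqrt hS0, Real.sq_sqrt hm.le]
  have h2 : Real.sqrt 2 ≤ 2 := by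
    rw [Real.sqrt_le_left (by norm_num)]; norm_num
  have hR1 : |R - 1| ≤ 2 * c + K ^ 2 / m := by
    have e : (R - 1) * (R + 1) = Real.sqrt 2 * (T / m) - ha ^ 2 / m := by
      have : (R - 1) * (R + 1) = R ^ 2 - 1 := by ring
      rw [this, hRS, hS]; field_simp; ring
    have e2 : |R - 1| ≤ |(R - 1) * (R + 1)| := by
      rw [abs_mul, abs_of_nonneg (show 0 ≤ R + 1 by linarith)]
      nlinarith [abs_nonneg (R - 1)]
    rw [e] at e2
    refine e2.trans ((abs_sub _ _).trans (add_le_add ?_ ?_))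
    · rw [abs_mul, abs_of_nonneg (Real.sqrt_nonneg 2), abs_div, abs_of_pos hm]
      have : |T| / m ≤ c := by rw [div_le_iff₀ hm]; exact hT
      exact mul_le_mul h2 this (by positivity) (by norm_num)
    · rw [abs_div, abs_of_pos hm, abs_pow]
      gcongr
  have hb : |x * (R - 1) + ya * ha| ≤ δ := by
    refine (abs_add_le _ _).trans (le_trans (add_le_add ?_ ?_) hδ)
    · rw [abs_mul]; gcongr
    · rw [abs_mul]
      exact mul_le_mul hya hha (abs_nonneg _) ((abs_nonneg _).trans hya)
  have hiff : Real.sqrt m * (X - ya * ha) ≤ x * Real.sqrt S ↔ X ≤ x * R + ya * ha := by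
    have : x * Real.sqrt S = Real.sqrt m * (x * R) := by rw [hR]; field_simp
    rw [this, mul_le_mul_iff_right₀ hsm]
    constructor <;> intro h <;> linarith
  rw [hiff]
  have := abs_le.1 hb
  constructor <;> intro h <;> linarith

lemma off_unif (μ : ∀ n : ℕ, Measure (Matrix (Fin (n + 1)) (Fin (n + 1)) ℝ))
    (hμ : ∀ n, IsHaarOrthogonal (n + 1) (μ n)) (x : ℝ) :
    ∀ ε > (0 : ℝ), ∃ N : ℕ, ∀ n ≥ N, ∀ σ : Equiv.Perm (Fin (n + 1)), ∀ a b : Fin (n + 1), a ≠ b →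
      (cycleCount σ : ℝ) ≤ 2 * Real.log (n + 1) →
      |((μ n) {M | Real.sqrt (n + 1) * ((M * σ.permMatrix ℝ * Mᵀ) a b) ≤ x}).toReal -
        ((gaussianReal 0 1) (Set.Iic x)).toReal| < ε := by
  intro ε hε
  obtain ⟨δ, hδ0, hδ⟩ := gauss_window x (ε / 8) (by linarith)
  obtain ⟨K, hK0, hK1, hK2⟩ := gauss_tails (ε / 16) (by linarith)
  obtain ⟨N1, hN1⟩ := diag_unif μ hμ (-K) (ε / 16) (by linarith)
  obtain ⟨N2, hN2⟩ := diag_unif μ hμ K (ε / 16) (by linarith)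
  set c := δ / (6 * (|x| + 1)) with hc
  have hx1 : 0 < |x| + 1 := by positivity
  have hc0 : 0 < c := by positivity
  set η := δ / (3 * K) with hη
  have hη0 : 0 < η := by positivity
  have hmt : Tendsto (fun n : ℕ => (n : ℝ) + 1) atTop atTop :=
    tendsto_atTop_add_const_right _ _ tendsto_natCast_atTop_atTop
  have ev1 := hmt.eventually (eventually_gt_atTop (8 / (ε * c ^ 2)))
  have ev2 := hmt.eventually (eventually_ge_atTop (3 * |x| * K ^ 2 / δ))
  have ev3 := hmt.eventually (eventually_ge_atTop ((K / η) ^ 2))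
  obtain ⟨N3, hN3⟩ := eventually_atTop.1 (ev1.and (ev2.and ev3))
  refine ⟨max N1 (max N2 N3), fun n hn σ a b hab hσ => ?_⟩
  have hn1 : n ≥ N1 := (le_max_left _ _).trans hn
  have hn2 : n ≥ N2 := ((le_max_left _ _).trans (le_max_right _ _)).trans hn
  have hn3 : n ≥ N3 := ((le_max_right _ _).trans (le_max_right _ _)).trans hn
  obtain ⟨q1, q2, q3⟩ := hN3 n hn3
  have d1 := hN1 n hn1 σ a hσ
  have d2 := hN2 n hn2 σ a hσ
  set m : ℝ := (n : ℝ) + 1 with hm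
  have hm0 : 0 < m := by positivity
  have hprob := (hμ n).isProb
  have hsq : K ≤ Real.sqrt m * η := by
    have := Real.le_sqrt_of_sq_le q3
    rwa [div_le_iff₀ hη0] at this
  have hδ' : |x| * (2 * c + K ^ 2 / m) + η * K ≤ δ := by
    have e1 : |x| * (2 * c) ≤ δ / 3 := by
      have : |x| * (2 * c) = (|x| / (|x| + 1)) * (δ / 3) := by rw [hc]; field_simp; ring
      rw [this]
      have : |x| / (|x| + 1) ≤ 1 := by rw [div_le_one hx1]; linarith
      nlinarith
    have e2 : |x| * (K ^ 2 / m) ≤ δ / 3 := by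
      rw [div_le_iff₀ hδ0] at q2
      rw [← mul_div_assoc, div_le_iff₀ hm0]
      linarith
    have e3 : η * K = δ / 3 := by rw [hη]; field_simp
    rw [mul_add]; linarith
  -- bad sets
  set A1 : Set (Fin (n + 1) → ℝ) := {h | c * ((n + 1 : ℕ) : ℝ) ≤ |∑ k, ysq (h k)|} with hA1
  set A2 : Set (Matrix (Fin (n + 1)) (Fin (n + 1)) ℝ) :=
    {M | K < |Real.sqrt m * (M * σ.permMatrix ℝ * Mᵀ) a a|} with hA2
  set A3 : Set (Fin (n + 1) → ℝ) := {h | K < |h a|} with hA3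
  have b1 : (gam (n + 1)).real A1 < ε / 8 := by
    refine (chi_conc c hc0 (Nat.succ_pos n)).trans_lt ?_
    push_cast
    rw [div_lt_iff₀ (by positivity)] at q1 ⊢
    nlinarith
  have b2 : (μ n).real A2 < ε / 4 := by
    refine (tail_abs (μ n) _ ((mat_meas_conj σ a a).const_mul _) K).trans_lt ?_
    have d1' := abs_lt.1 d1
    have d2' := abs_lt.1 d2
    simp only [Measure.real] at hK1 hK2 ⊢
    linarith [d1'.2, d2'.1]
  have b3 : (gam (n + 1)).real A3 < ε / 8 := by
    refine (tail_abs (gam (n + 1)) _ (measurable_pi_apply a) K).trans_lt ?_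
    have hmp := measurePreserving_eval (fun _ : Fin (n + 1) => gaussianReal 0 1) a
    have e : ∀ t : ℝ, (gam (n + 1)).real {h | h a ≤ t} = (gaussianReal 0 1).real (Set.Iic t) := by
      intro t
      exact hmp.measureReal_preimage measurableSet_Iic.nullMeasurableSet
    rw [e, e]
    linarith
  have hlaw := off_law (μ n) (hμ n) σ a b hab (Real.sqrt m) x
  have key := slutsky ((μ n).prod (gam (n + 1))) _ (lin_meas σ a) (lin_law (μ n) (hμ n) σ a)
    {p | Real.sqrt m * ∑ k, (p.1 * σ.permMatrix ℝ * p.1ᵀ) a k * hp a p.2 k ≤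
        x * Real.sqrt (∑ k, hp a p.2 k ^ 2)}
    ((Set.univ ×ˢ A1 ∪ A2 ×ˢ Set.univ) ∪ Set.univ ×ˢ A3) x δ
  have hcore : ∀ p : Matrix (Fin (n + 1)) (Fin (n + 1)) ℝ × (Fin (n + 1) → ℝ),
      p ∉ ((Set.univ ×ˢ A1 ∪ A2 ×ˢ Set.univ) ∪ Set.univ ×ˢ A3) →
      (p.2 ⬝ᵥ (fun k => (p.1 * σ.permMatrix ℝ * p.1ᵀ) a k) ≤ x - δ →
        Real.sqrt m * ∑ k, (p.1 * σ.permMatrix ℝ * p.1ᵀ) a k * hp a p.2 k ≤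
        x * Real.sqrt (∑ k, hp a p.2 k ^ 2)) ∧
      (Real.sqrt m * ∑ k, (p.1 * σ.permMatrix ℝ * p.1ᵀ) a k * hp a p.2 k ≤
        x * Real.sqrt (∑ k, hp a p.2 k ^ 2) →
        p.2 ⬝ᵥ (fun k => (p.1 * σ.permMatrix ℝ * p.1ᵀ) a k) ≤ x + δ) := by
    rintro ⟨M, h⟩ hpA
    simp only [Set.mem_union, Set.mem_prod, Set.mem_univ, true_and, and_true, not_or] at hpA
    obtain ⟨⟨n1, n2⟩, n3⟩ := hpA
    have n1' : |∑ k, ysq (h k)| ≤ c * m := by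
      have := (not_le.1 (show ¬ (c * ((n + 1 : ℕ) : ℝ) ≤ |∑ k, ysq (h k)|) from n1)).le
      push_cast at this
      exact this
    have n3' : |h a| ≤ K := not_lt.1 (show ¬ (K < |h a|) from n3)
    have n2' : |(M * σ.permMatrix ℝ * Mᵀ) a a| ≤ η := by
      have h0 : |Real.sqrt m * (M * σ.permMatrix ℝ * Mᵀ) a a| ≤ K :=
        not_lt.1 (show ¬ (K < |Real.sqrt m * (M * σ.permMatrix ℝ * Mᵀ) a a|) from n2)
      rw [abs_mul, abs_of_nonneg (Real.sqrt_nonneg m)] at h0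
      exact le_of_mul_le_mul_left (h0.trans hsq) (Real.sqrt_pos.2 hm0)
    dsimp only
    have hpk : ∀ k, hp a h k = h k - if k = a then h a else 0 := by
      intro k
      unfold hp
      split_ifs with hk
      · rw [hk]; ring
      · ring
    have eX : ∑ k, (M * σ.permMatrix ℝ * Mᵀ) a k * hp a h k =
        h ⬝ᵥ (fun k => (M * σ.permMatrix ℝ * Mᵀ) a k) - (M * σ.permMatrix ℝ * Mᵀ) a a * h a := by
      simp only [hpk, mul_sub, Finset.sum_sub_distrib, dotProduct, mul_ite, mul_zero,
        Finset.sum_ite_eq', Finset.mem_univ, if_true]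
      congr 1
      exact Finset.sum_congr rfl fun k _ => mul_comm _ _
    have eS : ∑ k, hp a h k ^ 2 = m + Real.sqrt 2 * (∑ k, ysq (h k)) - h a ^ 2 := by
      have e1 : ∀ k, hp a h k ^ 2 = h k ^ 2 - if k = a then h a ^ 2 else 0 := by
        intro k
        unfold hp
        split_ifs with hk
        · rw [hk]; ring
        · ring
      have e2 : ∀ k, h k ^ 2 = 1 + Real.sqrt 2 * ysq (h k) := by
        intro k
        have h2 : Real.sqrt 2 ≠ 0 := by positivity
        unfold ysq
        field_simp
        ring
      simp only [e1, Finset.sum_sub_distrib, Finset.sum_ite_eq', Finset.mem_univ, if_true]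
      simp only [e2, Finset.sum_add_distrib, ← Finset.mul_sum, Finset.sum_const, Finset.card_univ,
        Fintype.card_fin, nsmul_eq_mul, mul_one]
      push_cast
      ring
    rw [eX]
    exact off_core hm0 eS (Finset.sum_nonneg fun k _ => sq_nonneg _) n1' n3' n2' hc0.le hδ'
  have key2 := key (fun p hpA => (hcore p hpA).1) (fun p hpA => (hcore p hpA).2)
  have hA : ((μ n).prod (gam (n + 1))).real
      ((Set.univ ×ˢ A1 ∪ A2 ×ˢ Set.univ) ∪ Set.univ ×ˢ A3) < ε / 2 := by
    refine (measureReal_union_le _ _).trans_lt ?_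
    have := measureReal_union_le (μ := (μ n).prod (gam (n + 1))) (Set.univ ×ˢ A1) (A2 ×ˢ Set.univ)
    simp only [measureReal_prod_prod, probReal_univ, one_mul, mul_one] at this ⊢
    linarith
  rw [hlaw]
  simp only [Measure.real] at key2 hA hδ
  linarith

end helpers

/-- uniformly over permutation matrices `Q_n` with at most `2 log n` cycles,
the distribution function of `√n (M Q_n Mᵀ)_{ab}` converges to the standard normal one. -/
theorem stmt8 (μ : ∀ n : ℕ, Measure (Matrix (Fin (n + 1)) (Fin (n + 1)) ℝ))
    (hμ : ∀ n, IsHaarOrthogonal (n + 1) (μ n)) (a b : ∀ n : ℕ, Fin (n + 1)) (x : ℝ) :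
    ∀ ε > (0 : ℝ), ∃ N : ℕ, ∀ n ≥ N, ∀ σ : Equiv.Perm (Fin (n + 1)),
      (cycleCount σ : ℝ) ≤ 2 * Real.log (n + 1) →
      |((μ n) {M | Real.sqrt (n + 1) * ((M * σ.permMatrix ℝ * Mᵀ) (a n) (b n)) ≤ x}).toReal -
        ((gaussianReal 0 1) (Set.Iic x)).toReal| < ε := by
  intro ε hε
  obtain ⟨N1, h1⟩ := diag_unif μ hμ x ε hε
  obtain ⟨N2, h2⟩ := off_unif μ hμ x ε hε
  refine ⟨max N1 N2, fun n hn σ hσ => ?_⟩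
  by_cases hab : a n = b n
  · rw [← hab]
    exact h1 n ((le_max_left _ _).trans hn) σ (a n) hσ
  · exact h2 n ((le_max_right _ _).trans hn) σ (a n) (b n) hab hσ
end
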